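/- arXiv:1812.11768 — 6 statements merged into one kernel-verified Lean document; each statement's English description precedes it below -/
import Mathlib

section
/- Suppose κ, λ, δ are infinite cardinals with κ ≤ δ, λ ≤ δ, and κ^λ ≥ δ. Then there is a structure 𝔄 in a countable first-order language whose underlying set is the set of ordinals below the initial ordinal of δ such that for every elementary substructure 𝔅 of 𝔄, |𝔅 ∩ κ|^{|𝔅 ∩ λ|} ≥ |𝔅|, where 𝔅 ∩ κ denotes the set of elements of 𝔅 that are ordinals below the initial ordinal of κ, and similarly for λ. -/
open Cardinal Ordinal

theorem chang_model_arithmetic (κ lam δ : Cardinal.{0})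
    (hκ : ℵ₀ ≤ κ) (hlam : ℵ₀ ≤ lam) (hδ : ℵ₀ ≤ δ)
    (hκδ : κ ≤ δ) (hlamδ : lam ≤ δ) (hpow : δ ≤ κ ^ lam) :
    ∃ (L : FirstOrder.Language.{0,0}) (_ : Countable L.Symbols)
      (_ : L.Structure (Set.Iio δ.ord)),
      ∀ B : L.ElementarySubstructure (Set.Iio δ.ord),
        #B ≤ #{x : Set.Iio δ.ord // x ∈ B ∧ x.val < κ.ord} ^
              #{x : Set.Iio δ.ord // x ∈ B ∧ x.val < lam.ord} := by
  classical
  have hG : #(Set.Iio δ.ord) ≤ #(Set.Iio lam.ord → Set.Iio κ.ord) := by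
    rw [← Cardinal.power_def, Cardinal.mk_Iio_ordinal, Cardinal.mk_Iio_ordinal,
      Cardinal.mk_Iio_ordinal, card_ord, card_ord, card_ord, ← Cardinal.lift_power]
    exact Cardinal.lift_le.2 hpow
  obtain ⟨G⟩ := hG
  have hκ' : κ.ord ≤ δ.ord := Cardinal.ord_le_ord.2 hκδ
  have hlam' : lam.ord ≤ δ.ord := Cardinal.ord_le_ord.2 hlamδ
  have hpos : 0 < lam.ord := by
    rw [Cardinal.lt_ord, Ordinal.card_zero]
    exact lt_of_lt_of_le Cardinal.aleph0_pos hlam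
  have hex : ∀ a b : Set.Iio δ.ord, ∃ ξ : Set.Iio lam.ord, a ≠ b → G a ξ ≠ G b ξ := by
    intro a b
    by_cases h : a = b
    · exact ⟨⟨0, hpos⟩, fun h' => absurd h h'⟩
    · obtain ⟨ξ, hξ⟩ := Function.ne_iff.1 (G.injective.ne h)
      exact ⟨ξ, fun _ => hξ⟩
  choose d hd using hex
  let f : Set.Iio δ.ord → Set.Iio δ.ord → Set.Iio δ.ord := fun a x =>
    if h : x.val < lam.ord then ⟨(G a ⟨x.val, h⟩).val, (G a ⟨x.val, h⟩).2.trans_le hκ'⟩ else x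
  let e : Set.Iio δ.ord → Set.Iio δ.ord → Set.Iio δ.ord := fun a b =>
    ⟨(d a b).val, (d a b).2.trans_le hlam'⟩
  let z : Set.Iio δ.ord := ⟨0, hpos.trans_le hlam'⟩
  let L : FirstOrder.Language.{0,0} := ⟨fun _ => Bool, fun _ => Empty⟩
  let S : L.Structure (Set.Iio δ.ord) :=
    { funMap := fun {n} b v => match n, b, v with
        | 2, true, v => f (v 0) (v 1)
        | 2, false, v => e (v 0) (v 1)
        | _, _, _ => z
      RelMap := fun r => Empty.elim r }
  refine ⟨L, ?_, S, ?_⟩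
  · change Countable ((Σ _ : ℕ, Bool) ⊕ (Σ _ : ℕ, Empty))
    infer_instance
  · intro B
    have hf : ∀ a ∈ B, ∀ b ∈ B, f a b ∈ B := by
      intro a ha b hb
      have := B.toSubstructure.fun_mem (n := 2) (show L.Functions 2 from true) ![a, b]
        (by intro i; fin_cases i <;> assumption)
      exact this
    have he : ∀ a ∈ B, ∀ b ∈ B, e a b ∈ B := by
      intro a ha b hb
      have := B.toSubstructure.fun_mem (n := 2) (show L.Functions 2 from false) ![a, b]
        (by intro i; fin_cases i <;> assumption)
      exact this
    rw [Cardinal.power_def]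
    refine Cardinal.mk_le_of_injective (f := fun (a : B) x => ⟨f a.1 x.1, hf _ a.2 _ x.2.1, ?_⟩) ?_
    · simp only [f, dif_pos x.2.2]
      exact (G a.1 ⟨x.1.1, x.2.2⟩).2
    · intro a b hab
      by_contra hne
      have hne' : a.1 ≠ b.1 := fun h => hne (Subtype.ext h)
      have h1 := congrFun hab ⟨e a.1 b.1, he _ a.2 _ b.2, (d a.1 b.1).2⟩
      have h2 := congrArg (fun z => z.1.1) h1
      have h3 : (e a.1 b.1).val < lam.ord := (d a.1 b.1).2
      simp only [f, dif_pos h3] at h2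
      exact hd _ _ hne' (Subtype.ext h2)
end

section
/- Suppose (κ₁,κ₀) ↠ (μ₁,μ₀), ν is a cardinal with ν ≤ κ₀, and κ₀^ν ≥ κ₁. Then μ₀^{min(μ₀,ν)} ≥ μ₁. -/
open Cardinal Ordinal

/-- Chang's Conjecture `(κ₁,κ₀) ↠ (μ₁,μ₀)`: every structure in a countable first-order
language on the set of ordinals below the initial ordinal of `κ₁` has a substructure of
cardinality `μ₁` whose intersection with the ordinals below the initial ordinal of `κ₀`
has cardinality `μ₀`. -/
def ChangCC (κ₁ κ₀ μ₁ μ₀ : Cardinal.{0}) : Prop :=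
  ∀ (L : FirstOrder.Language.{0,0}) (_ : Countable L.Symbols) (_ : L.Structure (Set.Iio κ₁.ord)),
    ∃ B : L.Substructure (Set.Iio κ₁.ord),
      #B = Cardinal.lift.{1,0} μ₁ ∧
      #{x : Set.Iio κ₁.ord // x ∈ B ∧ x.val < κ₀.ord} = Cardinal.lift.{1,0} μ₀

theorem chang_arithmetic (κ₁ κ₀ μ₁ μ₀ ν : Cardinal.{0})
    (hκ₀ : ℵ₀ ≤ κ₀) (hμ₀ : ℵ₀ ≤ μ₀) (hκ : κ₀ ≤ κ₁) (hμ : μ₀ ≤ μ₁)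
    (hcc : ChangCC κ₁ κ₀ μ₁ μ₀) (hν : ν ≤ κ₀) (hpow : κ₁ ≤ κ₀ ^ ν) :
    μ₁ ≤ μ₀ ^ (min μ₀ ν) := by
  classical
  have hνo : ν.ord ≤ κ₀.ord := Cardinal.ord_le_ord.2 hν
  have hκo : κ₀.ord ≤ κ₁.ord := Cardinal.ord_le_ord.2 hκ
  have hinj : #(Set.Iio κ₁.ord) ≤ #(Set.Iio ν.ord → Set.Iio κ₀.ord) := by
    have := Cardinal.lift_le.{1,0}.2 hpow
    simpa [Cardinal.mk_Iio_ordinal] using this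
  obtain ⟨f, hf⟩ := hinj
  let X := Set.Iio κ₁.ord
  let g : X → X → X := fun a i =>
    if h : i.val < ν.ord then ⟨(f a ⟨i.val, h⟩).val, lt_of_lt_of_le (f a ⟨i.val, h⟩).2 hκo⟩ else i
  have hg : ∀ a i, i.val < ν.ord → (g a i).val < κ₀.ord := by
    intro a i h
    simp only [g, dif_pos h]
    exact (f a ⟨i.val, h⟩).2
  have hd : ∀ a b : X, ∃ i : X, a ≠ b → i.val < ν.ord ∧ g a i ≠ g b i := by
    intro a b
    by_cases hab : a = b
    · exact ⟨a, fun h => absurd hab h⟩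
    · have : f a ≠ f b := fun h => hab (hf h)
      obtain ⟨i, hi⟩ := Function.ne_iff.1 this
      refine ⟨⟨i.val, lt_of_lt_of_le i.2 (hνo.trans hκo)⟩, fun _ => ⟨i.2, fun h => hi ?_⟩⟩
      have hi2 : i.val < ν.ord := i.2
      simp only [g, dif_pos hi2] at h
      exact Subtype.ext (congrArg (fun z : X => z.val) h)
  choose d hd using hd
  let L : FirstOrder.Language.{0,0} := ⟨fun n => {_b : Bool // n = 2}, fun _ => Empty⟩
  have hL : Countable L.Symbols := by
    change Countable ((Σ n : ℕ, {_b : Bool // n = 2}) ⊕ (Σ _n : ℕ, Empty))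
    infer_instance
  let S : L.Structure X :=
    { funMap := fun {n} b x =>
        if b.1 then g (x ⟨0, by have := b.2; omega⟩) (x ⟨1, by have := b.2; omega⟩)
        else d (x ⟨0, by have := b.2; omega⟩) (x ⟨1, by have := b.2; omega⟩)
      RelMap := fun r _ => r.elim }
  obtain ⟨B, hB, hA⟩ := hcc L hL S
  have hBg : ∀ a ∈ B, ∀ i ∈ B, g a i ∈ B := by
    intro a ha i hi
    exact B.fun_mem (n := 2) ⟨true, rfl⟩ ![a, i] (by intro j; fin_cases j <;> assumption)
  have hBd : ∀ a ∈ B, ∀ i ∈ B, d a i ∈ B := by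
    intro a ha i hi
    exact B.fun_mem (n := 2) ⟨false, rfl⟩ ![a, i] (by intro j; fin_cases j <;> assumption)
  let A := {x : X // x ∈ B ∧ x.val < κ₀.ord}
  let N := {x : X // x ∈ B ∧ x.val < ν.ord}
  have hA' : #A = Cardinal.lift.{1,0} μ₀ := hA
  have h1 : #B ≤ #(N → A) := by
    refine Cardinal.mk_le_of_injective
      (f := fun a (i : N) => (⟨g a.1 i.1, hBg _ a.2 _ i.2.1, hg _ _ i.2.2⟩ : A)) ?_
    intro a b hab
    by_contra hne
    have hne' : a.1 ≠ b.1 := fun h => hne (Subtype.ext h)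
    have h := hd a.1 b.1 hne'
    have := congrFun hab ⟨d a.1 b.1, hBd _ a.2 _ b.2, h.1⟩
    exact h.2 (congrArg Subtype.val this)
  have h2 : #N ≤ Cardinal.lift.{1,0} μ₀ := by
    rw [← hA']
    refine Cardinal.mk_le_of_injective
      (f := fun i : N => (⟨i.1, i.2.1, i.2.2.trans_le hνo⟩ : A)) ?_
    intro a b h
    exact Subtype.ext (congrArg (fun z : A => z.1) h)
  have h3 : #N ≤ Cardinal.lift.{1,0} ν := by
    have : #(Set.Iio ν.ord) = Cardinal.lift.{1,0} ν := by simp [Cardinal.mk_Iio_ordinal]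
    rw [← this]
    refine Cardinal.mk_le_of_injective (f := fun i : N => (⟨i.1.1, i.2.2⟩ : Set.Iio ν.ord)) ?_
    intro a b h
    exact Subtype.ext (Subtype.ext (congrArg (fun z : Set.Iio ν.ord => z.1) h))
  have h4 : Cardinal.lift.{1,0} μ₁ ≤ Cardinal.lift.{1,0} (μ₀ ^ (min μ₀ ν)) := by
    rw [← hB, Cardinal.lift_power, Cardinal.lift_min]
    refine h1.trans ?_
    rw [← Cardinal.power_def, hA']
    refine Cardinal.power_le_power_left ?_ (le_min h2 h3)
    intro h
    rw [Cardinal.lift_eq_zero] at h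
    exact (Cardinal.aleph0_pos.trans_le hμ₀).ne' h
  exact Cardinal.lift_le.1 h4
end

section
/- Assume GCH. If κ and μ are infinite cardinals and (κ⁺,κ) ↠ (μ⁺,μ), then cf(κ) ≥ cf(μ). -/
open Cardinal Ordinal

theorem gch_power_le
    (GCH : ∀ c : Cardinal.{0}, ℵ₀ ≤ c → 2 ^ c = Order.succ c)
    (μ θ : Cardinal.{0}) (hμ : ℵ₀ ≤ μ) (hθ : θ < μ.ord.cof) : μ ^ θ ≤ μ := by
  have hθμ : θ < μ := hθ.trans_le (Ordinal.cof_ord_le μ)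
  have key : ∀ c : Cardinal.{0}, c < μ → c ^ θ ≤ μ := by
    intro c hc
    rcases lt_or_ge (max c θ) ℵ₀ with h | h
    · exact (power_lt_aleph0 ((le_max_left _ _).trans_lt h)
        ((le_max_right _ _).trans_lt h)).le.trans hμ
    · calc c ^ θ ≤ (2 ^ max c θ) ^ θ :=
            power_le_power_right ((le_max_left c θ).trans (cantor _).le)
        _ = 2 ^ (max c θ * θ) := by rw [power_mul]
        _ ≤ 2 ^ max c θ := by
            apply power_le_power_left two_ne_zero
            exact mul_le_of_le h le_rfl (le_max_right _ _)
        _ = Order.succ (max c θ) := GCH _ h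
        _ ≤ μ := Order.succ_le_of_lt (max_lt hc hθμ)
  have hb : ∀ f : θ.out → μ.ord.ToType, ∃ t, ∀ i, f i < t := by
    intro f
    by_contra! hcon
    have hcof : IsCofinal (Set.range f) := by
      intro t
      obtain ⟨i, hi⟩ := hcon t
      exact ⟨f i, ⟨i, rfl⟩, hi⟩
    have h1 := Order.cof_le hcof
    rw [Ordinal.cof_toType] at h1
    have h2 : #(Set.range f) ≤ θ := by simpa using mk_range_le (f := f)
    exact absurd hθ (not_lt.2 (h1.trans h2))
  choose t ht using hb
  have hinj : Function.Injective
      (fun f : θ.out → μ.ord.ToType =>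
        (⟨t f, fun i => ⟨f i, ht f i⟩⟩ : Σ s : μ.ord.ToType, (θ.out → Set.Iio s))) := by
    intro f g hfg
    have h3 := congrArg (fun p : (Σ s : μ.ord.ToType, (θ.out → Set.Iio s)) =>
      fun i => ((p.2 i : Set.Iio p.1) : μ.ord.ToType)) hfg
    exact h3
  have h := mk_le_of_injective hinj
  have e : #(θ.out → μ.ord.ToType) = μ ^ θ := by simp
  rw [e, mk_sigma] at h
  refine h.trans ?_
  calc Cardinal.sum (fun s : μ.ord.ToType => #(θ.out → Set.Iio s))
      ≤ Cardinal.sum (fun s : μ.ord.ToType => μ) := by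
        apply sum_le_sum
        intro s
        have : #(θ.out → Set.Iio s) = #(Set.Iio s) ^ θ := by simp
        rw [this]
        exact key _ (mk_Iio_toType_ord_lt s)
    _ = μ := by
        rw [sum_const']
        simp [mul_eq_self hμ]

theorem mk_below (κ c : Cardinal.{0}) (h : c ≤ κ) :
    #{x : Set.Iio κ.ord // x.val < c.ord} = Cardinal.lift.{1,0} c := by
  have e : {x : Set.Iio κ.ord // x.val < c.ord} ≃ Set.Iio c.ord :=
    { toFun := fun x => ⟨x.1.1, x.2⟩
      invFun := fun x => ⟨⟨x.1, lt_of_lt_of_le x.2 (ord_le_ord.2 h)⟩, x.2⟩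
      left_inv := fun x => rfl
      right_inv := fun x => rfl }
  rw [mk_congr e, Cardinal.mk_Iio_ordinal, card_ord]

def changLang : FirstOrder.Language.{0,0} := ⟨fun n => {_b : Bool // n = 2}, fun _ => Empty⟩

theorem changLang_countable : Countable changLang.Symbols := by
  unfold FirstOrder.Language.Symbols changLang
  infer_instance

def changStr {S : Type 1} (F : Bool → S → S → S) : changLang.Structure S where
  funMap := fun {n} b x => F b.1 (x ⟨0, by rw [b.2]; decide⟩) (x ⟨1, by rw [b.2]; decide⟩)
  RelMap := fun r _ => Empty.elim r

theorem changStr_closed {S : Type 1} (F : Bool → S → S → S)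
    (B : @FirstOrder.Language.Substructure changLang S (changStr F)) (b : Bool) (x y : S)
    (hx : x ∈ B) (hy : y ∈ B) : F b x y ∈ B := by
  letI := changStr F
  have := B.fun_mem (n := 2) (⟨b, rfl⟩ : {_b : Bool // 2 = 2}) ![x, y]
    (by intro i; fin_cases i <;> assumption)
  exact this

theorem chang_cof_of_gch
    (GCH : ∀ c : Cardinal.{0}, ℵ₀ ≤ c → 2 ^ c = Order.succ c)
    (κ μ : Cardinal.{0}) (hκ : ℵ₀ ≤ κ) (hμ : ℵ₀ ≤ μ)
    (hcc : ChangCC (Order.succ κ) κ (Order.succ μ) μ) :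
    μ.ord.cof ≤ κ.ord.cof := by
  classical
  by_contra! hlt
  have hpow := gch_power_le GCH μ κ.ord.cof hμ hlt
  set θ := κ.ord.cof with hθ
  have hK := mk_below (Order.succ κ) κ (Order.le_succ κ)
  have hT := mk_below (Order.succ κ) θ ((Ordinal.cof_ord_le κ).trans (Order.le_succ κ))
  have hle : #(Set.Iio (Order.succ κ).ord) ≤
      #({x : Set.Iio (Order.succ κ).ord // x.val < θ.ord} →
        {x : Set.Iio (Order.succ κ).ord // x.val < κ.ord}) := by
    rw [← power_def, hK, hT, ← lift_power, Cardinal.mk_Iio_ordinal, card_ord, Cardinal.lift_le]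
    exact Order.succ_le_of_lt (lt_power_cof_ord hκ)
  obtain ⟨f, hf⟩ := hle
  have hd : ∀ a b, a ≠ b → ∃ i, f a i ≠ f b i := fun a b hab =>
    Function.ne_iff.1 (fun h => hab (hf h))
  choose d hd using hd
  obtain ⟨B, hB1, hB2⟩ := hcc changLang changLang_countable (changStr (fun b x y =>
    if b then (if h : y.val < θ.ord then (f x ⟨y, h⟩).1 else y)
    else (if h : x ≠ y then (d x y h).1 else x)))
  have hclF : ∀ x y (h : y.val < θ.ord), x ∈ B → y ∈ B → (f x ⟨y, h⟩).1 ∈ B := by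
    intro x y h hx hy
    have := changStr_closed _ B true x y hx hy
    simpa [h] using this
  have hclD : ∀ x y (h : x ≠ y), x ∈ B → y ∈ B → (d x y h).1 ∈ B := by
    intro x y h hx hy
    have := changStr_closed _ B false x y hx hy
    simpa [h] using this
  let TB := {x : Set.Iio (Order.succ κ).ord // x ∈ B ∧ x.val < θ.ord}
  let KB := {x : Set.Iio (Order.succ κ).ord // x ∈ B ∧ x.val < κ.ord}
  have hTB : #TB ≤ Cardinal.lift.{1,0} θ := by
    rw [← hT]
    exact mk_le_of_injective (f := fun x : TB => ⟨x.1, x.2.2⟩) (by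
      intro x y hxy
      exact Subtype.ext (congrArg (fun z => z.1) hxy))
  have hinj : Function.Injective (fun (x : B) (i : TB) =>
      (⟨(f x.1 ⟨i.1, i.2.2⟩).1, hclF _ _ _ x.2 i.2.1, (f x.1 ⟨i.1, i.2.2⟩).2⟩ : KB)) := by
    intro x y hxy
    by_contra hne
    have hne' : x.1 ≠ y.1 := fun h => hne (Subtype.ext h)
    have h1 := congrFun hxy ⟨(d _ _ hne').1, hclD _ _ hne' x.2 y.2, (d _ _ hne').2⟩
    exact hd _ _ hne' (Subtype.ext (congrArg (fun z : KB => z.1) h1))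
  have h := mk_le_of_injective hinj
  have hμ0 : Cardinal.lift.{1,0} μ ≠ 0 := by
    simpa using (aleph0_pos.trans_le hμ).ne'
  rw [hB1, ← power_def] at h
  have h2 : Cardinal.lift.{1,0} (Order.succ μ) ≤ Cardinal.lift.{1,0} μ :=
    calc _ ≤ #KB ^ #TB := h
      _ = Cardinal.lift.{1,0} μ ^ #TB := by rw [hB2]
      _ ≤ Cardinal.lift.{1,0} μ ^ Cardinal.lift.{1,0} θ := power_le_power_left hμ0 hTB
      _ = Cardinal.lift.{1,0} (μ ^ θ) := (lift_power _ _).symm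
      _ ≤ _ := Cardinal.lift_le.2 hpow
  exact absurd (Cardinal.lift_le.1 h2) (not_le.2 (Order.lt_succ μ))
end

section
/- Suppose (κ₁,κ₀) ↠_ν (μ₁,μ₀) and κ₀ = μ₀^{+ν}, where ν is an infinite cardinal. Then (κ₁,κ₀) ↠_{μ₀} (μ₁,μ₀). -/
open Cardinal Ordinal

/-- Chang's Conjecture with subscript, `(κ₁,κ₀) ↠_ν (μ₁,μ₀)`: additionally the substructure
contains every ordinal below the initial ordinal of `ν`. -/
def ChangCCSub (κ₁ κ₀ μ₁ μ₀ ν : Cardinal.{0}) : Prop :=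
  ∀ (L : FirstOrder.Language.{0,0}) (_ : Countable L.Symbols) (_ : L.Structure (Set.Iio κ₁.ord)),
    ∃ B : L.Substructure (Set.Iio κ₁.ord),
      #B = Cardinal.lift.{1,0} μ₁ ∧
      #{x : Set.Iio κ₁.ord // x ∈ B ∧ x.val < κ₀.ord} = Cardinal.lift.{1,0} μ₀ ∧
      ∀ x : Set.Iio κ₁.ord, x.val < ν.ord → x ∈ B

/-- The `ν`-th iterated cardinal successor of `μ`: if `μ = ℵ_α` then `iterSucc μ ν = ℵ_{α+ν}`. -/
noncomputable def iterSucc (μ : Cardinal.{0}) (ν : Ordinal.{0}) : Cardinal.{0} :=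
  Cardinal.preAleph (Cardinal.preAleph.symm μ + ν)


/-- Strict bounds below successor cardinals for families of size at most `μ`. -/
theorem su_bound {ι : Type 1} {μ c : Cardinal.{0}} (hc : ℵ₀ ≤ c) (hμc : μ ≤ c)
    (hι : #ι ≤ Cardinal.lift.{1,0} μ) (f : ι → Ordinal.{0}) :
    ∃ η < (Order.succ c).ord, ∀ i, f i < (Order.succ c).ord → f i < η := by
  have hreg := isRegular_succ hc
  let s : Set Ordinal.{0} := {o | o ∈ Set.range f ∧ o < (Order.succ c).ord}
  have hs : #s < (Ordinal.lift.{1} (Order.succ c).ord).cof := by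
    rw [← Ordinal.lift_cof, hreg.cof_ord]
    have h1 : #s ≤ #ι := (mk_le_mk_of_subset (fun x hx => hx.1)).trans mk_range_le
    refine (h1.trans hι).trans_lt ?_
    rw [Cardinal.lift_lt]
    exact Order.lt_succ_of_le hμc
  refine ⟨_, sSup_add_one_lt_of_lt_cof hs (fun i hi => hi.2), fun i hi => ?_⟩
  have : BddAbove ((· + 1) '' s) := by
    refine ⟨(Order.succ c).ord + 1, ?_⟩
    rintro _ ⟨x, hx, rfl⟩
    simpa using hx.2.le
  refine (lt_add_one (f i)).trans_le (le_csSup this ⟨f i, ⟨⟨i, rfl⟩, hi⟩, rfl⟩)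

/-- An injection of a proper initial segment into the cardinality. -/
theorem su_inj (K : Ordinal.{0}) (β : Set.Iio K) : ∃ γ : Set.Iio K → Set.Iio K,
    Set.InjOn γ {x | x.val < β.val} ∧ ∀ x, x.val < β.val → (γ x).val < β.val.card.ord := by
  have h : #(Set.Iio β.val) = #(Set.Iio β.val.card.ord) := by simp
  obtain ⟨e⟩ := Cardinal.eq.1 h
  refine ⟨fun x => if hx : x.val < β.val then
    ⟨(e ⟨x.val, hx⟩).val, ((e ⟨x.val, hx⟩).2.trans_le (ord_card_le _)).trans β.2⟩ else x, ?_, ?_⟩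
  · intro x hx y hy hxy
    simp only [Set.mem_ofPred_eq] at hx hy
    simp only [hx, hy, dif_pos] at hxy
    have := e.injective (Subtype.ext (congrArg (fun a => a.val) hxy))
    exact Subtype.ext (congrArg (fun a => a.val) this)
  · intro x hx
    simp only [hx, dif_pos]
    exact (e ⟨x.val, hx⟩).2

theorem su_union {α ι : Type 1} {c : Cardinal.{1}} (hc : ℵ₀ ≤ c) (s : Set α) (I : Set ι)
    (T : ι → Set α) (hI : #I ≤ c) (hT : ∀ i ∈ I, #(T i) ≤ c) (hs : s ⊆ ⋃ i ∈ I, T i) :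
    #s ≤ c := by
  refine (mk_le_mk_of_subset hs).trans ((mk_biUnion_le T I).trans ?_)
  refine (mul_le_mul' hI (ciSup_le' fun i : I => hT i.1 i.2)).trans ?_
  rw [mul_eq_self hc]

/-- The language with one more function symbol in each arity. -/
def suL1 (L : FirstOrder.Language.{0,0}) : FirstOrder.Language.{0,0} where
  Functions k := L.Functions k ⊕ Unit
  Relations _ := Empty

noncomputable def suGam (K : Ordinal.{0}) (β : Set.Iio K) : Set.Iio K → Set.Iio K :=
  (su_inj K β).choose

@[reducible]
noncomputable def suS1 (L : FirstOrder.Language.{0,0}) (K : Ordinal.{0}) (z : Set.Iio K)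
    (S : L.Structure (Set.Iio K)) : (suL1 L).Structure (Set.Iio K) where
  funMap {k} f v := match f with
    | Sum.inl f => S.funMap f v
    | Sum.inr _ => if h : 1 < k then suGam K (v ⟨0, by omega⟩) (v ⟨1, h⟩) else z
  RelMap {_} r _ := r.elim

def suL2 (L : FirstOrder.Language.{0,0}) : FirstOrder.Language.{0,0} where
  Functions k := L.Term (Fin k) × Finset (Fin k) × Fin k
  Relations _ := Empty

open Classical in
@[reducible]
noncomputable def suS2 (L : FirstOrder.Language.{0,0}) (K m : Ordinal.{0}) (δ : Ordinal.{0} → Ordinal.{0})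
    (S : L.Structure (Set.Iio K)) : (suL2 L).Structure (Set.Iio K) where
  funMap {k} f v :=
    if h : ∃ η : Set.Iio K, η.val < δ (v f.2.2).val ∧ ∀ α : Fin k → Set.Iio K,
      (∀ l, (α l).val < m) →
      (f.1.realize (fun l => if l ∈ f.2.1 then α l else v l)).val < δ (v f.2.2).val →
      (f.1.realize (fun l => if l ∈ f.2.1 then α l else v l)).val < η.val
    then h.choose else v f.2.2
  RelMap {_} r _ := r.elim

theorem su_count2 (L : FirstOrder.Language.{0,0}) (h : Countable (Σ k, L.Functions k)) :
    Countable (suL2 L).Symbols := by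
  have : ∀ k, Countable (L.Term (Fin k)) := fun k => by
    rw [← mk_le_aleph0_iff]
    refine FirstOrder.Language.Term.card_le.trans ?_
    have h3 : #(Σ k, L.Functions k) ≤ ℵ₀ := mk_le_aleph0_iff.2 h
    rw [mk_sigma] at h3
    simpa using h3
  have h1 : ∀ k, Countable ((suL2 L).Functions k) := fun k => by
    unfold suL2; dsimp; infer_instance
  have h2 : ∀ k, Countable ((suL2 L).Relations k) := fun k => by
    unfold suL2; dsimp; infer_instance
  unfold FirstOrder.Language.Symbols
  infer_instance

theorem su_term {L : FirstOrder.Language.{0,0}} {M : Type 1} [L.Structure M] {s : Set M} (t : L.Term s) :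
    ∃ (n : ℕ) (t' : L.Term (Fin n)) (f : Fin n → s),
      t'.realize (fun l => (f l : M)) = t.realize ((↑) : s → M) := by
  classical
  let e := t.varFinset.equivFin
  refine ⟨_, t.restrictVar e, fun l => (e.symm l).val, ?_⟩
  exact FirstOrder.Language.Term.realize_restrictVar _ (by simp)

/-- Key: the closure of `B ∪ m` is bounded below each `δ i` by elements of `B`. -/
theorem su_key (L : FirstOrder.Language.{0,0}) (K : Ordinal.{0}) (μ : Cardinal.{0}) (hμ : ℵ₀ ≤ μ)
    (δ : Ordinal.{0} → Ordinal.{0})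
    (S : L.Structure (Set.Iio K)) (B : Set (Set.Iio K))
    (hB : ∀ k (f : (suL2 L).Functions k) (v : Fin k → Set.Iio K), (∀ l, v l ∈ B) →
      (suS2 L K μ.ord δ S).funMap f v ∈ B)
    (i : Set.Iio K) (hi : i ∈ B) (c : Cardinal.{0}) (hμc : μ ≤ c)
    (hδ : δ i.val = (Order.succ c).ord) (hδK : δ i.val ≤ K)
    (x : Set.Iio K) (hx : x ∈ FirstOrder.Language.Substructure.closure L (B ∪ {y | y.val < μ.ord}))
    (hxδ : x.val < δ i.val) : ∃ η ∈ B, η.val < δ i.val ∧ x.val < η.val := by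
  classical
  obtain ⟨t, ht⟩ := FirstOrder.Language.Substructure.mem_closure_iff_exists_term.1 hx
  obtain ⟨n, t', f, hf⟩ := su_term t
  rw [ht] at hf
  let F : Fin (n+1) → Set.Iio K := Fin.cons i (fun l => (f l : Set.Iio K))
  let v : Fin (n+1) → Set.Iio K := fun l => if F l ∈ B then F l else i
  let u : (suL2 L).Functions (n+1) :=
    (t'.relabel Fin.succ, Finset.univ.filter (fun l => F l ∉ B), 0)
  have hv0 : v 0 = i := by simp [v, F]
  have hvB : ∀ l, v l ∈ B := fun l => by
    by_cases h : F l ∈ B <;> simp [v, h, hi]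
  have hmem := hB _ u v hvB
  let ι := {α : Fin (n+1) → Set.Iio K // ∀ l, (α l).val < μ.ord}
  have hι : #ι ≤ Cardinal.lift.{1,0} μ := by
    let g : ι → (Fin (n+1) → Set.Iio μ.ord) := fun α l => ⟨(α.1 l).val, α.2 l⟩
    have hg : Function.Injective g := fun α β h => by
      apply Subtype.ext; funext l; apply Subtype.ext
      exact congrArg (fun a => a.val) (congrFun h l)
    refine (mk_le_of_injective hg).trans ?_
    have : #(Fin (n+1) → Set.Iio μ.ord) = (Cardinal.lift.{1,0} μ) ^ (n+1) := by
      simp; norm_cast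
    rw [this]
    exact power_nat_le (by simpa using hμ)
  have hex : ∃ η : Set.Iio K, η.val < δ (v u.2.2).val ∧ ∀ α : Fin (n+1) → Set.Iio K,
      (∀ l, (α l).val < μ.ord) →
      (u.1.realize (fun l => if l ∈ u.2.1 then α l else v l)).val < δ (v u.2.2).val →
      (u.1.realize (fun l => if l ∈ u.2.1 then α l else v l)).val < η.val := by
    obtain ⟨η, h1, h2⟩ := su_bound (hμ.trans hμc) hμc hι
      (fun α => (u.1.realize (fun l => if l ∈ u.2.1 then α.1 l else v l)).val)
    have e : δ (v u.2.2).val = (Order.succ c).ord := by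
      change δ (v 0).val = _
      rw [hv0, hδ]
    rw [e]
    exact ⟨⟨η, h1.trans_le (hδ ▸ hδK)⟩, h1, fun α hα h => h2 ⟨α, hα⟩ h⟩
  have hval : (suS2 L K μ.ord δ S).funMap u v = hex.choose := dif_pos hex
  obtain ⟨h1, h2⟩ := hex.choose_spec
  rw [← hval] at h1 h2
  have e : (v u.2.2) = i := hv0
  rw [e] at h1 h2
  refine ⟨_, hmem, h1, ?_⟩
  -- an element below μ to fill
  have hpos : 0 < μ.ord := by
    rw [Cardinal.lt_ord]; simpa using (aleph0_pos.trans_le hμ)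
  let z : Set.Iio K := ⟨0, Set.mem_Iio.2 (lt_of_le_of_lt zero_le i.2)⟩
  let α : Fin (n+1) → Set.Iio K := fun l => if F l ∈ B then z else F l
  have hα : ∀ l, (α l).val < μ.ord := by
    intro l
    by_cases h : F l ∈ B
    · simpa [α, h, z] using hpos
    · simp only [α, h, if_false]
      refine Fin.cases (fun h => absurd hi h) (fun l h => ?_) l h
      exact (f l).2.resolve_left h
  have hreal : u.1.realize (fun l => if l ∈ u.2.1 then α l else v l) = x := by
    have : (fun l => if l ∈ u.2.1 then α l else v l) = F := by
      funext l
      by_cases h : F l ∈ B <;> simp [u, α, v, h]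
    rw [this]
    change (t'.relabel Fin.succ).realize F = x
    rw [FirstOrder.Language.Term.realize_relabel, ← hf]
    rfl
  have := h2 α hα
  rw [hreal] at this
  exact this hxδ

theorem stepup_one (κ₁ κ₀ μ₁ μ₀ ν : Cardinal.{0})
    (hκ₀ : ℵ₀ ≤ κ₀) (hμ₀ : ℵ₀ ≤ μ₀) (hν : ℵ₀ ≤ ν) (hκ : κ₀ ≤ κ₁) (hμ : μ₀ ≤ μ₁)
    (hcc : ChangCCSub κ₁ κ₀ μ₁ μ₀ ν) (hsucc : κ₀ = iterSucc μ₀ ν.ord) :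
    ChangCCSub κ₁ κ₀ μ₁ μ₀ μ₀ := by
  classical
  intro L hL S
  set p := Cardinal.preAleph.symm μ₀ with hp
  have hpμ : Cardinal.preAleph p = μ₀ := by simp [hp]
  have hmμ : ∀ o, μ₀ ≤ Cardinal.preAleph (p + o) := fun o => by
    rw [← hpμ, Cardinal.preAleph_le_preAleph]
    exact le_self_add
  let δ : Ordinal.{0} → Ordinal.{0} := fun o => (Order.succ (Cardinal.preAleph (p + o))).ord
  have hνκ : ν ≤ κ₀ := by
    rw [hsucc]
    refine (Cardinal.le_preAleph_ord ν).trans ?_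
    rw [iterSucc, Cardinal.preAleph_le_preAleph]
    exact le_add_self
  have hμκ : μ₀ ≤ κ₀ := by rw [hsucc]; exact hmμ _
  have hK0 : κ₀.ord ≤ κ₁.ord := Cardinal.ord_le_ord.2 hκ
  have hνK : ν.ord ≤ κ₀.ord := Cardinal.ord_le_ord.2 hνκ
  have hμK : μ₀.ord ≤ κ₀.ord := Cardinal.ord_le_ord.2 hμκ
  have hpos : 0 < κ₁.ord := by
    rw [Cardinal.lt_ord]
    simpa using aleph0_pos.trans_le (hκ₀.trans hκ)
  let z : Set.Iio κ₁.ord := ⟨0, hpos⟩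
  have hLF : Countable (Σ k, (suL1 L).Functions k) := by
    have h0 : Countable (Σ k, L.Functions k) :=
      (Sum.inl_injective (α := Σ k, L.Functions k) (β := Σ k, L.Relations k)).countable
    have h1 : ∀ k, Countable (L.Functions k) := fun k =>
      (sigma_mk_injective (i := k)).countable
    have h2 : ∀ k, Countable ((suL1 L).Functions k) := fun k => by
      unfold suL1; dsimp; infer_instance
    infer_instance
  let S1 := suS1 L κ₁.ord z S
  let S2 := suS2 (suL1 L) κ₁.ord μ₀.ord δ S1
  obtain ⟨B, hB1, hB2, hB3⟩ := hcc (suL2 (suL1 L)) (su_count2 _ hLF) S2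
  have hBc := fun k (f : (suL2 (suL1 L)).Functions k) (v : Fin k → Set.Iio κ₁.ord)
    (hv : ∀ l, v l ∈ (B : Set (Set.Iio κ₁.ord))) => B.fun_mem f v hv
  let C := FirstOrder.Language.Substructure.closure (suL1 L)
    ((B : Set (Set.Iio κ₁.ord)) ∪ {y | y.val < μ₀.ord})
  have hsub : (B : Set (Set.Iio κ₁.ord)) ∪ {y | y.val < μ₀.ord} ⊆ C :=
    FirstOrder.Language.Substructure.subset_closure
  have hBC : ∀ x, x ∈ B → x ∈ C := fun x hx => hsub (Or.inl hx)
  have hmC : ∀ x : Set.Iio κ₁.ord, x.val < μ₀.ord → x ∈ C := fun x hx => hsub (Or.inr hx)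
  have hlμ : ℵ₀ ≤ Cardinal.lift.{1,0} μ₀ := by simpa using hμ₀
  -- sizes of initial segments
  have hIio : ∀ c : Cardinal.{0}, c.ord ≤ κ₁.ord →
      #{x : Set.Iio κ₁.ord | x.val < c.ord} = Cardinal.lift.{1,0} c := by
    intro c hc
    have : #(Set.Iio c.ord) = Cardinal.lift.{1,0} c := by simp
    rw [← this]
    exact Cardinal.mk_congr
      ⟨fun x => ⟨x.1.1, x.2⟩, fun x => ⟨⟨x.1, lt_of_lt_of_le x.2 hc⟩, x.2⟩,
        fun _ => rfl, fun _ => rfl⟩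
  have hB2' : #{x : Set.Iio κ₁.ord | x ∈ B ∧ x.val < κ₀.ord} = Cardinal.lift.{1,0} μ₀ := hB2
  have hνμ : ν ≤ μ₀ := by
    rw [← Cardinal.lift_le.{1}, ← hB2', ← hIio ν (hνK.trans hK0)]
    exact mk_le_mk_of_subset fun x hx => ⟨hB3 x hx, lt_of_lt_of_le hx hνK⟩
  have main : ∀ i : Ordinal.{0}, i ≤ ν.ord →
      #{x : Set.Iio κ₁.ord | x ∈ C ∧ x.val < (Cardinal.preAleph (p + i)).ord} ≤
        Cardinal.lift.{1,0} μ₀ := by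
    intro i
    induction i using Ordinal.limitRecOn with
    | zero =>
      intro _
      rw [add_zero, hpμ, ← hIio μ₀ (hμK.trans hK0)]
      exact mk_le_mk_of_subset fun x hx => hx.2
    | add_one i ih =>
      intro hi
      have hi' : i < ν.ord := lt_of_lt_of_le (by simp) hi
      have ih := ih hi'.le
      let iK : Set.Iio κ₁.ord := ⟨i, lt_of_lt_of_le hi' (hνK.trans hK0)⟩
      have hiB : iK ∈ B := hB3 _ hi'
      have hδi : δ i = (Cardinal.preAleph (p + (i + 1))).ord := by
        simp only [δ]
        rw [Cardinal.succ_preAleph, add_assoc]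
      have hδκ : δ i ≤ κ₀.ord := by
        rw [hδi, hsucc, iterSucc, Cardinal.ord_le_ord, Cardinal.preAleph_le_preAleph]
        gcongr
      refine su_union hlμ _ {β : Set.Iio κ₁.ord | β ∈ B ∧ β.val < δ i}
        (fun β => {x | x ∈ C ∧ x.val < β.val}) ?_ ?_ ?_
      · rw [← hB2']
        exact mk_le_mk_of_subset fun x hx => ⟨hx.1, lt_of_lt_of_le hx.2 hδκ⟩
      · rintro β ⟨hβ, hβδ⟩
        refine le_trans ?_ ih
        obtain ⟨g1, g2⟩ := (su_inj κ₁.ord β).choose_spec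
        refine Cardinal.mk_le_of_injective
          (f := fun x : {x : Set.Iio κ₁.ord | x ∈ C ∧ x.val < β.val} =>
            ⟨suGam κ₁.ord β x.1, ?_, ?_⟩) ?_
        · have := C.fun_mem (n := 2) (Sum.inr ()) ![β, x.1] (by
            intro l
            fin_cases l
            · exact hBC _ hβ
            · exact x.2.1)
          exact this
        · refine (g2 _ x.2.2).trans_le (Cardinal.ord_le_ord.2 ?_)
          exact Order.lt_succ_iff.1 (Cardinal.lt_ord.1 hβδ)
        · intro x y hxy
          exact Subtype.ext (g1 x.2.2 y.2.2 (congrArg (fun a => a.val) hxy))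
      · rintro x ⟨hxC, hx⟩
        have hx' : x.val < δ i := by rw [hδi]; exact hx
        obtain ⟨η, h1, h2, h3⟩ := su_key (suL1 L) κ₁.ord μ₀ hμ₀ δ S1 B hBc iK hiB
          (Cardinal.preAleph (p + i)) (hmμ i) rfl (hδκ.trans hK0) x hxC hx'
        exact Set.mem_biUnion (show η ∈ {β : Set.Iio κ₁.ord | β ∈ B ∧ β.val < δ i} from ⟨h1, h2⟩)
          ⟨hxC, h3⟩
    | limit i hl ih =>
      intro hi
      refine su_union hlμ _ (Set.Iio i)
        (fun j => {x : Set.Iio κ₁.ord | x ∈ C ∧ x.val < (Cardinal.preAleph (p + j)).ord}) ?_ ?_ ?_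
      · rw [Cardinal.mk_Iio_ordinal, Cardinal.lift_le]
        refine le_trans ?_ hνμ
        simpa using Ordinal.card_le_card hi
      · intro j hj
        exact ih j hj (le_trans (le_of_lt hj) hi)
      · rintro x ⟨hxC, hx⟩
        have hn := Cardinal.isNormal_preAleph.comp (Ordinal.isNormal_add_right p)
        obtain ⟨j, hj, hxj⟩ := (hn.lt_iff_exists_lt hl).1 (Cardinal.lt_ord.1 hx)
        exact Set.mem_biUnion (show j ∈ Set.Iio i from hj) ⟨hxC, Cardinal.lt_ord.2 hxj⟩
  refine ⟨⟨(C : Set (Set.Iio κ₁.ord)), fun {n} f v hv => C.fun_mem (Sum.inl f) v hv⟩, ?_, ?_, ?_⟩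
  · change #C = _
    apply le_antisymm
    · have h1 := FirstOrder.Language.Substructure.lift_card_closure_le (L := suL1 L)
        (s := (B : Set (Set.Iio κ₁.ord)) ∪ {y | y.val < μ₀.ord})
      rw [Cardinal.lift_id'] at h1
      have hμ₁ : ℵ₀ ≤ Cardinal.lift.{1,0} μ₁ := by simpa using hμ₀.trans hμ
      refine h1.trans (max_le hμ₁ (add_le_of_le hμ₁ ?_ ?_))
      · rw [Cardinal.lift_id']
        refine (mk_union_le _ _).trans (add_le_of_le hμ₁ hB1.le ?_)
        rw [hIio μ₀ (hμK.trans hK0), Cardinal.lift_le]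
        exact hμ
      · refine le_trans ?_ hμ₁
        rw [Cardinal.lift_le_aleph0]
        exact mk_le_aleph0_iff.2 hLF
    · rw [← hB1]
      exact mk_le_mk_of_subset hBC
  · change #{x : Set.Iio κ₁.ord | x ∈ C ∧ x.val < κ₀.ord} = _
    apply le_antisymm
    · have := main ν.ord le_rfl
      rw [hsucc]
      exact this
    · rw [← hIio μ₀ (hμK.trans hK0)]
      exact mk_le_mk_of_subset fun x hx => ⟨hmC x hx, lt_of_lt_of_le hx hμK⟩
  · exact hmC
end

section
/- Suppose κ is a singular cardinal, μ is a cardinal with cf(κ) ≤ μ < κ, and (κ⁺,κ) ↠_{cf(κ)} (μ⁺,μ). Then there is no good scale for κ; moreover, every scale ⟨f_α : α < κ⁺⟩ for κ is bad at stationarily many α < κ⁺ with cf(α) = μ⁺. -/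
open Cardinal Ordinal

/-- `f < g` in the ordering modulo sets of size `< cf(κ)`:
`|{i < cf(κ) : f(i) ≥ g(i)}| < cf(κ)`.  (Indices range over ordinals below the initial
ordinal of `cf(κ) = κ.ord.cof`.) -/
def ptLT (κ : Cardinal.{0}) (f g : Ordinal → Ordinal) : Prop :=
  #{i : Ordinal | i < κ.ord.cof.ord ∧ g i ≤ f i} < Cardinal.lift.{1,0} κ.ord.cof

/-- `h` is a member of the product `∏_{i < cf(κ)} κs i`. -/
def ProdMem (κ : Cardinal.{0}) (κs : Ordinal.{0} → Cardinal.{0}) (h : Ordinal → Ordinal) : Prop :=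
  ∀ i < κ.ord.cof.ord, h i < (κs i).ord

/-- `(κs, f)` is a scale for the singular cardinal `κ`: `⟨κs i : i < cf(κ)⟩` is an increasing
sequence of regular cardinals cofinal in `κ`, and `⟨f α : α < κ⁺⟩` is increasing and cofinal
in `∏_{i<cf(κ)} κs i` with respect to `ptLT`. -/
def IsScale (κ : Cardinal.{0}) (κs : Ordinal.{0} → Cardinal.{0})
    (f : Ordinal → Ordinal → Ordinal) : Prop :=
  (∀ i, i < κ.ord.cof.ord → (κs i).IsRegular ∧ κs i < κ) ∧
  (∀ i j, i < j → j < κ.ord.cof.ord → κs i < κs j) ∧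
  (∀ c < κ, ∃ i < κ.ord.cof.ord, c < κs i) ∧
  (∀ α < (Order.succ κ).ord, ProdMem κ κs (f α)) ∧
  (∀ α β, α < β → β < (Order.succ κ).ord → ptLT κ (f α) (f β)) ∧
  (∀ h, ProdMem κ κs h → ∃ α < (Order.succ κ).ord, ptLT κ h (f α))

/-- The scale `(κs, f)` is good at `α`: there are `⟨g ζ : ζ < cf(α)⟩` in the product and
`j* < cf(κ)` such that `⟨g ζ j : ζ < cf(α)⟩` is strictly increasing for all `j* ≤ j < cf(κ)`,
and `⟨g ζ⟩` and `⟨f β : β < α⟩` are mutually cofinal. -/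
def GoodAt (κ : Cardinal.{0}) (κs : Ordinal.{0} → Cardinal.{0})
    (f : Ordinal → Ordinal → Ordinal) (α : Ordinal) : Prop :=
  ∃ (g : Ordinal → Ordinal → Ordinal) (j' : Ordinal), j' < κ.ord.cof.ord ∧
    (∀ ζ < α.cof.ord, ProdMem κ κs (g ζ)) ∧
    (∀ j, j' ≤ j → j < κ.ord.cof.ord → ∀ ζ ζ', ζ < ζ' → ζ' < α.cof.ord → g ζ j < g ζ' j) ∧
    (∀ ζ < α.cof.ord, ∃ β < α, ptLT κ (g ζ) (f β)) ∧
    (∀ β < α, ∃ ζ < α.cof.ord, ptLT κ (f β) (g ζ))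

/-- `C` is a club (closed unbounded) subset of `α`: `C ⊆ α`, `C` contains each of its limit
points below `α`, and `C` is unbounded in `α`. -/
def IsClubIn (C : Set Ordinal.{0}) (α : Ordinal.{0}) : Prop :=
  C ⊆ Set.Iio α ∧
  (∀ β < α, 0 < β → sSup (C ∩ Set.Iio β) = β → β ∈ C) ∧
  (∀ γ < α, ∃ δ ∈ C, γ ≤ δ)

theorem aux_bdd {T : Type 1} (o : Ordinal.{0}) (b : T → Ordinal.{0}) (hb : ∀ t, b t < o)
    (hT : #T < Cardinal.lift.{1,0} o.cof) : ∃ y < o, ∀ t, b t < y := by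
  have h1 : ¬ IsCofinal (Set.range (fun t => (⟨b t, hb t⟩ : Set.Iio o))) := by
    intro hc
    have h2 := Order.cof_le hc
    rw [Ordinal.cof_Iio, ← Ordinal.lift_cof] at h2
    exact absurd (hT.trans_le (h2.trans mk_range_le)) (lt_irrefl _)
  obtain ⟨y, hy⟩ := not_isCofinal_iff.1 h1
  refine ⟨y.1, y.2, fun t => ?_⟩
  exact hy _ ⟨t, rfl⟩

theorem aux_pig {T : Type 1} (o : Ordinal.{0}) (φ : Ordinal.{0} → T)
    (hT : #T < Cardinal.lift.{1,0} o.cof) :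
    ∃ t, ∀ y < o, ∃ ζ, y ≤ ζ ∧ ζ < o ∧ φ ζ = t := by
  by_contra hcon
  push Not at hcon
  choose b hb hb' using hcon
  obtain ⟨y, hy, hy'⟩ := aux_bdd o b hb hT
  exact hb' (φ y) y (hy' _).le hy rfl

theorem aux_idx (κ : Cardinal.{0}) (hκ : ℵ₀ ≤ κ.ord.cof) (f g f' g' : Ordinal.{0} → Ordinal.{0})
    (h : ptLT κ f g) (h' : ptLT κ f' g') (j' : Ordinal.{0}) (hj : j' < κ.ord.cof.ord) :
    ∃ j, j' ≤ j ∧ j < κ.ord.cof.ord ∧ f j < g j ∧ f' j < g' j := by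
  by_contra hcon
  push Not at hcon
  unfold ptLT at h h'
  have hsub : Set.Iio κ.ord.cof.ord ⊆
      (({i : Ordinal | i < κ.ord.cof.ord ∧ g i ≤ f i} ∪
      {i : Ordinal | i < κ.ord.cof.ord ∧ g' i ≤ f' i}) ∪ Set.Iio j' : Set Ordinal.{0}) := by
    intro i hi
    by_cases h1 : i < j'
    · right; exact h1
    · left
      by_cases h2 : f i < g i
      · right; exact ⟨hi, hcon i (not_lt.1 h1) hi h2⟩
      · left; exact ⟨hi, not_lt.1 h2⟩
  have hinf : ℵ₀ ≤ Cardinal.lift.{1,0} κ.ord.cof := Cardinal.aleph0_le_lift.2 hκ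
  have hj2 : #(Set.Iio j') < Cardinal.lift.{1,0} κ.ord.cof := by
    rw [Cardinal.mk_Iio_ordinal, Cardinal.lift_lt]
    exact Cardinal.lt_ord.1 hj
  have h3 := (mk_le_mk_of_subset hsub).trans (mk_union_le _ _)
  rw [Cardinal.mk_Iio_ordinal, Cardinal.card_ord] at h3
  exact absurd (h3.trans_lt (add_lt_of_lt hinf
    ((mk_union_le _ _).trans_lt (add_lt_of_lt hinf h h')) hj2)) (lt_irrefl _)

theorem aux_inj (κ : Cardinal.{0}) (β : Ordinal.{0}) (hβ : β < (Order.succ κ).ord) :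
    ∃ e : Ordinal.{0} → Ordinal.{0}, (∀ γ < β, e γ < κ.ord) ∧ Set.InjOn e (Set.Iio β) := by
  have h1 : #(Set.Iio β) ≤ #(Set.Iio κ.ord) := by
    rw [Cardinal.mk_Iio_ordinal, Cardinal.mk_Iio_ordinal, Cardinal.lift_le, Cardinal.card_ord]
    exact Order.lt_succ_iff.1 (Cardinal.lt_ord.1 hβ)
  obtain ⟨e⟩ := h1
  classical
  refine ⟨fun γ => if h : γ < β then (e ⟨γ, h⟩).1 else 0, ?_, ?_⟩
  · intro γ h
    simp only [h, dif_pos]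
    exact (e ⟨γ, h⟩).2
  · intro a ha b hb hab
    simp only [Set.mem_Iio] at ha hb
    simp only [ha, hb, dif_pos] at hab
    have := e.injective (Subtype.ext hab)
    exact congrArg Subtype.val this

theorem aux_cc {κ₁ κ₀ μ₁ μ₀ ν : Cardinal.{0}} (hcc : ChangCCSub κ₁ κ₀ μ₁ μ₀ ν)
    (F : Fin 3 → Set.Iio κ₁.ord → Set.Iio κ₁.ord → Set.Iio κ₁.ord) :
    ∃ B : Set (Set.Iio κ₁.ord), (∀ k, ∀ x ∈ B, ∀ y ∈ B, F k x y ∈ B) ∧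
      #B = Cardinal.lift.{1,0} μ₁ ∧
      #{x : Set.Iio κ₁.ord // x ∈ B ∧ x.val < κ₀.ord} = Cardinal.lift.{1,0} μ₀ ∧
      ∀ x : Set.Iio κ₁.ord, x.val < ν.ord → x ∈ B := by
  let L : FirstOrder.Language.{0,0} := ⟨fun n => {_k : Fin 3 // n = 2}, fun _ => Empty⟩
  have hc : Countable L.Symbols := by
    have h1 : Countable (Σ n, {_k : Fin 3 // n = 2}) := inferInstance
    have h2 : Countable (Σ _n : ℕ, Empty) := inferInstance
    exact inferInstanceAs (Countable ((Σ n, {_k : Fin 3 // n = 2}) ⊕ (Σ _n : ℕ, Empty)))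
  let S : L.Structure (Set.Iio κ₁.ord) :=
    { funMap := fun {n} (k : {_k : Fin 3 // n = 2}) x =>
        F k.1 (x ⟨0, by have := k.2; omega⟩) (x ⟨1, by have := k.2; omega⟩)
      RelMap := fun {n} (r : Empty) => r.elim }
  obtain ⟨B, h1, h2, h3⟩ := hcc L hc S
  refine ⟨(B : Set (Set.Iio κ₁.ord)), ?_, h1, h2, h3⟩
  intro k x hx y hy
  have := B.fun_mem (n := 2) (⟨k, rfl⟩ : {_k : Fin 3 // 2 = 2}) ![x, y] (by
    intro i
    fin_cases i
    · exact hx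
    · exact hy)
  exact this

theorem aux_main (κ μ : Cardinal.{0})
    (hκ : ℵ₀ ≤ κ) (hsing : κ.ord.cof < κ)
    (hμ₁ : κ.ord.cof ≤ μ) (hμ₂ : μ < κ)
    (hcc : ChangCCSub (Order.succ κ) κ (Order.succ μ) μ κ.ord.cof)
    (κs : Ordinal.{0} → Cardinal.{0}) (f : Ordinal.{0} → Ordinal.{0} → Ordinal.{0})
    (hs : IsScale κ κs f) (C : Set Ordinal.{0}) (hC : IsClubIn C (Order.succ κ).ord) :
    ∃ α ∈ C, α.cof = Order.succ μ ∧ ¬ GoodAt κ κs f α := by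
  classical
  obtain ⟨hs1, -, -, hs4, hs5, -⟩ := hs
  obtain ⟨hC1, hC2, hC3⟩ := hC
  have hcf : ℵ₀ ≤ κ.ord.cof := by
    rw [Ordinal.aleph0_le_cof_iff, Ordinal.one_lt_cof_iff]
    exact Cardinal.isSuccLimit_ord hκ
  have hμ : ℵ₀ ≤ μ := hcf.trans hμ₁
  have hreg : (Order.succ κ).IsRegular := isRegular_succ hκ
  have hκκ : κ.ord < (Order.succ κ).ord := Cardinal.ord_lt_ord.2 (Order.lt_succ κ)
  have hlim : Order.IsSuccLimit (Order.succ κ).ord := Cardinal.isSuccLimit_ord hreg.aleph0_le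
  have hpos : 0 < (Order.succ κ).ord := hreg.ord_pos
  choose! e he1 he2 using fun β hβ => aux_inj κ β hβ
  have hnx : ∀ β < (Order.succ κ).ord, ∃ δ ∈ C, β < δ := by
    intro β hβ
    obtain ⟨δ, h1, h2⟩ := hC3 _ (hlim.succ_lt hβ)
    exact ⟨δ, h1, Order.succ_le_iff.1 h2⟩
  choose! nx hnx1 hnx2 using hnx
  let tr : Ordinal.{0} → Set.Iio (Order.succ κ).ord := fun x =>
    if h : x < (Order.succ κ).ord then ⟨x, h⟩ else ⟨0, hpos⟩
  have htr : ∀ x, x < (Order.succ κ).ord → (tr x).1 = x := by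
    intro x h
    simp only [tr, h, dif_pos]
  obtain ⟨B, hB, hB1, hB2, hB3⟩ := aux_cc hcc
    ![fun x y => tr (f x.1 y.1), fun x y => tr (e x.1 y.1), fun x _ => tr (nx x.1)]
  let A : Set Ordinal.{0} := Subtype.val '' B
  have hAlt : ∀ x ∈ A, x < (Order.succ κ).ord := by
    rintro _ ⟨x, -, rfl⟩; exact x.2
  have hAcard : #A = Cardinal.lift.{1,0} (Order.succ μ) := by
    rw [← hB1]; exact mk_image_eq Subtype.val_injective
  have hA2 : #{x // x ∈ A ∧ x < κ.ord} ≤ Cardinal.lift.{1,0} μ := by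
    rw [← hB2]
    refine mk_le_of_injective
      (f := fun x => ⟨⟨x.1, hAlt _ x.2.1⟩, ?_, x.2.2⟩) ?_
    · obtain ⟨y, hy, hy'⟩ := x.2.1
      have : (⟨x.1, hAlt _ x.2.1⟩ : Set.Iio (Order.succ κ).ord) = y := Subtype.ext hy'.symm
      rw [this]; exact hy
    · intro x y hxy
      exact Subtype.ext (congrArg (fun z => z.1.1) hxy)
  have hAf : ∀ x ∈ A, ∀ i < κ.ord.cof.ord, f x i ∈ A ∧ f x i < κ.ord := by
    rintro _ ⟨x, hx, rfl⟩ i hi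
    have h1 : f x.1 i < κ.ord := (hs4 x.1 x.2 i hi).trans (Cardinal.ord_lt_ord.2 (hs1 i hi).2)
    have hi2 : i < (Order.succ κ).ord := hi.trans ((Cardinal.ord_lt_ord.2 hsing).trans hκκ)
    have h2 := hB 0 x hx ⟨i, hi2⟩ (hB3 ⟨i, hi2⟩ hi)
    exact ⟨⟨_, h2, htr _ (h1.trans hκκ)⟩, h1⟩
  have hAe : ∀ x ∈ A, ∀ y ∈ A, y < x → e x y ∈ A ∧ e x y < κ.ord := by
    rintro _ ⟨x, hx, rfl⟩ _ ⟨y, hy, rfl⟩ hyx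
    have h1 := he1 x.1 x.2 y.1 hyx
    exact ⟨⟨_, hB 1 x hx y hy, htr _ (h1.trans hκκ)⟩, h1⟩
  have hAn : ∀ x ∈ A, nx x ∈ A := by
    rintro _ ⟨x, hx, rfl⟩
    exact ⟨_, hB 2 x hx x hx, htr _ (hC1 (hnx1 x.1 x.2))⟩
  -- initial segments of `A`
  have hseg : ∀ x ∈ A, #{y // y ∈ A ∧ y < x} ≤ Cardinal.lift.{1,0} μ := by
    intro x hx
    refine le_trans ?_ hA2
    refine mk_le_of_injective
      (f := fun y => ⟨e x y.1, hAe x hx y.1 y.2.1 y.2.2⟩) ?_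
    intro y z hyz
    have := congrArg Subtype.val hyz
    exact Subtype.ext (he2 x (hAlt x hx) y.2.2 z.2.2 this)
  -- the supremum
  obtain ⟨y₀, hy₀, hy₀'⟩ := aux_bdd (T := A) (Order.succ κ).ord (fun t => t.1)
    (fun t => hAlt _ t.2) (by
      rw [hAcard, hreg.cof_ord, Cardinal.lift_lt]
      exact Order.succ_lt_succ hμ₂)
  have hbdd : BddAbove A := ⟨y₀, fun x hx => (hy₀' ⟨x, hx⟩).le⟩
  have hne : A.Nonempty := by
    rw [Set.nonempty_iff_ne_empty]
    rintro h
    have h2 : #A = 0 := by rw [h]; simp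
    rw [hAcard] at h2
    simp at h2
  set α := sSup A with hα
  have hαlt : α < (Order.succ κ).ord :=
    (csSup_le hne fun x hx => (hy₀' ⟨x, hx⟩).le).trans_lt hy₀
  have hAα : ∀ x ∈ A, x < α := fun x hx =>
    (hnx2 x (hAlt x hx)).trans_le (le_csSup hbdd (hAn x hx))
  have hcofA : ∀ y < α, ∃ x ∈ A, y < x := fun y hy => exists_lt_of_lt_csSup hne hy
  have hα0 : 0 < α := by
    obtain ⟨x, hx⟩ := hne
    exact zero_le.trans_lt (hAα x hx)
  have hαC : α ∈ C := by
    refine hC2 α hαlt hα0 ?_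
    apply le_antisymm
    · exact csSup_le' fun x hx => le_of_lt hx.2
    · refine le_of_forall_lt fun y hy => ?_
      obtain ⟨x, hx, hyx⟩ := hcofA y hy
      have h1 : nx x ∈ C ∩ Set.Iio α := ⟨hnx1 x (hAlt x hx), hAα _ (hAn x hx)⟩
      exact (hyx.trans (hnx2 x (hAlt x hx))).trans_le
        (le_csSup ⟨α, fun z hz => le_of_lt hz.2⟩ h1)
  have hcof : α.cof = Order.succ μ := by
    apply le_antisymm
    · rw [← Cardinal.lift_le.{1,0}, ← hAcard]
      by_contra hcon
      obtain ⟨y, hy, hy'⟩ := aux_bdd (T := A) α (fun t => t.1) (fun t => hAα _ t.2)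
        (not_le.1 hcon)
      obtain ⟨x, hx, hyx⟩ := hcofA y hy
      exact absurd (hyx.trans (hy' ⟨x, hx⟩)) (lt_irrefl _)
    · by_contra hcon
      have h1 : α.cof ≤ μ := Order.lt_succ_iff.1 (not_le.1 hcon)
      obtain ⟨s, hsc, hs⟩ := Order.exists_cof_eq (Set.Iio α)
      rw [Ordinal.cof_Iio, ← Ordinal.lift_cof] at hs
      choose! t ht1 ht2 using hcofA
      have h2 : A ⊆ ⋃ x : s, {y | y ∈ A ∧ y < t x.1.1} := by
        intro a ha
        obtain ⟨b, hb, hab⟩ := hsc ⟨a, hAα a ha⟩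
        exact Set.mem_iUnion.2 ⟨⟨b, hb⟩, ha, lt_of_le_of_lt hab (ht2 b.1 b.2)⟩
      have h3 : #A ≤ Cardinal.lift.{1,0} μ := by
        refine (mk_le_mk_of_subset h2).trans ((mk_iUnion_le _).trans ?_)
        refine (mul_le_mul' (b := Cardinal.lift.{1,0} μ) (d := Cardinal.lift.{1,0} μ)
          ?_ ?_).trans (Cardinal.mul_eq_self ?_).le
        · rw [hs, Cardinal.lift_le]; exact h1
        · exact ciSup_le' fun x => hseg _ (ht1 _ x.1.2)
        · simpa using hμ
      rw [hAcard, Cardinal.lift_le] at h3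
      exact absurd (Order.lt_succ μ) (not_lt.2 h3)
  refine ⟨α, hαC, hcof, ?_⟩
  rintro ⟨g, j', hj', -, hg2, hg3, hg4⟩
  have hall : ∀ ζ < α.cof.ord, ∃ x ∈ A, ∃ ζ' < α.cof.ord, ∃ j, j' ≤ j ∧ j < κ.ord.cof.ord ∧
      g ζ j < f x j ∧ f x j < g ζ' j := by
    intro ζ hζ
    obtain ⟨β, hβ, hβ'⟩ := hg3 ζ hζ
    obtain ⟨x, hx, hβx⟩ := hcofA β hβ
    obtain ⟨ζ', hζ', h1⟩ := hg4 x (hAα x hx)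
    have h5 := hs5 β x hβx (hAlt x hx)
    have h6 : ptLT κ (g ζ) (f x) := by
      unfold ptLT at hβ' h5 ⊢
      refine (mk_le_mk_of_subset ?_).trans_lt ((mk_union_le _ _).trans_lt
        (add_lt_of_lt (Cardinal.aleph0_le_lift.2 hcf) hβ' h5))
      rintro i ⟨hi, hi'⟩
      by_cases h : f β i ≤ g ζ i
      · left; exact ⟨hi, h⟩
      · right; exact ⟨hi, hi'.trans (not_le.1 h).le⟩
    obtain ⟨j, hj⟩ := aux_idx κ hcf _ _ _ _ h6 h1 j' hj'
    exact ⟨x, hx, ζ', hζ', j, hj⟩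
  choose! X hX Z hZ J hJ1 hJ2 hJ3 hJ4 using hall
  have hcp : 0 < κ.ord.cof.ord := zero_le.trans_lt hj'
  obtain ⟨a₀, ha₀⟩ := hne
  let T := Set.Iio κ.ord.cof.ord × {x // x ∈ A ∧ x < κ.ord}
  let φ : Ordinal.{0} → T := fun ζ =>
    if h : ζ < α.cof.ord then
      (⟨J ζ, hJ2 ζ h⟩, ⟨f (X ζ) (J ζ), hAf _ (hX ζ h) _ (hJ2 ζ h)⟩)
    else (⟨0, hcp⟩, ⟨f a₀ 0, hAf _ ha₀ _ hcp⟩)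
  have hT : #T < Cardinal.lift.{1,0} α.cof.ord.cof := by
    rw [hcof, (isRegular_succ hμ).cof_ord]
    refine lt_of_le_of_lt ?_ (Cardinal.lift_lt.2 (Order.lt_succ μ))
    rw [mk_prod, Cardinal.lift_id, Cardinal.lift_id]
    refine (mul_le_mul' (b := Cardinal.lift.{1,0} μ) (d := Cardinal.lift.{1,0} μ)
          ?_ hA2).trans (Cardinal.mul_eq_self ?_).le
    · rw [Cardinal.mk_Iio_ordinal, Cardinal.lift_le, Cardinal.card_ord]; exact hμ₁
    · simpa using hμ
  obtain ⟨t, ht⟩ := aux_pig α.cof.ord φ hT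
  have hθ : Order.IsSuccLimit α.cof.ord := by
    rw [hcof]; exact Cardinal.isSuccLimit_ord (isRegular_succ hμ).aleph0_le
  obtain ⟨ζ₁, -, hζ₁, h1⟩ := ht 0 hθ.bot_lt
  obtain ⟨ζ₂, hle, hζ₂, h2⟩ := ht _ (hθ.succ_lt (hZ ζ₁ hζ₁))
  have h3 : φ ζ₁ = φ ζ₂ := h1.trans h2.symm
  simp only [φ, hζ₁, hζ₂, dif_pos] at h3
  have hJJ : J ζ₁ = J ζ₂ := congrArg (fun z : T => z.1.1) h3
  have hff : f (X ζ₁) (J ζ₁) = f (X ζ₂) (J ζ₂) := congrArg (fun z : T => z.2.1) h3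
  have h4 := hJ4 ζ₁ hζ₁
  have h5 := hJ3 ζ₂ hζ₂
  have h6 := hg2 (J ζ₂) (hJ1 ζ₂ hζ₂) (hJ2 ζ₂ hζ₂) (Z ζ₁) ζ₂ (Order.succ_le_iff.1 hle) hζ₂
  rw [hff, hJJ] at h4
  exact absurd ((h4.trans h6).trans h5) (lt_irrefl _)

theorem cc_no_good_scale (κ μ : Cardinal.{0})
    (hκ : ℵ₀ ≤ κ) (hsing : κ.ord.cof < κ)
    (hμ₁ : κ.ord.cof ≤ μ) (hμ₂ : μ < κ)
    (hcc : ChangCCSub (Order.succ κ) κ (Order.succ μ) μ κ.ord.cof) :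
    (¬ ∃ κs f, IsScale κ κs f ∧
        ∀ α < (Order.succ κ).ord, κ.ord.cof < α.cof → GoodAt κ κs f α) ∧
    (∀ κs f, IsScale κ κs f →
      ∀ C : Set Ordinal, IsClubIn C (Order.succ κ).ord →
        ∃ α ∈ C, α.cof = Order.succ μ ∧ ¬ GoodAt κ κs f α) := by
  have hmain := aux_main κ μ hκ hsing hμ₁ hμ₂ hcc
  refine ⟨?_, hmain⟩
  rintro ⟨κs, f, hs, hgood⟩
  have hC : IsClubIn (Set.Iio (Order.succ κ).ord) (Order.succ κ).ord :=
    ⟨subset_rfl, fun β hβ _ _ => hβ, fun γ hγ => ⟨γ, hγ, le_rfl⟩⟩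
  obtain ⟨α, hα, h1, h2⟩ := hmain κs f hs _ hC
  exact h2 (hgood α hα (by rw [h1]; exact hμ₁.trans_lt (Order.lt_succ μ)))
end

section
/- Suppose κ is a regular cardinal, μ < κ is a singular cardinal, and (κ⁺,κ) ↠ (μ⁺,μ). Then there is a better scale for μ. -/
open Cardinal Ordinal

/-- The scale `f` is better at `α`: there is a club `C ⊆ α` such that for every `β ∈ C` there
is `j < cf(κ)` with `f γ i < f β i` for all `j ≤ i < cf(κ)` and all `γ ∈ C ∩ β`. -/
def BetterAt (κ : Cardinal.{0}) (f : Ordinal → Ordinal → Ordinal) (α : Ordinal) : Prop :=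
  ∃ C : Set Ordinal, IsClubIn C α ∧
    ∀ β ∈ C, ∃ j < κ.ord.cof.ord,
      ∀ i, j ≤ i → i < κ.ord.cof.ord → ∀ γ ∈ C, γ < β → f γ i < f β i


theorem CBS.bdd {a : Ordinal.{0}} {S : Set Ordinal.{0}} (hS : ∀ x ∈ S, x < a)
    (hc : #S < Cardinal.lift.{1} a.cof) : ∃ b < a, ∀ s ∈ S, s ≤ b := by
  refine ⟨sSup S, Ordinal.sSup_lt_of_lt_cof (by simpa using hc) hS, fun s hs => ?_⟩
  exact le_csSup ⟨a, fun x hx => (hS x hx).le⟩ hs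

theorem CBS.mkIio (a : Ordinal.{0}) : #(Set.Iio a) = Cardinal.lift.{1} a.card := by
  exact Cardinal.mk_Iio_ordinal a

theorem CBS.mk_le_of_inj {S : Set Ordinal.{0}} {a : Ordinal.{0}} (f : Ordinal → Ordinal)
   (h : ∀ x ∈ S, f x < a) (hi : ∀ x ∈ S, ∀ y ∈ S, f x = f y → x = y) : #S ≤ Cardinal.lift.{1} a.card := by
  rw [← CBS.mkIio]
  exact Cardinal.mk_le_of_injective (f := fun x : S => (⟨f x.1, h x.1 x.2⟩ : Set.Iio a))
    (fun x y hxy => Subtype.ext (hi _ x.2 _ y.2 (congrArg Subtype.val hxy)))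

theorem CBS.wfrec {X : Type*} [Inhabited X] (F : Ordinal.{0} → (Ordinal.{0} → X) → X)
    (hF : ∀ α r r', (∀ β < α, r β = r' β) → F α r = F α r') : ∃ g, ∀ α, g α = F α g := by
  classical
  let G : Ordinal.{0} → X := WellFounded.fix (r := (· < ·)) wellFounded_lt
    (fun α rec => F α (fun β => if h : β < α then rec β h else default))
  refine ⟨G, fun α => ?_⟩
  have : G α = F α (fun β => if h : β < α then G β else default) := by
    show WellFounded.fix _ _ _ = _
    rw [WellFounded.fix_eq]
  rw [this]
  apply hF
  intro β hβ
  simp [hβ]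

theorem CBS.inj_of_card {a : Ordinal.{0}} {c : Cardinal.{0}} (h : a.card ≤ c) :
    ∃ e : Ordinal.{0} → Ordinal.{0}, (∀ x < a, e x < c.ord) ∧ ∀ x < a, ∀ y < a, e x = e y → x = y := by
  have h1 : #(Set.Iio a) ≤ #(Set.Iio c.ord) := by
    rw [CBS.mkIio, CBS.mkIio, Cardinal.card_ord]; exact Cardinal.lift_le.2 h
  obtain ⟨f⟩ := h1
  classical
  refine ⟨fun x => if h : x < a then (f ⟨x, h⟩).1 else 0, ?_, ?_⟩
  · intro x hx; simp only [hx, dif_pos]; exact (f ⟨x, hx⟩).2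
  · intro x hx y hy hxy
    simp only [hx, hy, dif_pos] at hxy
    have := f.injective (Subtype.ext hxy)
    exact congrArg Subtype.val this

/-- injection from a set of bounded size -/
theorem CBS.inj_of_mk {S : Set Ordinal.{0}} {c : Cardinal.{0}} (h : #S ≤ Cardinal.lift.{1} c) :
    ∃ e : Ordinal.{0} → Ordinal.{0}, (∀ x ∈ S, e x < c.ord) ∧ ∀ x ∈ S, ∀ y ∈ S, e x = e y → x = y := by
  have h1 : #S ≤ #(Set.Iio c.ord) := by
    rw [CBS.mkIio]; simpa using h
  obtain ⟨f⟩ := h1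
  classical
  refine ⟨fun x => if h : x ∈ S then (f ⟨x, h⟩).1 else 0, ?_, ?_⟩
  · intro x hx; simp only [hx, dif_pos]; exact (f ⟨x, hx⟩).2
  · intro x hx y hy hxy
    simp only [hx, hy, dif_pos] at hxy
    have := f.injective (Subtype.ext hxy)
    exact congrArg Subtype.val this

/-- monotone cofinal sequence -/
theorem CBS.fund (a : Ordinal.{0}) : ∃ D : Ordinal.{0} → Ordinal.{0},
    (∀ x < a.cof.ord, D x < a) ∧ (∀ x y, x < y → y < a.cof.ord → D x < D y) ∧
    (∀ z < a, ∃ x < a.cof.ord, z ≤ D x) := by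
  obtain ⟨f, hf⟩ := Ordinal.exists_isFundamentalSeq (o := a) (a := a.cof.ord) rfl
  classical
  refine ⟨fun x => if h : x < a.cof.ord then (f ⟨x, h⟩).1 else 0, ?_, ?_, ?_⟩
  · intro x hx; simp only [hx, dif_pos]; exact (f ⟨x, hx⟩).2
  · intro x y hxy hy
    simp only [hy, hxy.trans hy, dif_pos]
    exact hf.strictMono (show (⟨x, hxy.trans hy⟩ : Set.Iio a.cof.ord) < ⟨y, hy⟩ from hxy)
  · intro z hz
    obtain ⟨w, ⟨x, rfl⟩, hw⟩ := hf.isCofinal_range (⟨z, hz⟩ : Set.Iio a)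
    refine ⟨x.1, x.2, ?_⟩
    have hx := x.2
    simp only [Set.mem_Iio] at hx
    simp only [hx, dif_pos]
    exact hw

theorem CBS.regbdd {χ : Cardinal.{0}} (hχ : χ.IsRegular) {S : Set Ordinal.{0}}
    (hS : ∀ x ∈ S, x < χ.ord) (hc : #S < Cardinal.lift.{1} χ) : ∃ b < χ.ord, ∀ s ∈ S, s < b := by
  obtain ⟨b, hb, h⟩ := CBS.bdd hS (by rwa [hχ.cof_ord])
  exact ⟨Order.succ b, (Cardinal.isSuccLimit_ord hχ.aleph0_le).succ_lt hb,
    fun s hs => Order.lt_succ_of_le (h s hs)⟩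

theorem CBS.mk_image_le' {S : Set Ordinal.{0}} {X : Type 1} (f : Ordinal → X) : #(f '' S) ≤ #S :=
  Cardinal.mk_image_le

/-- bounded image of a subset of a small initial segment -/
theorem CBS.regbdd_img {χ : Cardinal.{0}} (hχ : χ.IsRegular) {a : Ordinal.{0}} (ha : a < χ.ord)
    (f : Ordinal → Ordinal) (hf : ∀ x < a, f x < χ.ord) : ∃ b < χ.ord, ∀ x < a, f x < b := by
  obtain ⟨b, hb, h⟩ := CBS.regbdd hχ (S := f '' Set.Iio a) (by rintro _ ⟨x, hx, rfl⟩; exact hf x hx)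
    (by
      refine Cardinal.mk_image_le.trans_lt ?_
      rw [CBS.mkIio]
      exact Cardinal.lift_lt.2 (Cardinal.lt_ord.1 ha))
  exact ⟨b, hb, fun x hx => h _ ⟨x, hx, rfl⟩⟩

theorem CBS.split {α : Ordinal.{0}} {T J : Set Ordinal.{0}} (hT : ∀ γ < α, ∃ δ ∈ T, γ ≤ δ)
    (p : Ordinal → Ordinal) (hp : ∀ t ∈ T, p t ∈ J) (hJ : #J < Cardinal.lift.{1} α.cof) :
    ∃ j ∈ J, ∀ γ < α, ∃ δ ∈ T, p δ = j ∧ γ ≤ δ := by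
  by_contra hcon
  push Not at hcon
  have : ∀ j, ∃ γ, j ∈ J → γ < α ∧ ∀ δ ∈ T, p δ = j → δ < γ := by
    intro j
    by_cases hj : j ∈ J
    · obtain ⟨γ, h1, h2⟩ := hcon j hj
      exact ⟨γ, fun _ => ⟨h1, h2⟩⟩
    · exact ⟨0, fun h => absurd h hj⟩
  choose b hb using this
  obtain ⟨c, hc, h⟩ := CBS.bdd (a := α) (S := b '' J) (by rintro _ ⟨x, hx, rfl⟩; exact (hb x hx).1)
    (Cardinal.mk_image_le.trans_lt hJ)
  obtain ⟨δ, hδ, hcδ⟩ := hT c hc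
  have h1 := (hb _ (hp δ hδ)).2 δ hδ rfl
  exact absurd (h1.trans_le (h _ ⟨_, hp δ hδ, rfl⟩)) (not_lt.2 hcδ)

theorem CBS.splitOrd {α : Ordinal.{0}} {T : Set Ordinal.{0}} {c : Cardinal.{0}}
    (hT : ∀ γ < α, ∃ δ ∈ T, γ ≤ δ)
    (p : Ordinal → Ordinal) (hp : ∀ t ∈ T, p t < c.ord) (hJ : c < α.cof) :
    ∃ j < c.ord, ∀ γ < α, ∃ δ ∈ T, p δ = j ∧ γ ≤ δ :=
  CBS.split (J := Set.Iio c.ord) hT p hp (by rw [CBS.mkIio, Cardinal.card_ord]; exact Cardinal.lift_lt.2 hJ)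

/-- closure sequence -/
theorem CBS.seqN {χ : Cardinal.{0}} (hχ : χ.IsRegular) (h : Ordinal.{0} → Ordinal.{0})
    (hh : ∀ x < χ.ord, h x < χ.ord) (ν0 : Ordinal.{0}) (hν : ν0 < χ.ord) :
    ∃ N : Ordinal → Ordinal, (∀ ξ < χ.ord, N ξ < χ.ord) ∧ (∀ ξ η, ξ < η → N ξ < N η) ∧
      (∀ ξ, ν0 ≤ N ξ) ∧ (∀ ξ, h (N ξ) < N (Order.succ ξ)) ∧
      (∀ l, Order.IsSuccLimit l → ∀ x < N l, ∃ ξ < l, x < N ξ) := by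
  obtain ⟨N, hN⟩ := CBS.wfrec (X := Ordinal.{0})
    (fun ξ r => max ν0 (sSup ((fun η => max (Order.succ (r η)) (Order.succ (h (r η)))) '' Set.Iio ξ)))
    (by
      intro α r r' hr
      congr 2
      apply Set.image_congr
      intro a ha
      simp only [hr a ha])
  have hb : ∀ ξ η, η < ξ → max (Order.succ (N η)) (Order.succ (h (N η))) ≤ N ξ := by
    intro ξ η hη
    rw [hN ξ]
    apply le_max_of_le_right
    exact le_csSup (Ordinal.bddAbove_of_small) (Set.mem_image_of_mem (fun η => max (Order.succ (N η)) (Order.succ (h (N η)))) hη)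
  refine ⟨N, ?_, ?_, ?_, ?_, ?_⟩
  · intro ξ
    induction ξ using WellFoundedLT.induction with
    | ind ξ ih =>
      intro hξ
      rw [hN]
      apply max_lt hν
      obtain ⟨b, hb, hb'⟩ := CBS.regbdd_img hχ hξ (fun η => max (Order.succ (N η)) (Order.succ (h (N η))))
        (by
          intro x hx
          have hl := Cardinal.isSuccLimit_ord hχ.aleph0_le
          have := ih x hx (hx.trans hξ)
          exact max_lt (hl.succ_lt this) (hl.succ_lt (hh _ this)))
      refine lt_of_le_of_lt ?_ hb
      apply csSup_le'
      rintro _ ⟨x, hx, rfl⟩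
      exact (hb' x hx).le
  · intro ξ η hξ
    exact (Order.lt_succ _).trans_le ((le_max_left _ _).trans (hb η ξ hξ))
  · intro ξ; rw [hN]; exact le_max_left _ _
  · intro ξ
    exact (Order.lt_succ _).trans_le ((le_max_right _ _).trans (hb _ ξ (Order.lt_succ ξ)))
  · intro l hl x hx
    rw [hN l] at hx
    rcases lt_max_iff.1 hx with h1 | h1
    · exact ⟨0, hl.bot_lt, h1.trans_le (by rw [hN]; exact le_max_left _ _)⟩
    · obtain ⟨y, ⟨η, hη, rfl⟩, hy⟩ := exists_lt_of_lt_csSup' h1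
      exact ⟨Order.succ η, hl.succ_lt hη, hy.trans_le (hb _ η (Order.lt_succ η))⟩


def CBS.lts (L : Ordinal.{0}) (f g : Ordinal.{0} → Ordinal.{0}) : Prop :=
  ∃ j < L, ∀ i, j ≤ i → i < L → f i < g i

def CBS.les (L : Ordinal.{0}) (f g : Ordinal.{0} → Ordinal.{0}) : Prop :=
  ∃ j < L, ∀ i, j ≤ i → i < L → f i ≤ g i

theorem CBS.lts.les {L : Ordinal.{0}} {f g : Ordinal.{0} → Ordinal.{0}} (h : CBS.lts L f g) :
    CBS.les L f g := by
  obtain ⟨j, hj, h⟩ := h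
  exact ⟨j, hj, fun i h1 h2 => (h i h1 h2).le⟩

theorem CBS.les.trans {L : Ordinal.{0}} {f g k : Ordinal.{0} → Ordinal.{0}} (h : CBS.les L f g)
    (h' : CBS.les L g k) : CBS.les L f k := by
  obtain ⟨j, hj, h⟩ := h
  obtain ⟨j', hj', h'⟩ := h'
  exact ⟨max j j', max_lt hj hj', fun i h1 h2 =>
    (h i ((le_max_left _ _).trans h1) h2).trans (h' i ((le_max_right _ _).trans h1) h2)⟩

theorem CBS.lts.trans_les {L : Ordinal.{0}} {f g k : Ordinal.{0} → Ordinal.{0}} (h : CBS.lts L f g)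
    (h' : CBS.les L g k) : CBS.lts L f k := by
  obtain ⟨j, hj, h⟩ := h
  obtain ⟨j', hj', h'⟩ := h'
  exact ⟨max j j', max_lt hj hj', fun i h1 h2 =>
    (h i ((le_max_left _ _).trans h1) h2).trans_le (h' i ((le_max_right _ _).trans h1) h2)⟩

theorem CBS.not_les {L : Ordinal.{0}} {f g : Ordinal.{0} → Ordinal.{0}} (h : ¬ CBS.les L f g)
    {j : Ordinal.{0}} (hj : j < L) : ∃ i, j ≤ i ∧ i < L ∧ g i < f i := by
  by_contra hc
  push Not at hc
  exact h ⟨j, hj, hc⟩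

theorem CBS.ptLT_of_lts {μ : Cardinal.{0}} {f g : Ordinal.{0} → Ordinal.{0}}
    (h : CBS.lts μ.ord.cof.ord f g) : ptLT μ f g := by
  obtain ⟨j, hj, h⟩ := h
  unfold ptLT
  have h1 : {i : Ordinal | i < μ.ord.cof.ord ∧ g i ≤ f i} ⊆ Set.Iio j := by
    rintro i ⟨h1, h2⟩
    by_contra hc
    exact absurd h2 (not_le.2 (h i (not_lt.1 hc) h1))
  refine (Cardinal.mk_le_mk_of_subset h1).trans_lt ?_
  rw [CBS.mkIio]
  exact Cardinal.lift_lt.2 (Cardinal.lt_ord.1 hj)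

/-- the combinatorial system of sets -/
def CBS.WSys (μ : Cardinal.{0}) (θ : Ordinal.{0} → Cardinal.{0})
    (W : Ordinal.{0} → Ordinal.{0} → Set Ordinal.{0}) : Prop :=
  (∀ a < (Order.succ μ).ord, ∀ i < μ.ord.cof.ord, #(W a i) ≤ Cardinal.lift.{1} (θ i)) ∧
  (∀ a i, W a i ⊆ Set.Iio a) ∧
  (∀ a < (Order.succ μ).ord, ∀ i j, i ≤ j → j < μ.ord.cof.ord → W a i ⊆ W a j) ∧
  (∀ a < (Order.succ μ).ord, ∀ γ < a, ∃ i < μ.ord.cof.ord, γ ∈ W a i) ∧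
  (∀ α < (Order.succ μ).ord, μ.ord.cof < α.cof → ∃ C, IsClubIn C α ∧
    ∀ β ∈ C, ∃ i < μ.ord.cof.ord, ∀ γ ∈ C, γ < β → γ ∈ W β i)

theorem CBS.partA {μ : Cardinal.{0}} {θ : Ordinal.{0} → Cardinal.{0}}
    {W : Ordinal.{0} → Ordinal.{0} → Set Ordinal.{0}} (hW : CBS.WSys μ θ W)
    (μs : Ordinal.{0} → Cardinal.{0}) (hμs : ∀ i < μ.ord.cof.ord, (μs i).IsRegular ∧ θ i < μs i)
    (k : Ordinal.{0} → Ordinal.{0} → Ordinal.{0})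
    (hk : ∀ β < (Order.succ μ).ord, ∀ i < μ.ord.cof.ord, k β i < (μs i).ord) :
    ∃ f : Ordinal.{0} → Ordinal.{0} → Ordinal.{0},
      (∀ β < (Order.succ μ).ord, ∀ i < μ.ord.cof.ord, f β i < (μs i).ord) ∧
      (∀ β < (Order.succ μ).ord, ∀ i < μ.ord.cof.ord, k β i < f β i) ∧
      (∀ β < (Order.succ μ).ord, ∀ γ < β, CBS.lts μ.ord.cof.ord (f γ) (f β)) ∧
      (∀ α < (Order.succ μ).ord, μ.ord.cof < α.cof → BetterAt μ f α) := by
  obtain ⟨hW1, hW2, hW3, hW4, hW5⟩ := hW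
  obtain ⟨f, hf⟩ := CBS.wfrec (X := Ordinal.{0} → Ordinal.{0})
    (fun β r i => max (Order.succ (k β i)) (sSup ((fun γ => Order.succ (r γ i)) '' W β i)))
    (by
      intro α r r' hr
      funext i
      congr 2
      apply Set.image_congr
      intro a ha
      simp only [hr a (hW2 _ _ ha)])
  have key : ∀ β < (Order.succ μ).ord, ∀ i < μ.ord.cof.ord, ∀ γ ∈ W β i, f γ i < f β i := by
    intro β hβ i hi γ hγ
    rw [hf β]
    apply (Order.lt_succ _).trans_le
    apply le_max_of_le_right
    refine le_csSup ?_ (Set.mem_image_of_mem (fun γ => Order.succ (f γ i)) hγ)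
    exact (Ordinal.bddAbove_of_small (s := (fun γ => Order.succ (f γ i)) '' Set.Iio β)).mono
      (Set.image_mono (hW2 β i))
  refine ⟨f, ?_, ?_, ?_, ?_⟩
  · intro β
    induction β using WellFoundedLT.induction with
    | ind β ih =>
      intro hβ i hi
      rw [hf]
      have hl := Cardinal.isSuccLimit_ord (hμs i hi).1.aleph0_le
      apply max_lt (hl.succ_lt (hk β hβ i hi))
      obtain ⟨b, hb, hb'⟩ := CBS.regbdd (hμs i hi).1 (S := (fun γ => Order.succ (f γ i)) '' W β i)
        (by
          rintro _ ⟨x, hx, rfl⟩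
          have hx' := hW2 _ _ hx
          exact hl.succ_lt (ih x hx' (lt_trans hx' hβ) i hi))
        (Cardinal.mk_image_le.trans_lt ((hW1 β hβ i hi).trans_lt (Cardinal.lift_lt.2 (hμs i hi).2)))
      exact (csSup_le' (fun x hx => (hb' x hx).le)).trans_lt hb
  · intro β hβ i hi
    rw [hf]
    exact (Order.lt_succ _).trans_le (le_max_left _ _)
  · intro β hβ γ hγ
    obtain ⟨i, hi, h⟩ := hW4 β hβ γ hγ
    exact ⟨i, hi, fun i' h1 h2 => key β hβ i' h2 γ (hW3 β hβ _ _ h1 h2 h)⟩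
  · intro α hα hc
    obtain ⟨C, hC, h⟩ := hW5 α hα hc
    refine ⟨C, hC, fun β hβ => ?_⟩
    obtain ⟨j, hj, hj'⟩ := h β hβ
    have hβ' : β < (Order.succ μ).ord := lt_trans (hC.1 hβ) hα
    exact ⟨j, hj, fun i h1 h2 γ h3 h4 => key β hβ' i h2 γ (hW3 β hβ' _ _ h1 h2 (hj' γ h3 h4))⟩

theorem CBS.good {μ : Cardinal.{0}} {f : Ordinal.{0} → Ordinal.{0} → Ordinal.{0}} {α : Ordinal.{0}}
    (h : BetterAt μ f α) (hα : μ.ord.cof < α.cof) :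
    ∃ j < μ.ord.cof.ord, ∃ C ⊆ Set.Iio α, (∀ γ < α, ∃ δ ∈ C, γ ≤ δ) ∧
      ∀ β ∈ C, ∀ γ ∈ C, γ < β → ∀ i, j ≤ i → i < μ.ord.cof.ord → f γ i < f β i := by
  obtain ⟨C, hC, h⟩ := h
  have h' : ∀ β, ∃ j, β ∈ C → j < μ.ord.cof.ord ∧
      ∀ i, j ≤ i → i < μ.ord.cof.ord → ∀ γ ∈ C, γ < β → f γ i < f β i := by
    intro β
    by_cases hβ : β ∈ C
    · obtain ⟨j, h1, h2⟩ := h β hβ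
      exact ⟨j, fun _ => ⟨h1, h2⟩⟩
    · exact ⟨0, fun h => absurd h hβ⟩
  choose p hp using h'
  obtain ⟨j, hj, hT⟩ := CBS.splitOrd hC.2.2 p (fun t ht => (hp t ht).1) hα
  refine ⟨j, hj, {β | β ∈ C ∧ p β = j}, fun x hx => hC.1 hx.1, ?_, ?_⟩
  · intro γ hγ
    obtain ⟨δ, h1, h2, h3⟩ := hT γ hγ
    exact ⟨δ, ⟨h1, h2⟩, h3⟩
  · rintro β ⟨hβ, rfl⟩ γ ⟨hγ, -⟩ hlt i h1 h2
    exact (hp β hβ).2 i h1 h2 γ hγ hlt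

theorem CBS.seqN' {χ : Cardinal.{0}} (hχ : χ.IsRegular) (h : Ordinal.{0} → Ordinal.{0})
    (hh : ∀ x < χ.ord, h x < χ.ord) (ν0 : Ordinal.{0}) (hν : ν0 < χ.ord) :
    ∃ N : Ordinal → Ordinal, (∀ ξ < χ.ord, N ξ < χ.ord) ∧ (∀ ξ η, ξ < η → N ξ < N η) ∧
      (∀ ξ, ν0 ≤ N ξ) ∧ (∀ ξ < χ.ord, ∀ x ≤ N ξ, h x < N (Order.succ ξ)) ∧
      (∀ l, Order.IsSuccLimit l → ∀ x < N l, ∃ ξ < l, x < N ξ) := by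
  have hl := Cardinal.isSuccLimit_ord hχ.aleph0_le
  have : ∀ ν, ∃ b, ν < χ.ord → b < χ.ord ∧ ∀ x ≤ ν, h x < b := by
    intro ν
    by_cases hν : ν < χ.ord
    · obtain ⟨b, h1, h2⟩ := CBS.regbdd_img hχ (hl.succ_lt hν) h
        (fun x hx => hh x ((Order.lt_succ_iff.1 hx).trans_lt hν))
      exact ⟨b, fun _ => ⟨h1, fun x hx => h2 x (Order.lt_succ_iff.2 hx)⟩⟩
    · exact ⟨0, fun h => absurd h hν⟩
  choose H hH using this
  obtain ⟨N, h1, h2, h3, h4, h5⟩ := CBS.seqN hχ H (fun x hx => (hH x hx).1) ν0 hν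
  exact ⟨N, h1, h2, h3, fun ξ hξ x hx => ((hH _ (h1 ξ hξ)).2 x hx).trans (h4 ξ), h5⟩

theorem CBS.cofN {θ : Cardinal.{0}} (hθ : θ.IsRegular) (N : Ordinal.{0} → Ordinal.{0})
    (hN : ∀ ξ η, ξ < η → N ξ < N η) (hl : ∀ x < N θ.ord, ∃ ξ < θ.ord, x < N ξ) :
    θ ≤ (N θ.ord).cof := by
  by_contra hc
  push Not at hc
  obtain ⟨D, h1, h2, h3⟩ := CBS.fund (N θ.ord)
  have : ∀ x, ∃ ξ, x < (N θ.ord).cof.ord → ξ < θ.ord ∧ D x < N ξ := by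
    intro x
    by_cases hx : x < (N θ.ord).cof.ord
    · obtain ⟨ξ, h4, h5⟩ := hl _ (h1 x hx)
      exact ⟨ξ, fun _ => ⟨h4, h5⟩⟩
    · exact ⟨0, fun h => absurd h hx⟩
  choose p hp using this
  obtain ⟨b, hb, hb'⟩ := CBS.regbdd_img hθ (Cardinal.ord_lt_ord.2 hc) p (fun x hx => (hp x hx).1)
  obtain ⟨x, hx, hx'⟩ := h3 (N b) (hN _ _ hb)
  exact absurd (hx'.trans_lt (((hp x hx).2).trans (hN _ _ (hb' x hx)))) (lt_irrefl _)

/-- projection to a set -/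
noncomputable def CBS.pr (S : Set Ordinal.{0}) (x : Ordinal.{0}) : Ordinal.{0} :=
  sInf {s | s ∈ S ∧ x ≤ s}

theorem CBS.pr_mem {S : Set Ordinal.{0}} {x : Ordinal.{0}} (h : ∃ s ∈ S, x ≤ s) :
    CBS.pr S x ∈ S ∧ x ≤ CBS.pr S x := by
  obtain ⟨s, h1, h2⟩ := h
  exact csInf_mem (s := {s | s ∈ S ∧ x ≤ s}) ⟨s, h1, h2⟩

theorem CBS.pr_le {S : Set Ordinal.{0}} {x s : Ordinal.{0}} (h : s ∈ S) (hx : x ≤ s) :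
    CBS.pr S x ≤ s := csInf_le' ⟨h, hx⟩

structure CBS.Good (μ : Cardinal.{0}) (f : Ordinal.{0} → Ordinal.{0} → Ordinal.{0}) : Prop where
  inc : ∀ β < (Order.succ μ).ord, ∀ γ < β, CBS.lts μ.ord.cof.ord (f γ) (f β)
  good : ∀ α < (Order.succ μ).ord, μ.ord.cof < α.cof → ∃ j < μ.ord.cof.ord, ∃ C ⊆ Set.Iio α,
    (∀ γ < α, ∃ δ ∈ C, γ ≤ δ) ∧
      ∀ β ∈ C, ∀ γ ∈ C, γ < β → ∀ i, j ≤ i → i < μ.ord.cof.ord → f γ i < f β i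

theorem CBS.bpp {μ : Cardinal.{0}} (hμ : ℵ₀ ≤ μ) {f : Ordinal.{0} → Ordinal.{0} → Ordinal.{0}}
    (hf : CBS.Good μ f) {θ : Cardinal.{0}} (hθ : θ.IsRegular) (hθ1 : μ.ord.cof < θ)
    (hθ2 : θ ≤ μ) (S : Ordinal.{0} → Set Ordinal.{0})
    (hS : ∀ i < μ.ord.cof.ord, #(S i) < Cardinal.lift.{1} θ)
    (hd : ∀ ξ < (Order.succ μ).ord, ∃ j < μ.ord.cof.ord, ∀ i, j ≤ i → i < μ.ord.cof.ord →
      ∃ s ∈ S i, f ξ i ≤ s) :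
    ∃ ξ < (Order.succ μ).ord, ∀ ξ' < (Order.succ μ).ord,
      CBS.les μ.ord.cof.ord (f ξ') (fun i => CBS.pr (S i) (f ξ i)) := by
  by_contra hcon
  push Not at hcon
  have : ∀ ξ, ∃ ξ', ξ < (Order.succ μ).ord → ξ' < (Order.succ μ).ord ∧
      ¬ CBS.les μ.ord.cof.ord (f ξ') (fun i => CBS.pr (S i) (f ξ i)) := by
    intro ξ
    by_cases h : ξ < (Order.succ μ).ord
    · obtain ⟨a, h1, h2⟩ := hcon ξ h
      exact ⟨a, fun _ => ⟨h1, h2⟩⟩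
    · exact ⟨0, fun h' => absurd h' h⟩
  choose h hh using this
  have hreg : (Order.succ μ).IsRegular := Cardinal.isRegular_succ hμ
  obtain ⟨N, hN1, hN2, -, hN4, hN5⟩ := CBS.seqN' hreg h (fun x hx => (hh x hx).1) 0
    (Cardinal.isSuccLimit_ord hreg.aleph0_le).bot_lt
  have hθM : θ.ord < (Order.succ μ).ord := Cardinal.ord_lt_ord.2 (Order.lt_succ_of_le hθ2)
  have hθl := Cardinal.isSuccLimit_ord hθ.aleph0_le
  have hlim := hN5 θ.ord hθl
  set α := N θ.ord with hαdef
  have hαM : α < (Order.succ μ).ord := hN1 _ hθM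
  have hcof : θ ≤ α.cof := CBS.cofN hθ N hN2 hlim
  have hlc : μ.ord.cof < α.cof := hθ1.trans_le hcof
  obtain ⟨j, hj, C, hC1, hC2, hC3⟩ := hf.good α hαM hlc
  have step : ∀ β ∈ C, ∃ i s b, j ≤ i ∧ i < μ.ord.cof.ord ∧ s ∈ S i ∧ b ∈ C ∧ f β i ≤ s ∧ s < f b i := by
    intro β hβ
    obtain ⟨ξ, hξ, hβξ⟩ := hlim β (hC1 hβ)
    have hβM : β < (Order.succ μ).ord := lt_trans (hC1 hβ) hαM
    have h1 : h β < N (Order.succ ξ) := hN4 ξ (hξ.trans hθM) β hβξ.le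
    obtain ⟨b, hb, hb'⟩ := hC2 (N (Order.succ ξ)) (hN2 _ _ (hθl.succ_lt hξ))
    obtain ⟨j1, hj1, hj1'⟩ := hd β hβM
    obtain ⟨j2, hj2, hj2'⟩ := hf.inc b (lt_trans (hC1 hb) hαM) (h β) (h1.trans_le hb')
    obtain ⟨i, hi, hiL, hi'⟩ := CBS.not_les (hh β hβM).2 (max_lt hj (max_lt hj1 hj2))
    simp only [max_le_iff] at hi
    obtain ⟨hp1, hp2⟩ := CBS.pr_mem (hj1' i hi.2.1 hiL)
    exact ⟨i, _, b, hi.1, hiL, hp1, hb, hp2, hi'.trans (hj2' i hi.2.2 hiL)⟩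
  have step' : ∀ β, ∃ i s b, β ∈ C → (j ≤ i ∧ i < μ.ord.cof.ord ∧ s ∈ S i ∧ b ∈ C ∧ f β i ≤ s ∧ s < f b i) := by
    intro β
    by_cases hβ : β ∈ C
    · obtain ⟨i, s, b, h⟩ := step β hβ
      exact ⟨i, s, b, fun _ => h⟩
    · exact ⟨0, 0, 0, fun h => absurd h hβ⟩
  choose pi ps pb hp using step'
  obtain ⟨i, hi, hT⟩ := CBS.splitOrd hC2 pi (fun t ht => (hp t ht).2.1) hlc
  obtain ⟨s, hs, hT'⟩ := CBS.split (α := α) (T := {β | β ∈ C ∧ pi β = i}) (J := S i)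
    (fun γ hγ => by
      obtain ⟨δ, h1, h2, h3⟩ := hT γ hγ
      exact ⟨δ, ⟨h1, h2⟩, h3⟩) ps (by
      rintro t ⟨ht, rfl⟩
      exact (hp t ht).2.2.1) ((hS i hi).trans_le (Cardinal.lift_le.2 hcof))
  have hα0 : 0 < α := by
    have := hN2 0 θ.ord hθl.bot_lt
    exact zero_le.trans_lt this
  obtain ⟨β, ⟨hβ, hβi⟩, hβs, -⟩ := hT' 0 hα0
  obtain ⟨h1, -, -, h4, h5, h6⟩ := hp β hβ
  obtain ⟨δ, ⟨hδ, hδi⟩, hδs, hle⟩ := hT' (pb β) (hC1 h4)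
  obtain ⟨-, -, -, -, h5', -⟩ := hp δ hδ
  rw [hβi, hβs] at h6
  rw [hδi, hδs] at h5'
  rw [hβi] at h1
  have : f (pb β) i ≤ f δ i := by
    rcases hle.lt_or_eq with h | h
    · exact (hC3 δ hδ _ h4 h i h1 hi).le
    · rw [h]
  exact absurd (h6.trans_le (this.trans h5')) (lt_irrefl _)


theorem CBS.exists_lub {μ : Cardinal.{0}} (hμ : ℵ₀ ≤ μ) (hs : μ.ord.cof < μ)
    {f : Ordinal.{0} → Ordinal.{0} → Ordinal.{0}}
    (hf : CBS.Good μ f) (U : Ordinal.{0} → Ordinal.{0})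
    (hU : ∀ ξ < (Order.succ μ).ord, ∀ i < μ.ord.cof.ord, f ξ i ≤ U i) :
    ∃ h : Ordinal.{0} → Ordinal.{0}, (∀ i < μ.ord.cof.ord, h i ≤ U i) ∧
      (∀ ξ < (Order.succ μ).ord, CBS.les μ.ord.cof.ord (f ξ) h) ∧
      ∀ u, (∀ ξ < (Order.succ μ).ord, CBS.les μ.ord.cof.ord (f ξ) u) → CBS.les μ.ord.cof.ord h u := by
  by_contra hcon
  push Not at hcon
  have hcl : ℵ₀ ≤ μ.ord.cof := Ordinal.aleph0_le_cof.2 (Cardinal.isSuccLimit_ord hμ)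
  have hL := Cardinal.isSuccLimit_ord hcl
  have hregM : (Order.succ μ).IsRegular := Cardinal.isRegular_succ hμ
  set l := μ.ord.cof with hldef
  have hreg : (Order.succ l).IsRegular := Cardinal.isRegular_succ hcl
  let S : (Ordinal.{0} → Ordinal.{0} → Ordinal.{0}) → Ordinal.{0} → Ordinal.{0} → Set Ordinal.{0} :=
    fun r α i => ((fun β => r β i) '' Set.Iio α) ∪ {U i}
  let P : (Ordinal.{0} → Ordinal.{0} → Ordinal.{0}) → Ordinal.{0} → (Ordinal.{0} → Ordinal.{0}) → Prop :=
    fun r α u => ∃ ξ < (Order.succ μ).ord, (∀ ξ < (Order.succ μ).ord, CBS.les l.ord (f ξ) u) ∧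
      ¬ CBS.les l.ord (fun i => CBS.pr (S r α i) (f ξ i)) u
  classical
  obtain ⟨u, hu⟩ := CBS.wfrec (X := Ordinal.{0} → Ordinal.{0})
    (fun α r => if h : ∃ u, P r α u then h.choose else U)
    (by
      intro α r r' hr
      have : S r α = S r' α := by
        funext i
        show _ ∪ _ = _ ∪ _
        congr 1
        apply Set.image_congr
        intro a ha
        simp only [hr a ha]
      have : P r α = P r' α := by
        funext u
        simp only [P, this]
      simp only [this])
  have hUS : ∀ α i, U i ∈ S u α i := fun α i => Or.inr rfl
  have hP : ∀ α < (Order.succ l).ord, P u α (u α) := by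
    intro α hα
    have hex : ∃ v, P u α v := by
      obtain ⟨ξ, hξ, h⟩ := CBS.bpp hμ hf hreg (Order.lt_succ l) (Order.succ_le_of_lt hs) (S u α)
        (by
          intro i hi
          refine (Cardinal.mk_union_le _ _).trans_lt ?_
          have hreg' : ℵ₀ ≤ Cardinal.lift.{1} (Order.succ l) := by
            exact Cardinal.aleph0_le_lift.2 hreg.aleph0_le
          apply Cardinal.add_lt_of_lt hreg'
          · refine Cardinal.mk_image_le.trans_lt ?_
            rw [CBS.mkIio]
            exact Cardinal.lift_lt.2 (Cardinal.lt_ord.1 hα)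
          · rw [Cardinal.mk_singleton]
            exact Cardinal.one_lt_aleph0.trans_le hreg')
        (fun ξ hξ => ⟨0, hL.bot_lt, fun i _ hi => ⟨U i, hUS α i, hU ξ hξ i hi⟩⟩)
      obtain ⟨v, hv1, hv2⟩ := hcon (fun i => CBS.pr (S u α i) (f ξ i))
        (fun i hi => CBS.pr_le (hUS α i) (hU ξ hξ i hi)) h
      exact ⟨v, ξ, hξ, hv1, hv2⟩
    rw [hu α, dif_pos hex]
    exact hex.choose_spec
  have hP' : ∀ α, ∃ ξ, α < (Order.succ l).ord → ξ < (Order.succ μ).ord ∧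
      ¬ CBS.les l.ord (fun i => CBS.pr (S u α i) (f ξ i)) (u α) := by
    intro α
    by_cases hα : α < (Order.succ l).ord
    · obtain ⟨ξ, h1, h2, h3⟩ := hP α hα
      exact ⟨ξ, fun _ => ⟨h1, h3⟩⟩
    · exact ⟨0, fun h => absurd h hα⟩
  choose x hx using hP'
  obtain ⟨ξ, hξ, hξx⟩ := CBS.regbdd_img hregM (a := (Order.succ l).ord)
    (Cardinal.ord_lt_ord.2 (Order.succ_lt_succ hs)) x (fun α hα => (hx α hα).1)
  have hI : ∀ α, ∃ i, α < (Order.succ l).ord →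
      i < l.ord ∧ f ξ i ≤ u α i ∧ u α i < CBS.pr (S u α i) (f ξ i) := by
    intro α
    by_cases hα : α < (Order.succ l).ord
    · obtain ⟨-, -, h2, -⟩ := hP α hα
      obtain ⟨j1, hj1, hj1'⟩ := h2 ξ hξ
      obtain ⟨j2, hj2, hj2'⟩ := hf.inc ξ hξ (x α) (hξx α hα)
      obtain ⟨i, hi, hiL, hi'⟩ := CBS.not_les (hx α hα).2 (max_lt hj1 hj2)
      simp only [max_le_iff] at hi
      refine ⟨i, fun _ => ⟨hiL, hj1' i hi.1 hiL, hi'.trans_le ?_⟩⟩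
      obtain ⟨h3, h4⟩ := CBS.pr_mem (S := S u α i) (x := f ξ i) ⟨U i, hUS α i, hU ξ hξ i hiL⟩
      exact CBS.pr_le h3 ((hj2' i hi.2 hiL).le.trans h4)
    · exact ⟨0, fun h => absurd h hα⟩
  choose pi hpi using hI
  obtain ⟨i, hi, hT⟩ := CBS.splitOrd (α := (Order.succ l).ord) (T := Set.Iio (Order.succ l).ord)
    (c := l) (fun γ hγ => ⟨γ, hγ, le_rfl⟩) pi (fun t ht => (hpi t ht).1)
    (by rw [hreg.cof_ord]; exact Order.lt_succ l)
  have hl' := Cardinal.isSuccLimit_ord hreg.aleph0_le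
  obtain ⟨α0, h0, h0', -⟩ := hT 0 hl'.bot_lt
  let V : Set Ordinal.{0} := (fun α => CBS.pr (S u α i) (f ξ i)) '' {α | α < (Order.succ l).ord ∧ pi α = i}
  have hV : V.Nonempty := ⟨_, α0, ⟨h0, h0'⟩, rfl⟩
  obtain ⟨α, ⟨hα, hαi⟩, hα'⟩ := csInf_mem hV
  obtain ⟨β, hβ, hβi, hβα⟩ := hT (Order.succ α) (hl'.succ_lt hα)
  have h1 : sInf V ≤ CBS.pr (S u β i) (f ξ i) := csInf_le' ⟨β, ⟨hβ, hβi⟩, rfl⟩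
  obtain ⟨-, h3, h4⟩ := hpi α hα
  rw [hαi] at h3 h4
  have h2 : CBS.pr (S u β i) (f ξ i) ≤ u α i :=
    CBS.pr_le (Or.inl ⟨α, Order.succ_le_iff.1 hβα, rfl⟩) h3
  rw [← hα'] at h1
  exact absurd (h1.trans_lt (h2.trans_lt h4)) (lt_irrefl _)

theorem CBS.eub {μ : Cardinal.{0}} (hμ : ℵ₀ ≤ μ) (hs : μ.ord.cof < μ)
    {f : Ordinal.{0} → Ordinal.{0} → Ordinal.{0}}
    (hf : CBS.Good μ f) (h : Ordinal.{0} → Ordinal.{0})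
    (h1 : ∀ ξ < (Order.succ μ).ord, CBS.les μ.ord.cof.ord (f ξ) h)
    (h2 : ∀ u, (∀ ξ < (Order.succ μ).ord, CBS.les μ.ord.cof.ord (f ξ) u) → CBS.les μ.ord.cof.ord h u)
    (g : Ordinal.{0} → Ordinal.{0}) (hg : CBS.lts μ.ord.cof.ord g h) :
    ∃ ξ < (Order.succ μ).ord, CBS.lts μ.ord.cof.ord g (f ξ) := by
  have hcl : ℵ₀ ≤ μ.ord.cof := Ordinal.aleph0_le_cof.2 (Cardinal.isSuccLimit_ord hμ)
  have hreg : (Order.succ μ.ord.cof).IsRegular := Cardinal.isRegular_succ hcl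
  obtain ⟨ξ, hξ, hh⟩ := CBS.bpp hμ hf hreg (Order.lt_succ _) (Order.succ_le_of_lt hs) (fun i => {g i, h i})
    (by
      intro i hi
      have : ℵ₀ ≤ Cardinal.lift.{1} (Order.succ μ.ord.cof) := Cardinal.aleph0_le_lift.2 hreg.aleph0_le
      refine lt_of_lt_of_le ?_ this
      exact (Set.toFinite _).lt_aleph0)
    (by
      intro ξ hξ
      obtain ⟨j, hj, hj'⟩ := h1 ξ hξ
      exact ⟨j, hj, fun i hi hi' => ⟨h i, by simp, hj' i hi hi'⟩⟩)
  obtain ⟨j1, hj1, hj1'⟩ := h2 _ hh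
  obtain ⟨j2, hj2, hj2'⟩ := hg
  refine ⟨ξ, hξ, max j1 j2, max_lt hj1 hj2, fun i hi hiL => ?_⟩
  rw [max_le_iff] at hi
  by_contra hc
  have h3 : CBS.pr {g i, h i} (f ξ i) ≤ g i := CBS.pr_le (by simp) (not_lt.1 hc)
  exact absurd ((hj1' i hi.1 hiL).trans_lt (h3.trans_lt (hj2' i hi.2 hiL))) (lt_irrefl _)

theorem CBS.strict_ub {μ : Cardinal.{0}} (hμ : ℵ₀ ≤ μ)
    {f : Ordinal.{0} → Ordinal.{0} → Ordinal.{0}}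
    (hf : CBS.Good μ f) (h : Ordinal.{0} → Ordinal.{0})
    (h1 : ∀ ξ < (Order.succ μ).ord, CBS.les μ.ord.cof.ord (f ξ) h) :
    ∀ ξ < (Order.succ μ).ord, CBS.lts μ.ord.cof.ord (f ξ) h := by
  intro ξ hξ
  have hregM : (Order.succ μ).IsRegular := Cardinal.isRegular_succ hμ
  have : Order.succ ξ < (Order.succ μ).ord := (Cardinal.isSuccLimit_ord hregM.aleph0_le).succ_lt hξ
  exact (hf.inc _ this ξ (Order.lt_succ ξ)).trans_les (h1 _ this)

theorem CBS.cof_eub {μ : Cardinal.{0}} (hμ : ℵ₀ ≤ μ)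
    {f : Ordinal.{0} → Ordinal.{0} → Ordinal.{0}}
    (hf : CBS.Good μ f) (h : Ordinal.{0} → Ordinal.{0})
    (h1 : ∀ ξ < (Order.succ μ).ord, CBS.les μ.ord.cof.ord (f ξ) h)
    (h2 : ∀ u, (∀ ξ < (Order.succ μ).ord, CBS.les μ.ord.cof.ord (f ξ) u) → CBS.les μ.ord.cof.ord h u)
    {θ : Cardinal.{0}} (hθ : θ.IsRegular) (hθ1 : μ.ord.cof < θ) (hθ2 : θ ≤ μ) :
    ∃ j < μ.ord.cof.ord, ∀ i, j ≤ i → i < μ.ord.cof.ord → θ ≤ (h i).cof := by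
  by_contra hcon
  push Not at hcon
  classical
  choose D hD1 hD2 hD3 using CBS.fund
  have hst := CBS.strict_ub hμ hf h h1
  obtain ⟨ξ, hξ, hh⟩ := CBS.bpp hμ hf hθ hθ1 hθ2
    (fun i => if (h i).cof < θ then D (h i) '' Set.Iio (h i).cof.ord else {h i})
    (by
      intro i hi
      split_ifs with hc
      · refine Cardinal.mk_image_le.trans_lt ?_
        rw [CBS.mkIio, Cardinal.card_ord]
        exact Cardinal.lift_lt.2 hc
      · have : ℵ₀ ≤ Cardinal.lift.{1} θ := by simpa using hθ.aleph0_le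
        refine lt_of_lt_of_le ?_ this
        exact (Set.toFinite _).lt_aleph0)
    (by
      intro ξ hξ
      obtain ⟨j, hj, hj'⟩ := hst ξ hξ
      refine ⟨j, hj, fun i hi hi' => ?_⟩
      split_ifs with hc
      · obtain ⟨x, hx, hx'⟩ := hD3 (h i) _ (hj' i hi hi')
        exact ⟨_, ⟨x, hx, rfl⟩, hx'⟩
      · exact ⟨h i, rfl, (hj' i hi hi').le⟩)
  obtain ⟨j1, hj1, hj1'⟩ := h2 _ hh
  obtain ⟨j2, hj2, hj2'⟩ := hst ξ hξ
  obtain ⟨i, hi, hiL, hic⟩ := hcon (max j1 j2) (max_lt hj1 hj2)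
  rw [max_le_iff] at hi
  have h3 := hj1' i hi.1 hiL
  simp only [hic, if_true] at h3
  obtain ⟨x, hx, hx'⟩ := hD3 (h i) _ (hj2' i hi.2 hiL)
  obtain ⟨⟨y, hy, hy'⟩, -⟩ := CBS.pr_mem (S := D (h i) '' Set.Iio (h i).cof.ord) (x := f ξ i)
    ⟨_, ⟨x, hx, rfl⟩, hx'⟩
  rw [← hy'] at h3
  exact absurd (h3.trans_lt (hD1 (h i) y hy)) (lt_irrefl _)

theorem CBS.theta {μ : Cardinal.{0}} (hμ : ℵ₀ ≤ μ) (hs : μ.ord.cof < μ) :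
    ∃ θ : Ordinal.{0} → Cardinal.{0}, (∀ i < μ.ord.cof.ord, ℵ₀ ≤ θ i ∧ θ i < μ) ∧
      (∀ i j, i ≤ j → j < μ.ord.cof.ord → θ i ≤ θ j) ∧ (∀ c < μ, ∃ i < μ.ord.cof.ord, c ≤ θ i) := by
  obtain ⟨D, h1, h2, h3⟩ := CBS.fund μ.ord
  have hcl : ℵ₀ ≤ μ.ord.cof := Ordinal.aleph0_le_cof.2 (Cardinal.isSuccLimit_ord hμ)
  refine ⟨fun i => max ℵ₀ (D i).card, ?_, ?_, ?_⟩
  · intro i hi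
    exact ⟨le_max_left _ _, max_lt (hcl.trans_lt hs) (Cardinal.lt_ord.1 (h1 i hi))⟩
  · intro i j hij hj
    apply max_le_max le_rfl
    apply Ordinal.card_le_card
    rcases hij.lt_or_eq with h | h
    · exact (h2 i j h hj).le
    · rw [h]
  · intro c hc
    obtain ⟨x, hx, hx'⟩ := h3 c.ord (Cardinal.ord_lt_ord.2 hc)
    exact ⟨x, hx, le_max_of_le_right (Cardinal.ord_le.1 hx')⟩

theorem CBS.succ_lt {μ c : Cardinal.{0}} (hμ : ℵ₀ ≤ μ) (hs : μ.ord.cof < μ) (hc : c < μ) :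
    Order.succ c < μ := by
  rcases lt_or_ge c ℵ₀ with h | h
  · have : Order.succ c ≤ ℵ₀ := Order.succ_le_of_lt h
    have hcl : ℵ₀ ≤ μ.ord.cof := Ordinal.aleph0_le_cof.2 (Cardinal.isSuccLimit_ord hμ)
    exact this.trans_lt (hcl.trans_lt hs)
  · refine lt_of_le_of_ne (Order.succ_le_of_lt hc) ?_
    intro he
    rw [← he, (Cardinal.isRegular_succ h).cof_ord] at hs
    exact lt_irrefl _ hs

theorem CBS.final {μ : Cardinal.{0}} (hμ : ℵ₀ ≤ μ) (hs : μ.ord.cof < μ)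
    {θ : Ordinal.{0} → Cardinal.{0}} (hθ : ∀ i < μ.ord.cof.ord, ℵ₀ ≤ θ i ∧ θ i < μ)
    (hθ3 : ∀ c < μ, ∃ i < μ.ord.cof.ord, c ≤ θ i)
    {W : Ordinal.{0} → Ordinal.{0} → Set Ordinal.{0}} (hW : CBS.WSys μ θ W) :
    ∃ μs f, IsScale μ μs f ∧
      ∀ α < (Order.succ μ).ord, μ.ord.cof < α.cof → BetterAt μ f α := by
  have hcl : ℵ₀ ≤ μ.ord.cof := Ordinal.aleph0_le_cof.2 (Cardinal.isSuccLimit_ord hμ)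
  have hL := Cardinal.isSuccLimit_ord hcl
  have hregM : (Order.succ μ).IsRegular := Cardinal.isRegular_succ hμ
  obtain ⟨f, hf1, -, hf3, hf4⟩ := CBS.partA hW (fun i => Order.succ (θ i))
    (fun i hi => ⟨Cardinal.isRegular_succ (hθ i hi).1, Order.lt_succ _⟩) (fun _ _ => 0)
    (fun β hβ i hi => (Cardinal.isSuccLimit_ord ((hθ i hi).1.trans (Order.le_succ _))).bot_lt)
  have hf : CBS.Good μ f := ⟨hf3, fun α hα hc => CBS.good (hf4 α hα hc) hc⟩
  obtain ⟨h, hh1, hh2, hh3⟩ := CBS.exists_lub hμ hs hf (fun i => (Order.succ (θ i)).ord)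
    (fun ξ hξ i hi => (hf1 ξ hξ i hi).le)
  have hst := CBS.strict_ub hμ hf h hh2
  have hhμ : ∀ i < μ.ord.cof.ord, (h i).cof < μ := by
    intro i hi
    refine (Ordinal.cof_le_card _).trans_lt ?_
    refine (Ordinal.card_le_card (hh1 i hi)).trans_lt ?_
    rw [Cardinal.card_ord]
    exact CBS.succ_lt hμ hs (hθ i hi).2
  classical
  let P : Ordinal.{0} → (Ordinal.{0} → Ordinal.{0}) → Ordinal.{0} → Prop := fun ξ r i =>
    i < μ.ord.cof.ord ∧ ξ ≤ i ∧ θ ξ < (h i).cof ∧ ∀ η < ξ, (h (r η)).cof < (h i).cof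
  obtain ⟨p, hp⟩ := CBS.wfrec (X := Ordinal.{0})
    (fun ξ r => if hx : ∃ i, P ξ r i then hx.choose else 0)
    (by
      intro α r r' hr
      have : P α r = P α r' := by
        funext i
        simp only [P]
        have : (∀ η < α, (h (r η)).cof < (h i).cof) ↔ (∀ η < α, (h (r' η)).cof < (h i).cof) :=
          forall₂_congr (fun η hη => by rw [hr η hη])
        rw [this]
      simp only [this])
  have hP : ∀ ξ < μ.ord.cof.ord, P ξ p (p ξ) := by
    intro ξ
    induction ξ using WellFoundedLT.induction with
    | ind ξ ih =>
      intro hξ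
      have hex : ∃ i, P ξ p i := by
        obtain ⟨b, hb, hb'⟩ := CBS.bdd (a := μ.ord) (S := (fun η => (h (p η)).cof.ord) '' Set.Iio ξ)
          (by
            rintro _ ⟨η, hη, rfl⟩
            exact Cardinal.ord_lt_ord.2 (hhμ _ (ih η hη (lt_trans hη hξ)).1))
          (by
            refine Cardinal.mk_image_le.trans_lt ?_
            rw [CBS.mkIio]
            exact Cardinal.lift_lt.2 (Cardinal.lt_ord.1 hξ))
        have hc : max b.card (max (θ ξ) μ.ord.cof) < μ :=
          max_lt (Cardinal.lt_ord.1 hb) (max_lt (hθ ξ hξ).2 hs)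
        have hc0 : ℵ₀ ≤ max b.card (max (θ ξ) μ.ord.cof) :=
          hcl.trans ((le_max_right _ _).trans (le_max_right _ _))
        obtain ⟨j, hj, hj'⟩ := CBS.cof_eub hμ hf h hh2 hh3 (Cardinal.isRegular_succ hc0)
          (Order.lt_succ_of_le ((le_max_right _ _).trans (le_max_right _ _)))
          (CBS.succ_lt hμ hs hc).le
        have h1 := Order.succ_le_iff.1 (hj' (max j ξ) (le_max_left _ _) (max_lt hj hξ))
        refine ⟨max j ξ, max_lt hj hξ, le_max_right _ _, ?_, ?_⟩
        · exact ((le_max_left _ _).trans (le_max_right _ _)).trans_lt h1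
        · intro η hη
          refine lt_of_le_of_lt ?_ h1
          apply le_max_of_le_left
          exact Cardinal.ord_le.1 (hb' _ ⟨η, hη, rfl⟩)
      rw [hp ξ, dif_pos hex]
      exact hex.choose_spec
  choose D hD1 hD2 hD3 using CBS.fund
  have hinj : ∀ ξ < μ.ord.cof.ord, ∀ η < μ.ord.cof.ord, p ξ = p η → ξ = η := by
    intro ξ hξ η hη he
    rcases lt_trichotomy ξ η with hlt | hlt | hlt
    · have := (hP η hη).2.2.2 ξ hlt
      rw [he] at this
      exact absurd this (lt_irrefl _)
    · exact hlt
    · have := (hP ξ hξ).2.2.2 η hlt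
      rw [he] at this
      exact absurd this (lt_irrefl _)
  have hreg' : ∀ ξ < μ.ord.cof.ord, ((h (p ξ)).cof).IsRegular := by
    intro ξ hξ
    apply Cardinal.isRegular_cof
    apply Ordinal.aleph0_le_cof.1
    exact (hθ ξ hξ).1.trans (hP ξ hξ).2.2.1.le
  have hk : ∀ α ξ, ∃ x, ξ < μ.ord.cof.ord → x < (h (p ξ)).cof.ord ∧
      (f α (p ξ) < h (p ξ) → f α (p ξ) ≤ D (h (p ξ)) x) := by
    intro α ξ
    by_cases hξ : ξ < μ.ord.cof.ord
    · by_cases hlt : f α (p ξ) < h (p ξ)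
      · obtain ⟨x, h1, h2⟩ := hD3 _ _ hlt
        exact ⟨x, fun _ => ⟨h1, fun _ => h2⟩⟩
      · exact ⟨0, fun _ => ⟨(Cardinal.isSuccLimit_ord (hreg' ξ hξ).aleph0_le).bot_lt,
          fun h => absurd h hlt⟩⟩
    · exact ⟨0, fun h => absurd h hξ⟩
  choose k hk using hk
  obtain ⟨F, hF1, hF2, hF3, hF4⟩ := CBS.partA hW (fun ξ => (h (p ξ)).cof)
    (fun ξ hξ => ⟨hreg' ξ hξ, (hP ξ hξ).2.2.1⟩) k (fun β hβ i hi => (hk β i hi).1)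
  refine ⟨fun ξ => (h (p ξ)).cof, F, ⟨?_, ?_, ?_, hF1, ?_, ?_⟩, hF4⟩
  · intro i hi
    exact ⟨hreg' i hi, hhμ _ (hP i hi).1⟩
  · intro i j hij hj
    exact (hP j hj).2.2.2 i hij
  · intro c hc
    obtain ⟨i, hi, hi'⟩ := hθ3 c hc
    exact ⟨i, hi, hi'.trans_lt (hP i hi).2.2.1⟩
  · intro α β hαβ hβ
    exact CBS.ptLT_of_lts (hF3 β hβ α hαβ)
  · intro g hg
    let G : Ordinal.{0} → Ordinal.{0} := fun i =>
      if hx : ∃ ξ, ξ < μ.ord.cof.ord ∧ p ξ = i then D (h i) (g hx.choose) else 0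
    have hG : ∀ ξ < μ.ord.cof.ord, G (p ξ) = D (h (p ξ)) (g ξ) := by
      intro ξ hξ
      have hx : ∃ η, η < μ.ord.cof.ord ∧ p η = p ξ := ⟨ξ, hξ, rfl⟩
      have : hx.choose = ξ := hinj _ hx.choose_spec.1 _ hξ hx.choose_spec.2
      simp only [G, dif_pos hx, this]
    have hM0 : 0 < (Order.succ μ).ord := (Cardinal.isSuccLimit_ord hregM.aleph0_le).bot_lt
    obtain ⟨ζ, hζ, j, hj, hj'⟩ := CBS.eub hμ hs hf h hh2 hh3 G (by
      obtain ⟨j, hj, hj'⟩ := hst 0 hM0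
      refine ⟨j, hj, fun i h1 h2 => ?_⟩
      by_cases hx : ∃ ξ, ξ < μ.ord.cof.ord ∧ p ξ = i
      · obtain ⟨ξ, hξ, rfl⟩ := hx
        rw [hG ξ hξ]
        exact hD1 _ _ (hg ξ hξ)
      · simp only [G, dif_neg hx]
        exact zero_le.trans_lt (hj' i h1 h2))
    obtain ⟨j2, hj2, hj2'⟩ := hst ζ hζ
    refine ⟨ζ, hζ, CBS.ptLT_of_lts ⟨max j j2, max_lt hj hj2, fun ξ h1 h2 => ?_⟩⟩
    rw [max_le_iff] at h1
    obtain ⟨hp1, hp2, -⟩ := hP ξ h2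
    have h3 := hj' (p ξ) (h1.1.trans hp2) hp1
    rw [hG ξ h2] at h3
    have h4 := (hk ζ ξ h2).2 (hj2' (p ξ) (h1.2.trans hp2) hp1)
    have h5 : D (h (p ξ)) (g ξ) < D (h (p ξ)) (k ζ ξ) := h3.trans_le h4
    refine lt_trans ?_ (hF2 ζ hζ ξ h2)
    by_contra hc
    rcases (not_lt.1 hc).lt_or_eq with h6 | h6
    · exact absurd (h5.trans (hD2 _ _ _ h6 (hg ξ h2))) (lt_irrefl _)
    · rw [h6] at h5
      exact absurd h5 (lt_irrefl _)


def CBS.lang : FirstOrder.Language.{0,0} where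
  Functions := fun n => {_k : ℕ // n = 3}
  Relations := fun _ => Empty

theorem CBS.lang_countable : Countable CBS.lang.Symbols := by
  have h1 : Countable (Σ l, CBS.lang.Functions l) := by
    have : ∀ l, Countable (CBS.lang.Functions l) := fun l =>
      inferInstanceAs (Countable {_k : ℕ // l = 3})
    infer_instance
  have h2 : Countable (Σ l, CBS.lang.Relations l) := by
    have : ∀ l, Countable (CBS.lang.Relations l) := fun l =>
      inferInstanceAs (Countable Empty)
    infer_instance
  exact inferInstanceAs (Countable (_ ⊕ _))

theorem CBS.cc {κ μ : Cardinal.{0}} (hcc : ChangCC (Order.succ κ) κ (Order.succ μ) μ)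
    (F : ℕ → Ordinal.{0} → Ordinal.{0} → Ordinal.{0} → Ordinal.{0}) :
    ∃ B : Set Ordinal.{0}, B ⊆ Set.Iio (Order.succ κ).ord ∧ #B = Cardinal.lift.{1} (Order.succ μ) ∧
      #(B ∩ Set.Iio κ.ord : Set Ordinal.{0}) = Cardinal.lift.{1} μ ∧
      ∀ n, ∀ a ∈ B, ∀ b ∈ B, ∀ c ∈ B, F n a b c < (Order.succ κ).ord → F n a b c ∈ B := by
  classical
  let st : CBS.lang.Structure (Set.Iio (Order.succ κ).ord) :=
    { funMap := fun {n} f x =>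
        let y : Fin 3 → Set.Iio (Order.succ κ).ord := fun i => x (Fin.cast f.2.symm i)
        if h : F f.1 (y 0).1 (y 1).1 (y 2).1 < (Order.succ κ).ord then ⟨_, h⟩ else y 0
      RelMap := fun {n} r _ => r.elim }
  obtain ⟨B, h1, h2⟩ := hcc CBS.lang CBS.lang_countable st
  refine ⟨Subtype.val '' (B : Set (Set.Iio (Order.succ κ).ord)), ?_, ?_, ?_, ?_⟩
  · rintro _ ⟨x, -, rfl⟩
    exact x.2
  · rw [Cardinal.mk_image_eq Subtype.val_injective]
    exact h1
  · rw [← h2]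
    have : (Subtype.val '' (B : Set (Set.Iio (Order.succ κ).ord)) ∩ Set.Iio κ.ord : Set Ordinal.{0}) =
        Subtype.val '' {x : Set.Iio (Order.succ κ).ord | x ∈ B ∧ x.val < κ.ord} := by
      ext x
      constructor
      · rintro ⟨⟨y, hy, rfl⟩, h⟩
        exact ⟨y, ⟨hy, h⟩, rfl⟩
      · rintro ⟨y, ⟨hy, h⟩, rfl⟩
        exact ⟨⟨y, hy, rfl⟩, h⟩
    rw [this, Cardinal.mk_image_eq Subtype.val_injective]
    rfl
  · rintro n _ ⟨a, ha, rfl⟩ _ ⟨b, hb, rfl⟩ _ ⟨c, hc, rfl⟩ hlt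
    have := B.fun_mem (n := 3) (⟨n, rfl⟩ : {_k : ℕ // 3 = 3}) ![a, b, c] (by
      intro i
      fin_cases i
      · exact ha
      · exact hb
      · exact hc)
    refine ⟨_, this, ?_⟩
    show Subtype.val (dite _ _ _) = _
    rw [dif_pos (by simpa using hlt)]
    simp

theorem CBS.closR {κ : Cardinal.{0}} (hκ : κ.IsRegular) (hκ' : ℵ₀ < κ)
    (R : ℕ → Ordinal.{0} → Ordinal.{0} → Ordinal.{0} → Prop)
    (hR1 : ∀ n u v w w', R n u v w → R n u v w' → w = w')
    (hR2 : ∀ n u v w, u < κ.ord → v < κ.ord → R n u v w → w < κ.ord) (ν0 : Ordinal.{0}) (hν : ν0 < κ.ord) :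
    ∃ N : Ordinal → Ordinal, (∀ ξ < κ.ord, N ξ < κ.ord) ∧ (∀ ξ η, ξ < η → N ξ < N η) ∧
      (∀ ξ, ν0 ≤ N ξ) ∧
      (∀ l < κ.ord, Order.IsSuccLimit l → ∀ x < N l, ∃ ξ < l, x < N ξ) ∧
      (∀ l < κ.ord, Order.IsSuccLimit l → ∀ n u v w, u < N l → v < N l → R n u v w → w < N l) := by
  have hl := Cardinal.isSuccLimit_ord hκ.aleph0_le
  have h1 : ∀ n u v, ∃ b, u < κ.ord → v < κ.ord → b < κ.ord ∧ ∀ w, R n u v w → w ≤ b := by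
    intro n u v
    by_cases h : ∃ w, R n u v w
    · obtain ⟨w, hw⟩ := h
      exact ⟨w, fun hu hv => ⟨hR2 n u v w hu hv hw, fun w' hw' => (hR1 _ _ _ _ _ hw' hw).le⟩⟩
    · exact ⟨0, fun hu hv => ⟨hl.bot_lt, fun w hw => absurd ⟨w, hw⟩ h⟩⟩
  choose b1 hb1 using h1
  have h2 : ∀ u v, ∃ b, u < κ.ord → v < κ.ord → b < κ.ord ∧ ∀ n w, R n u v w → w < b := by
    intro u v
    by_cases huv : u < κ.ord ∧ v < κ.ord
    · obtain ⟨b, hb, hb'⟩ := CBS.regbdd hκ (S := Set.range (fun n => b1 n u v))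
        (by rintro _ ⟨n, rfl⟩; exact (hb1 n u v huv.1 huv.2).1)
        (by
          refine (Set.countable_range _).le_aleph0.trans_lt ?_
          simpa using hκ')
      exact ⟨b, fun hu hv => ⟨hb, fun n w hw => ((hb1 n u v hu hv).2 w hw).trans_lt (hb' _ ⟨n, rfl⟩)⟩⟩
    · exact ⟨0, fun hu hv => absurd ⟨hu, hv⟩ huv⟩
  choose b2 hb2 using h2
  have h3 : ∀ x, ∃ b, x < κ.ord → b < κ.ord ∧ ∀ u ≤ x, ∀ v ≤ x, ∀ n w, R n u v w → w < b := by
    intro x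
    by_cases hx : x < κ.ord
    · have h4 : ∀ u, ∃ b, u ≤ x → b < κ.ord ∧ ∀ v ≤ x, b2 u v < b := by
        intro u
        by_cases hu : u ≤ x
        · obtain ⟨b, hb, hb'⟩ := CBS.regbdd_img hκ (hl.succ_lt hx) (b2 u) (fun v hv =>
            (hb2 u v (hu.trans_lt hx) ((Order.lt_succ_iff.1 hv).trans_lt hx)).1)
          exact ⟨b, fun _ => ⟨hb, fun v hv => hb' v (Order.lt_succ_iff.2 hv)⟩⟩
        · exact ⟨0, fun h => absurd h hu⟩
      choose b3 hb3 using h4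
      obtain ⟨b, hb, hb'⟩ := CBS.regbdd_img hκ (hl.succ_lt hx) b3 (fun u hu =>
            (hb3 u (Order.lt_succ_iff.1 hu)).1)
      refine ⟨b, fun _ => ⟨hb, fun u hu v hv n w hw => ?_⟩⟩
      exact ((hb2 u v (hu.trans_lt hx) (hv.trans_lt hx)).2 n w hw).trans
        (((hb3 u hu).2 v hv).trans (hb' u (Order.lt_succ_iff.2 hu)))
    · exact ⟨0, fun h => absurd h hx⟩
  choose b4 hb4 using h3
  obtain ⟨N, hN1, hN2, hN3, hN4, hN5⟩ := CBS.seqN hκ b4 (fun x hx => (hb4 x hx).1) ν0 hν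
  refine ⟨N, hN1, hN2, hN3, fun l _ h => hN5 l h, ?_⟩
  intro l hlK hll n u v w hu hv hR
  obtain ⟨ξ, hξ, hu'⟩ := hN5 l hll u hu
  obtain ⟨η, hη, hv'⟩ := hN5 l hll v hv
  have hmono : ∀ ξ η, ξ ≤ η → N ξ ≤ N η := fun ξ η h => by
    rcases h.lt_or_eq with h | h
    · exact (hN2 _ _ h).le
    · rw [h]
  have hm : max ξ η < l := max_lt hξ hη
  have := (hb4 _ (hN1 (max ξ η) (hm.trans hlK))).2 u (hu'.le.trans (hmono _ _ (le_max_left _ _))) v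
    (hv'.le.trans (hmono _ _ (le_max_right _ _))) n w hR
  exact (this.trans (hN4 _)).trans (hN2 _ _ (hll.succ_lt hm))

structure CBS.Fns (κ : Cardinal.{0}) where
  e : Ordinal.{0} → Ordinal.{0} → Ordinal.{0}
  e_lt : ∀ α < (Order.succ κ).ord, ∀ γ < α, e α γ < κ.ord
  e_inj : ∀ α < (Order.succ κ).ord, ∀ γ < α, ∀ γ' < α, e α γ = e α γ' → γ = γ'
  g : Ordinal.{0} → Ordinal.{0} → Ordinal.{0}
  g_lt : ∀ α < (Order.succ κ).ord, ∀ ν < κ.ord, g α ν < κ.ord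
  g_gt : ∀ α < (Order.succ κ).ord, ∀ ν < κ.ord, ∀ γ < α, e α γ < ν → g γ ν < g α ν
  H : Ordinal.{0} → Ordinal.{0} → Ordinal.{0}
  H_lt : ∀ α < (Order.succ κ).ord, ∀ ν < κ.ord, H α ν < κ.ord
  H_gt : ∀ α < (Order.succ κ).ord, ∀ ν < κ.ord, ∀ γ' < α, ∀ γ < γ', e α γ < ν → e α γ' < ν →
    e γ' γ < H α ν
  D : Ordinal.{0} → Ordinal.{0} → Ordinal.{0}
  D_lt : ∀ a, ∀ x < a.cof.ord, D a x < a
  D_mono : ∀ a x y, x < y → y < a.cof.ord → D a x < D a y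
  c : Ordinal.{0} → Ordinal.{0} → Ordinal.{0}
  c_lt : ∀ a, ∀ z < a, c a z < a.cof.ord
  c_le : ∀ a, ∀ z < a, z ≤ D a (c a z)
  N : Ordinal.{0} → Ordinal.{0} → Ordinal.{0} → Ordinal.{0}
  N_lt : ∀ α < (Order.succ κ).ord, α.cof < κ → ∀ ν < κ.ord, ∀ ξ < κ.ord, N α ν ξ < κ.ord
  N_mono : ∀ α < (Order.succ κ).ord, α.cof < κ → ∀ ν < κ.ord, ∀ ξ η, ξ < η → N α ν ξ < N α ν η
  c' : Ordinal.{0} → Ordinal.{0} → Ordinal.{0} → Ordinal.{0}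
  c'_lt : ∀ α < (Order.succ κ).ord, α.cof < κ → Order.IsSuccLimit α → ∀ ν < κ.ord,
    ∀ x < N α ν α.cof.ord, c' α ν x < α.cof.ord ∧ x < N α ν (c' α ν x)
  N1 : ∀ α < (Order.succ κ).ord, α.cof < κ → Order.IsSuccLimit α → ∀ ν < κ.ord,
    ∀ γ < α, e α γ < N α ν α.cof.ord → ∀ ξ < γ,
      (e α ξ < N α ν α.cof.ord ↔ e γ ξ < N α ν α.cof.ord)
  N2 : ∀ α < (Order.succ κ).ord, α.cof < κ → Order.IsSuccLimit α → ∀ ν < κ.ord,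
    ∀ γ < α, e α γ < N α ν α.cof.ord → γ.cof < κ → γ.cof.ord < N α ν α.cof.ord
  N2' : ∀ α < (Order.succ κ).ord, α.cof < κ → Order.IsSuccLimit α → ∀ ν < κ.ord,
    α.cof.ord < N α ν α.cof.ord
  N3 : ∀ α < (Order.succ κ).ord, α.cof < κ → Order.IsSuccLimit α → ∀ ν < κ.ord,
    ∀ γ < α, e α γ < N α ν α.cof.ord → ∀ ξ < γ.cof.ord, ξ < N α ν α.cof.ord →
      e α (D γ ξ) < N α ν α.cof.ord
  N3' : ∀ α < (Order.succ κ).ord, α.cof < κ → Order.IsSuccLimit α → ∀ ν < κ.ord,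
    ∀ ξ < α.cof.ord, e α (D α ξ) < N α ν α.cof.ord
  N4 : ∀ α < (Order.succ κ).ord, α.cof < κ → Order.IsSuccLimit α → ∀ ν < κ.ord,
    ∀ γ < α, e α γ < N α ν α.cof.ord → ∀ η < γ, e α η < N α ν α.cof.ord →
      c γ η < N α ν α.cof.ord

theorem CBS.fns {κ : Cardinal.{0}} (hκ : κ.IsRegular) (hκ' : ℵ₀ < κ) : Nonempty (CBS.Fns κ) := by
  classical
  have hl := Cardinal.isSuccLimit_ord hκ.aleph0_le
  have hcard : ∀ α < (Order.succ κ).ord, α.card ≤ κ := fun α hα =>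
    Order.lt_succ_iff.1 (Cardinal.lt_ord.1 hα)
  have he : ∀ α : Ordinal.{0}, ∃ e : Ordinal.{0} → Ordinal.{0}, α < (Order.succ κ).ord →
      (∀ x < α, e x < κ.ord) ∧ ∀ x < α, ∀ y < α, e x = e y → x = y := by
    intro α
    by_cases hα : α < (Order.succ κ).ord
    · obtain ⟨e, he⟩ := CBS.inj_of_card (hcard α hα)
      exact ⟨e, fun _ => he⟩
    · exact ⟨fun _ => 0, fun h => absurd h hα⟩
  choose e he using he
  let A : Ordinal.{0} → Ordinal.{0} → Set Ordinal.{0} := fun α ν => {γ | γ < α ∧ e α γ < ν}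
  have hA : ∀ α < (Order.succ κ).ord, ∀ ν < κ.ord, #(A α ν) < Cardinal.lift.{1} κ := by
    intro α hα ν hν
    refine (CBS.mk_le_of_inj (a := ν) (e α) (fun x hx => hx.2)
      (fun x hx y hy h => (he α hα).2 x hx.1 y hy.1 h)).trans_lt ?_
    exact Cardinal.lift_lt.2 (Cardinal.lt_ord.1 hν)
  have hbd : ∀ α < (Order.succ κ).ord, ∀ ν < κ.ord, ∀ f : Ordinal.{0} → Ordinal.{0},
      (∀ x ∈ A α ν, f x < κ.ord) → ∃ b < κ.ord, ∀ x ∈ A α ν, f x < b := by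
    intro α hα ν hν f hf
    obtain ⟨b, hb, hb'⟩ := CBS.regbdd hκ (S := f '' A α ν) (by rintro _ ⟨x, hx, rfl⟩; exact hf x hx)
      (Cardinal.mk_image_le.trans_lt (hA α hα ν hν))
    exact ⟨b, hb, fun x hx => hb' _ ⟨x, hx, rfl⟩⟩
  obtain ⟨g, hg⟩ := CBS.wfrec (X := Ordinal.{0} → Ordinal.{0})
    (fun α r ν => sSup ((fun γ => Order.succ (r γ ν)) '' A α ν))
    (by
      intro α r r' hr
      funext ν
      congr 1
      apply Set.image_congr
      intro a ha
      simp only [hr a ha.1])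
  have g_lt : ∀ α < (Order.succ κ).ord, ∀ ν < κ.ord, g α ν < κ.ord := by
    intro α
    induction α using WellFoundedLT.induction with
    | ind α ih =>
      intro hα ν hν
      rw [hg]
      obtain ⟨b, hb, hb'⟩ := hbd α hα ν hν (fun γ => Order.succ (g γ ν))
        (fun x hx => hl.succ_lt (ih x hx.1 (hx.1.trans hα) ν hν))
      refine lt_of_le_of_lt (csSup_le' ?_) hb
      rintro _ ⟨x, hx, rfl⟩
      exact (hb' x hx).le
  have g_gt : ∀ α < (Order.succ κ).ord, ∀ ν < κ.ord, ∀ γ < α, e α γ < ν → g γ ν < g α ν := by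
    intro α hα ν hν γ hγ h
    rw [hg α]
    refine (Order.lt_succ _).trans_le (le_csSup ?_
      (Set.mem_image_of_mem (fun γ => Order.succ (g γ ν)) (show γ ∈ A α ν from ⟨hγ, h⟩)))
    exact (Ordinal.bddAbove_of_small (s := (fun γ => Order.succ (g γ ν)) '' Set.Iio α)).mono
      (Set.image_mono (fun x hx => hx.1))
  have hH : ∀ α ν, ∃ b, α < (Order.succ κ).ord → ν < κ.ord → b < κ.ord ∧
      ∀ γ' < α, ∀ γ < γ', e α γ < ν → e α γ' < ν → e γ' γ < b := by
    intro α ν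
    by_cases h : α < (Order.succ κ).ord ∧ ν < κ.ord
    · obtain ⟨hα, hν⟩ := h
      have h1 : ∀ γ', ∃ b, γ' < α → b < κ.ord ∧ ∀ γ ∈ A α ν, γ < γ' → e γ' γ < b := by
        intro γ'
        by_cases hγ' : γ' < α
        · obtain ⟨b, hb, hb'⟩ := hbd α hα ν hν (fun γ => if γ < γ' then e γ' γ else 0) (by
            intro x hx
            split_ifs with h
            · exact (he γ' (hγ'.trans hα)).1 x h
            · exact hl.bot_lt)
          refine ⟨b, fun _ => ⟨hb, fun γ h1 h2 => ?_⟩⟩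
          have := hb' γ h1
          simpa only [h2, if_true] using this
        · exact ⟨0, fun h => absurd h hγ'⟩
      choose b1 hb1 using h1
      obtain ⟨b, hb, hb'⟩ := hbd α hα ν hν b1 (fun x hx => (hb1 x hx.1).1)
      exact ⟨b, fun _ _ => ⟨hb, fun γ' hγ' γ hγ h1 h2 =>
        ((hb1 γ' hγ').2 γ ⟨hγ.trans hγ', h1⟩ hγ).trans (hb' γ' ⟨hγ', h2⟩)⟩⟩
    · exact ⟨0, fun h1 h2 => absurd ⟨h1, h2⟩ h⟩
  choose H hH using hH
  choose D hD1 hD2 hD3 using CBS.fund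
  have hc : ∀ a z, ∃ x, z < a → x < a.cof.ord ∧ z ≤ D a x := by
    intro a z
    by_cases h : z < a
    · obtain ⟨x, hx⟩ := hD3 a z h
      exact ⟨x, fun _ => hx⟩
    · exact ⟨0, fun h' => absurd h' h⟩
  choose c hc using hc
  have hN : ∀ α ν0, ∃ N : Ordinal.{0} → Ordinal.{0}, α < (Order.succ κ).ord → α.cof < κ → ν0 < κ.ord →
      (∀ ξ < κ.ord, N ξ < κ.ord) ∧ (∀ ξ η, ξ < η → N ξ < N η) ∧
      (Order.IsSuccLimit α → (∀ x < N α.cof.ord, ∃ ξ < α.cof.ord, x < N ξ) ∧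
      (∀ γ < α, e α γ < N α.cof.ord → ∀ ξ < γ, (e α ξ < N α.cof.ord ↔ e γ ξ < N α.cof.ord)) ∧
      (∀ γ < α, e α γ < N α.cof.ord → γ.cof < κ → γ.cof.ord < N α.cof.ord) ∧
      (α.cof.ord < N α.cof.ord) ∧
      (∀ γ < α, e α γ < N α.cof.ord → ∀ ξ < γ.cof.ord, ξ < N α.cof.ord → e α (D γ ξ) < N α.cof.ord) ∧
      (∀ ξ < α.cof.ord, e α (D α ξ) < N α.cof.ord) ∧
      (∀ γ < α, e α γ < N α.cof.ord → ∀ η < γ, e α η < N α.cof.ord → c γ η < N α.cof.ord)) := by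
    intro α ν0
    by_cases h : α < (Order.succ κ).ord ∧ α.cof < κ ∧ ν0 < κ.ord
    swap
    · exact ⟨fun _ => 0, fun h1 h2 h3 => absurd ⟨h1, h2, h3⟩ h⟩
    obtain ⟨hα, hαc, hν⟩ := h
    have hαc' : α.cof.ord < κ.ord := Cardinal.ord_lt_ord.2 hαc
    let R : ℕ → Ordinal.{0} → Ordinal.{0} → Ordinal.{0} → Prop := fun n u v w =>
      match n with
      | 0 => ∃ γ < α, ∃ ξ < γ, e α γ = u ∧ e α ξ = v ∧ w = e γ ξ
      | 1 => ∃ γ < α, ∃ ξ < γ, e α γ = u ∧ e γ ξ = v ∧ w = e α ξ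
      | 2 => ∃ γ < α, e α γ = u ∧ γ.cof < κ ∧ w = γ.cof.ord
      | 3 => ∃ γ < α, e α γ = u ∧ v < γ.cof.ord ∧ w = e α (D γ v)
      | 4 => v < α.cof.ord ∧ w = e α (D α v)
      | 5 => ∃ γ < α, ∃ η < γ, e α γ = u ∧ e α η = v ∧ w = c γ η
      | _ => False
    obtain ⟨N, hN1, hN2, hN3, hN4, hN5⟩ := CBS.closR hκ hκ' R (by
      intro n u v w w' h h'
      have hinj := (he α hα).2
      match n with
      | 0 =>
        obtain ⟨γ, hγ, ξ, hξ, h1, h2, rfl⟩ := h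
        obtain ⟨γ', hγ', ξ', hξ', h1', h2', rfl⟩ := h'
        rw [hinj γ hγ γ' hγ' (h1.trans h1'.symm),
          hinj ξ (hξ.trans hγ) ξ' (hξ'.trans hγ') (h2.trans h2'.symm)]
      | 1 =>
        obtain ⟨γ, hγ, ξ, hξ, h1, h2, rfl⟩ := h
        obtain ⟨γ', hγ', ξ', hξ', h1', h2', rfl⟩ := h'
        obtain rfl := hinj γ hγ γ' hγ' (h1.trans h1'.symm)
        rw [(he γ (hγ.trans hα)).2 ξ hξ ξ' hξ' (h2.trans h2'.symm)]
      | 2 =>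
        obtain ⟨γ, hγ, h1, h2, rfl⟩ := h
        obtain ⟨γ', hγ', h1', h2', rfl⟩ := h'
        obtain rfl := hinj γ hγ γ' hγ' (h1.trans h1'.symm)
        rfl
      | 3 =>
        obtain ⟨γ, hγ, h1, h2, rfl⟩ := h
        obtain ⟨γ', hγ', h1', h2', rfl⟩ := h'
        obtain rfl := hinj γ hγ γ' hγ' (h1.trans h1'.symm)
        rfl
      | 4 =>
        obtain ⟨-, rfl⟩ := h
        obtain ⟨-, rfl⟩ := h'
        rfl
      | 5 =>
        obtain ⟨γ, hγ, ξ, hξ, h1, h2, rfl⟩ := h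
        obtain ⟨γ', hγ', ξ', hξ', h1', h2', rfl⟩ := h'
        rw [hinj γ hγ γ' hγ' (h1.trans h1'.symm),
          hinj ξ (hξ.trans hγ) ξ' (hξ'.trans hγ') (h2.trans h2'.symm)]
      | n + 6 => exact h.elim) (by
      intro n u v w hu hv h
      have hlt := (he α hα).1
      match n with
      | 0 =>
        obtain ⟨γ, hγ, ξ, hξ, h1, h2, rfl⟩ := h
        exact (he γ (hγ.trans hα)).1 _ hξ
      | 1 =>
        obtain ⟨γ, hγ, ξ, hξ, h1, h2, rfl⟩ := h
        exact hlt _ (hξ.trans hγ)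
      | 2 =>
        obtain ⟨γ, hγ, h1, h2, rfl⟩ := h
        exact Cardinal.ord_lt_ord.2 h2
      | 3 =>
        obtain ⟨γ, hγ, h1, h2, rfl⟩ := h
        exact hlt _ ((hD1 _ _ h2).trans hγ)
      | 4 =>
        obtain ⟨h2, rfl⟩ := h
        exact hlt _ (hD1 _ _ h2)
      | 5 =>
        obtain ⟨γ, hγ, ξ, hξ, h1, h2, rfl⟩ := h
        refine (hc _ _ hξ).1.trans_le (Cardinal.ord_le_ord.2 ?_)
        exact (Ordinal.cof_le_card _).trans (hcard γ (hγ.trans hα))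
      | n + 6 => exact h.elim) (max ν0 (Order.succ α.cof.ord)) (max_lt hν (hl.succ_lt hαc'))
    refine ⟨N, fun _ _ _ => ⟨hN1, hN2, fun hαl => ?_⟩⟩
    have hll : Order.IsSuccLimit α.cof.ord :=
      Cardinal.isSuccLimit_ord (Ordinal.aleph0_le_cof.2 hαl)
    have hcl := hN5 _ hαc' hll
    have h0 : α.cof.ord < N α.cof.ord :=
      (Order.lt_succ _).trans_le ((le_max_right _ _).trans (hN3 _))
    refine ⟨hN4 _ hαc' hll, ?_, ?_, h0, ?_, ?_, ?_⟩
    · intro γ hγ h1 ξ hξ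
      constructor
      · intro h2
        exact hcl 0 _ _ _ h1 h2 ⟨γ, hγ, ξ, hξ, rfl, rfl, rfl⟩
      · intro h2
        exact hcl 1 _ _ _ h1 h2 ⟨γ, hγ, ξ, hξ, rfl, rfl, rfl⟩
    · intro γ hγ h1 h2
      exact hcl 2 _ _ _ h1 h1 ⟨γ, hγ, rfl, h2, rfl⟩
    · intro γ hγ h1 ξ hξ hξ'
      exact hcl 3 _ _ _ h1 hξ' ⟨γ, hγ, rfl, hξ, rfl⟩
    · intro ξ hξ
      exact hcl 4 _ _ _ (hξ.trans h0) (hξ.trans h0) ⟨hξ, rfl⟩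
    · intro γ hγ h1 η hη h2
      exact hcl 5 _ _ _ h1 h2 ⟨γ, hγ, η, hη, rfl, rfl, rfl⟩
  choose N hN using hN
  have hc' : ∀ α ν x, ∃ y, α < (Order.succ κ).ord → α.cof < κ → Order.IsSuccLimit α → ν < κ.ord →
      x < N α ν α.cof.ord → y < α.cof.ord ∧ x < N α ν y := by
    intro α ν x
    by_cases h : α < (Order.succ κ).ord ∧ α.cof < κ ∧ Order.IsSuccLimit α ∧ ν < κ.ord ∧ x < N α ν α.cof.ord
    · obtain ⟨h1, h2, h3, h4, h5⟩ := h
      obtain ⟨y, hy⟩ := ((hN α ν h1 h2 h4).2.2 h3).1 x h5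
      exact ⟨y, fun _ _ _ _ _ => hy⟩
    · exact ⟨0, fun h1 h2 h3 h4 h5 => absurd ⟨h1, h2, h3, h4, h5⟩ h⟩
  choose c' hc' using hc'
  exact ⟨{
    e := e
    e_lt := fun α hα => (he α hα).1
    e_inj := fun α hα => (he α hα).2
    g := g
    g_lt := g_lt
    g_gt := g_gt
    H := H
    H_lt := fun α hα ν hν => (hH α ν hα hν).1
    H_gt := fun α hα ν hν => (hH α ν hα hν).2
    D := D
    D_lt := hD1
    D_mono := hD2
    c := c
    c_lt := fun a z h => (hc a z h).1
    c_le := fun a z h => (hc a z h).2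
    N := N
    N_lt := fun α hα h1 ν hν => (hN α ν hα h1 hν).1
    N_mono := fun α hα h1 ν hν => (hN α ν hα h1 hν).2.1
    c' := c'
    c'_lt := fun α hα h1 h2 ν hν x hx => hc' α ν x hα h1 h2 hν hx
    N1 := fun α hα h1 h2 ν hν => ((hN α ν hα h1 hν).2.2 h2).2.1
    N2 := fun α hα h1 h2 ν hν => ((hN α ν hα h1 hν).2.2 h2).2.2.1
    N2' := fun α hα h1 h2 ν hν => ((hN α ν hα h1 hν).2.2 h2).2.2.2.1
    N3 := fun α hα h1 h2 ν hν => ((hN α ν hα h1 hν).2.2 h2).2.2.2.2.1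
    N3' := fun α hα h1 h2 ν hν => ((hN α ν hα h1 hν).2.2 h2).2.2.2.2.2.1
    N4 := fun α hα h1 h2 ν hν => ((hN α ν hα h1 hν).2.2 h2).2.2.2.2.2.2 }⟩


structure CBS.Ctx (κ μ : Cardinal.{0}) where
  hκ : κ.IsRegular
  hμ : ℵ₀ ≤ μ
  hs : μ.ord.cof < μ
  hμκ : μ < κ
  F : CBS.Fns κ
  B : Set Ordinal.{0}
  hB : ∀ a ∈ B, a < (Order.succ κ).ord
  cardB : #B = Cardinal.lift.{1} (Order.succ μ)
  cardBK : #(B ∩ Set.Iio κ.ord : Set Ordinal.{0}) = Cardinal.lift.{1} μ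
  Be : ∀ a ∈ B, ∀ b ∈ B, b < a → F.e a b ∈ B
  Bg : ∀ a ∈ B, ∀ b ∈ B, b < κ.ord → F.g a b ∈ B
  BH : ∀ a ∈ B, ∀ b ∈ B, b < κ.ord → F.H a b ∈ B
  BD : ∀ a ∈ B, ∀ b ∈ B, b < a.cof.ord → F.D a b ∈ B
  Bc : ∀ a ∈ B, ∀ b ∈ B, b < a → F.c a b ∈ B
  Blam : ∀ a ∈ B, a.cof.ord ∈ B
  BN : ∀ a ∈ B, ∀ b ∈ B, ∀ c ∈ B, a.cof < κ → b < κ.ord → c < κ.ord → F.N a b c ∈ B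
  Bc' : ∀ a ∈ B, ∀ b ∈ B, ∀ c ∈ B, F.c' a b c < a.cof.ord → F.c' a b c ∈ B
  Bs : ∀ a ∈ B, ∀ b ∈ B, ∀ c ∈ B, sSup {γ | γ < a ∧ F.e a γ < b ∧ γ < c} ∈ B
  Bm : ∀ a ∈ B, ∀ b ∈ B, ∀ c ∈ B, sInf {γ | γ < a ∧ F.e a γ < b ∧ c ≤ γ} < a →
    sInf {γ | γ < a ∧ F.e a γ < b ∧ c ≤ γ} ∈ B
  Bpred : ∀ a, Order.succ a ∈ B → a ∈ B

theorem CBS.ctx {κ μ : Cardinal.{0}}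
    (hκ : κ.IsRegular) (hμ : ℵ₀ ≤ μ) (hs : μ.ord.cof < μ) (hμκ : μ < κ)
    (hcc : ChangCC (Order.succ κ) κ (Order.succ μ) μ) : Nonempty (CBS.Ctx κ μ) := by
  obtain ⟨F⟩ := CBS.fns hκ (hμ.trans_lt hμκ)
  have hKK : κ.ord < (Order.succ κ).ord := Cardinal.ord_lt_ord.2 (Order.lt_succ κ)
  obtain ⟨B, hB, h1, h2, h3⟩ := CBS.cc hcc (fun n a b c =>
    match n with
    | 0 => F.e a b
    | 1 => F.g a b
    | 2 => F.H a b
    | 3 => F.D a b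
    | 4 => F.c a b
    | 5 => a.cof.ord
    | 6 => F.N a b c
    | 7 => F.c' a b c
    | 8 => sSup {γ | γ < a ∧ F.e a γ < b ∧ γ < c}
    | 9 => sInf {γ | γ < a ∧ F.e a γ < b ∧ c ≤ γ}
    | _ => sSup {x | x < a})
  have hcofle : ∀ a : Ordinal.{0}, a.cof.ord ≤ a := fun a => Ordinal.ord_cof_le a
  exact ⟨{
    hκ := hκ, hμ := hμ, hs := hs, hμκ := hμκ, F := F, B := B
    hB := fun a ha => hB ha
    cardB := h1
    cardBK := h2
    Be := fun a ha b hb h => h3 0 a ha b hb b hb ((F.e_lt a (hB ha) b h).trans hKK)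
    Bg := fun a ha b hb h => h3 1 a ha b hb b hb ((F.g_lt a (hB ha) b h).trans hKK)
    BH := fun a ha b hb h => h3 2 a ha b hb b hb ((F.H_lt a (hB ha) b h).trans hKK)
    BD := fun a ha b hb h => h3 3 a ha b hb b hb ((F.D_lt a b h).trans (hB ha))
    Bc := fun a ha b hb h => h3 4 a ha b hb b hb
      ((F.c_lt a b h).trans_le ((hcofle a).trans (le_of_lt (hB ha))))
    Blam := fun a ha => h3 5 a ha a ha a ha ((hcofle a).trans_lt (hB ha))
    BN := fun a ha b hb c hc h4 h5 h6 => h3 6 a ha b hb c hc ((F.N_lt a (hB ha) h4 b h5 c h6).trans hKK)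
    Bc' := fun a ha b hb c hc h4 => h3 7 a ha b hb c hc
      (h4.trans_le ((hcofle a).trans (le_of_lt (hB ha))))
    Bs := fun a ha b hb c hc => h3 8 a ha b hb c hc
      ((csSup_le' (fun x hx => hx.1.le)).trans_lt (hB ha))
    Bm := fun a ha b hb c hc h => h3 9 a ha b hb c hc (h.trans (hB ha))
    Bpred := fun a ha => by
      have h : sSup {x | x < Order.succ a} = a := by
        apply le_antisymm
        · exact csSup_le' (fun x hx => Order.lt_succ_iff.1 hx)
        · exact le_csSup ⟨a, fun x hx => Order.lt_succ_iff.1 hx⟩ (Order.lt_succ a)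
      have := h3 10 _ ha _ ha _ ha
      simp only [h] at this
      exact this ((Order.lt_succ a).trans (hB ha)) }⟩

theorem CBS.Ctx.seg {κ μ : Cardinal.{0}} (X : CBS.Ctx κ μ) {β : Ordinal.{0}} (hβ : β ∈ X.B) :
    #(X.B ∩ Set.Iio β : Set Ordinal.{0}) ≤ Cardinal.lift.{1} μ := by
  rw [← X.cardBK]
  refine Cardinal.mk_le_of_injective (f := fun x : (X.B ∩ Set.Iio β : Set Ordinal.{0}) =>
    (⟨X.F.e β x.1, X.Be β hβ x.1 x.2.1 x.2.2, X.F.e_lt β (X.hB β hβ) x.1 x.2.2⟩ :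
      (X.B ∩ Set.Iio κ.ord : Set Ordinal.{0}))) ?_
  intro x y h
  exact Subtype.ext (X.F.e_inj β (X.hB β hβ) _ x.2.2 _ y.2.2 (congrArg Subtype.val h))

theorem CBS.Ctx.exists_pi {κ μ : Cardinal.{0}} (X : CBS.Ctx κ μ) :
    ∃ p : Ordinal.{0} → Ordinal.{0}, StrictMono p ∧ (∀ a < (Order.succ μ).ord, p a ∈ X.B) ∧
      ∀ β ∈ X.B, ∃ a < (Order.succ μ).ord, p a = β := by
  let S : Set Ordinal.{0} := X.B ∪ Set.Ici (Order.succ κ).ord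
  have hS : ¬ BddAbove S := by
    rintro ⟨b, hb⟩
    have : max (Order.succ b) (Order.succ κ).ord ≤ b := hb (Or.inr (Set.mem_Ici.2 (le_max_right _ _)))
    exact absurd ((Order.lt_succ b).trans_le ((le_max_left _ _).trans this)) (lt_irrefl _)
  have hmono : StrictMono (Ordinal.enumOrd S) := Ordinal.enumOrd_strictMono hS
  have hmem : ∀ a, Ordinal.enumOrd S a ∈ S := fun a => Ordinal.enumOrd_mem hS a
  have hsurj : ∀ b ∈ S, ∃ a, Ordinal.enumOrd S a = b := fun b hb => Ordinal.enumOrd_surjective hS hb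
  have h1 : ∀ a < (Order.succ μ).ord, Ordinal.enumOrd S a ∈ X.B := by
    intro a ha
    rcases hmem a with h | h
    · exact h
    · exfalso
      have : X.B ⊆ Ordinal.enumOrd S '' Set.Iio a := by
        intro b hb
        obtain ⟨x, rfl⟩ := hsurj b (Or.inl hb)
        exact ⟨x, hmono.lt_iff_lt.1 ((X.hB _ hb).trans_le h), rfl⟩
      have h2 := (Cardinal.mk_le_mk_of_subset this).trans Cardinal.mk_image_le
      rw [X.cardB, CBS.mkIio, Cardinal.lift_le] at h2
      exact absurd (Cardinal.lt_ord.1 ha) (not_lt.2 h2)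
  refine ⟨Ordinal.enumOrd S, hmono, h1, ?_⟩
  intro β hβ
  obtain ⟨a, rfl⟩ := hsurj β (Or.inl hβ)
  refine ⟨a, ?_, rfl⟩
  by_contra hc
  have hsub : Ordinal.enumOrd S '' Set.Iio (Order.succ μ).ord ⊆ X.B ∩ Set.Iio (Ordinal.enumOrd S a) := by
    rintro _ ⟨x, hx, rfl⟩
    exact ⟨h1 x hx, hmono (lt_of_lt_of_le hx (not_lt.1 hc))⟩
  have h2 := (Cardinal.mk_le_mk_of_subset hsub).trans (X.seg hβ)
  rw [Cardinal.mk_image_eq hmono.injective, CBS.mkIio, Cardinal.card_ord, Cardinal.lift_le] at h2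
  exact absurd (Order.lt_succ μ) (not_lt.2 h2)

/-- The context with enumeration, coding and cardinals. -/
structure CBS.Ctx2 (κ μ : Cardinal.{0}) (θ : Ordinal.{0} → Cardinal.{0}) extends CBS.Ctx κ μ where
  p : Ordinal.{0} → Ordinal.{0}
  p_mono : StrictMono p
  p_mem : ∀ a < (Order.succ μ).ord, p a ∈ B
  p_surj : ∀ β ∈ B, ∃ a < (Order.succ μ).ord, p a = β
  b : Ordinal.{0} → Ordinal.{0}
  b_lt : ∀ x ∈ B, x < κ.ord → b x < μ.ord
  b_inj : ∀ x ∈ B, x < κ.ord → ∀ y ∈ B, y < κ.ord → b x = b y → x = y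
  hθ : ∀ i < μ.ord.cof.ord, ℵ₀ ≤ θ i ∧ θ i < μ
  hθ2 : ∀ i j, i ≤ j → j < μ.ord.cof.ord → θ i ≤ θ j
  hθ3 : ∀ c < μ, ∃ i < μ.ord.cof.ord, c ≤ θ i

theorem CBS.Ctx.ctx2 {κ μ : Cardinal.{0}} (X : CBS.Ctx κ μ) {θ : Ordinal.{0} → Cardinal.{0}}
    (hθ : ∀ i < μ.ord.cof.ord, ℵ₀ ≤ θ i ∧ θ i < μ)
    (hθ2 : ∀ i j, i ≤ j → j < μ.ord.cof.ord → θ i ≤ θ j)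
    (hθ3 : ∀ c < μ, ∃ i < μ.ord.cof.ord, c ≤ θ i) : Nonempty (CBS.Ctx2 κ μ θ) := by
  obtain ⟨p, h1, h2, h3⟩ := X.exists_pi
  obtain ⟨b, hb1, hb2⟩ := CBS.inj_of_mk X.cardBK.le
  exact ⟨{ X with
    p := p, p_mono := h1, p_mem := h2, p_surj := h3, b := b
    b_lt := fun x h h' => hb1 x ⟨h, h'⟩
    b_inj := fun x h h' y g g' => hb2 x ⟨h, h'⟩ y ⟨g, g'⟩
    hθ := hθ, hθ2 := hθ2, hθ3 := hθ3 }⟩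

section
variable {κ μ : Cardinal.{0}} {θ : Ordinal.{0} → Cardinal.{0}}

theorem CBS.Ctx2.idx (X : CBS.Ctx2 κ μ θ) {x : Ordinal.{0}} (hx : x < μ.ord) :
    ∃ i < μ.ord.cof.ord, x < (θ i).ord := by
  obtain ⟨i, hi, h⟩ := X.hθ3 _ (CBS.succ_lt X.hμ X.hs (Cardinal.lt_ord.1 hx))
  exact ⟨i, hi, Cardinal.lt_ord.2 (Order.succ_le_iff.1 h)⟩

theorem CBS.Ctx2.step3 (X : CBS.Ctx2 κ μ θ) :
    ∃ E : Set Ordinal.{0}, E ⊆ X.B ∩ Set.Iio κ.ord ∧ #E ≤ Cardinal.lift.{1} μ.ord.cof ∧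
      ∀ x ∈ X.B, x < κ.ord → ∃ ε ∈ E, x ≤ ε := by
  classical
  let T : Set Ordinal.{0} := X.B ∩ Set.Iio κ.ord
  let δ : Ordinal.{0} := sSup (Order.succ '' T)
  have hbd : BddAbove (Order.succ '' T) := by
    refine ⟨κ.ord, ?_⟩
    rintro _ ⟨x, hx, rfl⟩
    exact Order.succ_le_of_lt hx.2
  have hδ1 : ∀ x ∈ T, x < δ := fun x hx =>
    (Order.lt_succ x).trans_le (le_csSup hbd ⟨x, hx, rfl⟩)
  have hδ2 : ∀ z < δ, ∃ x ∈ T, z ≤ x := by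
    intro z hz
    obtain ⟨_, ⟨x, hx, rfl⟩, h⟩ := exists_lt_of_lt_csSup' hz
    exact ⟨x, hx, Order.lt_succ_iff.1 h⟩
  have hτμ : δ.cof ≤ μ := by
    by_contra hc
    push Not at hc
    have hlim : Order.IsSuccLimit δ := Ordinal.aleph0_le_cof.1 (X.hμ.trans hc.le)
    obtain ⟨z, hz, hz'⟩ := CBS.bdd (a := δ) (S := T) hδ1 (by
      show #(X.B ∩ Set.Iio κ.ord : Set Ordinal.{0}) < _
      rw [X.cardBK]; exact Cardinal.lift_lt.2 hc)
    obtain ⟨x, hx, hx'⟩ := hδ2 _ (hlim.succ_lt hz)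
    exact absurd ((Order.lt_succ z).trans_le (hx'.trans (hz' x hx))) (lt_irrefl _)
  have hτ : δ.cof < μ := by
    refine lt_of_le_of_ne hτμ ?_
    intro h
    have h1 := X.hs
    rw [← h, Ordinal.cof_ord_cof] at h1
    exact lt_irrefl _ h1
  obtain ⟨D, hD1, hD2, hD3⟩ := CBS.fund δ
  have hq : ∀ x, ∃ y, x < δ.cof.ord → y ∈ T ∧ D x ≤ y := by
    intro x
    by_cases hx : x < δ.cof.ord
    · obtain ⟨y, hy⟩ := hδ2 _ (hD1 x hx)
      exact ⟨y, fun _ => hy⟩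
    · exact ⟨0, fun h => absurd h hx⟩
  choose q hq using hq
  let E : Set Ordinal.{0} := q '' Set.Iio δ.cof.ord
  have hET : E ⊆ T := by
    rintro _ ⟨x, hx, rfl⟩
    exact (hq x hx).1
  have hEc : #E ≤ Cardinal.lift.{1} δ.cof := by
    refine Cardinal.mk_image_le.trans ?_
    rw [CBS.mkIio, Cardinal.card_ord]
  have hEcof : ∀ z < δ, ∃ ε ∈ E, z ≤ ε := by
    intro z hz
    obtain ⟨x, hx, hx'⟩ := hD3 z hz
    exact ⟨q x, ⟨x, hx, rfl⟩, hx'.trans (hq x hx).2⟩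
  rcases le_or_gt δ.cof μ.ord.cof with hle | hgt
  · exact ⟨E, hET, hEc.trans (Cardinal.lift_le.2 hle), fun x hx hx' => hEcof x (hδ1 x ⟨hx, hx'⟩)⟩
  exfalso
  have hcl : ℵ₀ ≤ μ.ord.cof := Ordinal.aleph0_le_cof.2 (Cardinal.isSuccLimit_ord X.hμ)
  have hlim : Order.IsSuccLimit δ := Ordinal.aleph0_le_cof.1 (hcl.trans hgt.le)
  have hregM : (Order.succ μ).IsRegular := Cardinal.isRegular_succ X.hμ
  have hI : ∀ a, ∃ i, a < (Order.succ μ).ord → i < μ.ord.cof.ord ∧ ∀ z < δ, ∃ ε ∈ E,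
      X.b (X.F.g (X.p a) ε) < (θ i).ord ∧ z ≤ ε := by
    intro a
    by_cases ha : a < (Order.succ μ).ord
    · have h1 : ∀ ε, ∃ i, ε ∈ E → i < μ.ord.cof.ord ∧ X.b (X.F.g (X.p a) ε) < (θ i).ord := by
        intro ε
        by_cases hε : ε ∈ E
        · have h2 := hET hε
          have h3 := X.p_mem a ha
          obtain ⟨i, hi⟩ := X.idx (X.b_lt _ (X.Bg _ h3 _ h2.1 h2.2) (X.F.g_lt _ (X.hB _ h3) _ h2.2))
          exact ⟨i, fun _ => hi⟩
        · exact ⟨0, fun h => absurd h hε⟩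
      choose r hr using h1
      obtain ⟨i, hi, hi'⟩ := CBS.splitOrd hEcof r (fun t ht => (hr t ht).1) hgt
      refine ⟨i, fun _ => ⟨hi, fun z hz => ?_⟩⟩
      obtain ⟨ε, h4, rfl, h5⟩ := hi' z hz
      exact ⟨ε, h4, (hr ε h4).2, h5⟩
    · exact ⟨0, fun h => absurd h ha⟩
  choose I hI using hI
  obtain ⟨i, hi, hiT⟩ := CBS.splitOrd (α := (Order.succ μ).ord) (T := Set.Iio (Order.succ μ).ord)
    (c := μ.ord.cof) (fun γ hγ => ⟨γ, hγ, le_rfl⟩) I (fun t ht => (hI t ht).1)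
    (by rw [hregM.cof_ord]; exact X.hs.trans (Order.lt_succ μ))
  let Y : Set Ordinal.{0} := {a | a < (Order.succ μ).ord ∧ I a = i}
  let ρ : Cardinal.{0} := max δ.cof (θ i)
  have hρ : ρ < μ := max_lt hτ (X.hθ i hi).2
  have hρ0 : ℵ₀ ≤ ρ := (X.hθ i hi).1.trans (le_max_right _ _)
  let P : Set Ordinal.{0} := {x | x ∈ T ∧ X.b x < (θ i).ord}
  have hP : #P ≤ Cardinal.lift.{1} ρ := by
    refine (CBS.mk_le_of_inj (a := (θ i).ord) X.b (fun x hx => hx.2)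
      (fun x hx y hy h => X.b_inj x hx.1.1 hx.1.2 y hy.1.1 hy.1.2 h)).trans ?_
    rw [Cardinal.card_ord]
    exact Cardinal.lift_le.2 (le_max_right _ _)
  have hsegY : ∀ a < (Order.succ μ).ord, #(Y ∩ Set.Iio a : Set Ordinal.{0}) ≤ Cardinal.lift.{1} ρ := by
    intro a ha
    have hpa := X.p_mem a ha
    have h1 : ∀ y : (Y ∩ Set.Iio a : Set Ordinal.{0}), ∃ ε ε' : E,
        X.F.e (X.p a) (X.p y) < ε.1 ∧ X.F.H (X.p a) ε.1 ≤ ε'.1 ∧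
        X.b (X.F.g (X.p y) ε'.1) < (θ i).ord := by
      rintro ⟨y, ⟨hy, hyi⟩, hya⟩
      have hpy := X.p_mem y hy
      have hlt := X.p_mono hya
      have h2 : X.F.e (X.p a) (X.p y) < δ := hδ1 _ ⟨X.Be _ hpa _ hpy hlt, X.F.e_lt _ (X.hB _ hpa) _ hlt⟩
      obtain ⟨ε, hε, h3⟩ := hEcof _ (hlim.succ_lt h2)
      have h4 := hET hε
      have h5 : X.F.H (X.p a) ε < δ := hδ1 _ ⟨X.BH _ hpa _ h4.1 h4.2, X.F.H_lt _ (X.hB _ hpa) _ h4.2⟩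
      obtain ⟨ε', hε', h6, h7⟩ := (hI y hy).2 _ h5
      rw [hyi] at h6
      exact ⟨⟨ε, hε⟩, ⟨ε', hε'⟩, Order.succ_le_iff.1 h3, h7, h6⟩
    choose ε ε' h1 h2 h3 using h1
    have h4 : ∀ y : (Y ∩ Set.Iio a : Set Ordinal.{0}), X.F.g (X.p y) (ε' y).1 ∈ P := by
      intro y
      have hpy := X.p_mem y.1 y.2.1.1
      have h5 := hET (ε' y).2
      exact ⟨⟨X.Bg _ hpy _ h5.1 h5.2, X.F.g_lt _ (X.hB _ hpy) _ h5.2⟩, h3 y⟩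
    have hkey : ∀ y z : (Y ∩ Set.Iio a : Set Ordinal.{0}), y.1 < z.1 → ε y = ε z → ε' y = ε' z →
        X.F.g (X.p y) (ε' y).1 ≠ X.F.g (X.p z) (ε' z).1 := by
      intro y z hyz h5 h6
      have hpz := X.p_mem z.1 z.2.1.1
      have h7 := X.F.H_gt (X.p a) (X.hB _ hpa) (ε z).1 (hET (ε z).2).2 (X.p z) (X.p_mono z.2.2) (X.p y)
        (X.p_mono hyz) (h5 ▸ h1 y) (h1 z)
      have h8 := X.F.g_gt (X.p z) (X.hB _ hpz) (ε' z).1 (hET (ε' z).2).2 (X.p y) (X.p_mono hyz)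
        (h7.trans_le (h2 z))
      rw [h6]
      exact h8.ne
    have h5 : #(Y ∩ Set.Iio a : Set Ordinal.{0}) ≤ #(E × E × P) := by
      refine Cardinal.mk_le_of_injective (f := fun y => (ε y, ε' y, ⟨_, h4 y⟩)) ?_
      intro y z h
      simp only [Prod.mk.injEq, Subtype.mk.injEq] at h
      obtain ⟨h6, h7, h8⟩ := h
      rcases lt_trichotomy y.1 z.1 with hlt | hlt | hlt
      · exact absurd h8 (hkey y z hlt h6 h7)
      · exact Subtype.ext hlt
      · exact absurd h8.symm (hkey z y hlt h6.symm h7.symm)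
    refine h5.trans ?_
    rw [Cardinal.mk_prod, Cardinal.mk_prod]
    simp only [Cardinal.lift_id]
    have hEρ : #E ≤ Cardinal.lift.{1} ρ := hEc.trans (Cardinal.lift_le.2 (le_max_left _ _))
    have hmul : Cardinal.lift.{1} ρ * Cardinal.lift.{1} ρ = Cardinal.lift.{1} ρ :=
      Cardinal.mul_eq_self (Cardinal.aleph0_le_lift.2 hρ0)
    calc #E * (#E * #P) ≤ Cardinal.lift.{1} ρ * (Cardinal.lift.{1} ρ * Cardinal.lift.{1} ρ) := by gcongr
      _ = _ := by rw [hmul, hmul]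
  have hlimM := Cardinal.isSuccLimit_ord hregM.aleph0_le
  have hsM : Order.succ ρ < Order.succ μ := Order.succ_lt_succ hρ
  have hYcard : Cardinal.lift.{1} (Order.succ ρ) ≤ #Y := by
    by_contra hc
    push Not at hc
    obtain ⟨z, hz, hz'⟩ := CBS.regbdd hregM (S := Y) (fun x hx => hx.1)
      (hc.trans (Cardinal.lift_lt.2 hsM))
    obtain ⟨y, h1, h2, h3⟩ := hiT z hz
    exact absurd (h3.trans_lt (hz' y ⟨h1, h2⟩)) (lt_irrefl _)
  obtain ⟨Y', hY', hY'c⟩ := Cardinal.le_mk_iff_exists_subset.1 hYcard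
  obtain ⟨z, hz, hz'⟩ := CBS.regbdd hregM (S := Y') (fun x hx => (hY' hx).1)
      (by rw [hY'c]; exact Cardinal.lift_lt.2 hsM)
  have h1 := (Cardinal.mk_le_mk_of_subset (show Y' ⊆ Y ∩ Set.Iio z from
    fun x hx => ⟨hY' hx, hz' x hx⟩)).trans (hsegY z hz)
  rw [hY'c, Cardinal.lift_le] at h1
  exact absurd (Order.lt_succ ρ) (not_lt.2 h1)
end


section
variable {κ μ : Cardinal.{0}} {θ : Ordinal.{0} → Cardinal.{0}}

def CBS.Ctx2.W2 (X : CBS.Ctx2 κ μ θ) (a i : Ordinal.{0}) : Set Ordinal.{0} :=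
  {c | c < a ∧ ∃ ν ∈ X.B, ν < κ.ord ∧ X.b ν < (θ i).ord ∧ X.F.e (X.p a) (X.p c) < ν ∧
    X.b (X.F.g (X.p c) ν) < (θ i).ord ∧
    ∀ c < a, ∀ c' < a, X.F.e (X.p a) (X.p c) < ν → X.F.e (X.p a) (X.p c') < ν →
      X.F.g (X.p c) ν = X.F.g (X.p c') ν → c = c'}

def CBS.Ctx2.W1 (X : CBS.Ctx2 κ μ θ) (a i : Ordinal.{0}) : Set Ordinal.{0} :=
  {c | c < a ∧ X.b (X.F.e (X.p a) (X.p c)) < (θ i).ord}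

def CBS.Ctx2.W0 (X : CBS.Ctx2 κ μ θ) (a i : Ordinal.{0}) : Set Ordinal.{0} :=
  X.W1 a i ∪ X.W2 a i

theorem CBS.Ctx2.W1_card (X : CBS.Ctx2 κ μ θ) {a i : Ordinal.{0}} (ha : a < (Order.succ μ).ord) :
    #(X.W1 a i) ≤ Cardinal.lift.{1} (θ i) := by
  have hpa := X.p_mem a ha
  have := CBS.mk_le_of_inj (S := X.W1 a i) (a := (θ i).ord) (fun c => X.b (X.F.e (X.p a) (X.p c)))
    (fun x hx => hx.2) (by
      intro x hx y hy h
      have hx' := X.p_mono hx.1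
      have hy' := X.p_mono hy.1
      have hpx := X.p_mem x (hx.1.trans ha)
      have hpy := X.p_mem y (hy.1.trans ha)
      have h1 := X.b_inj _ (X.Be _ hpa _ hpx hx') (X.F.e_lt _ (X.hB _ hpa) _ hx')
        _ (X.Be _ hpa _ hpy hy') (X.F.e_lt _ (X.hB _ hpa) _ hy') h
      exact X.p_mono.injective (X.F.e_inj _ (X.hB _ hpa) _ hx' _ hy' h1))
  rwa [Cardinal.card_ord] at this

theorem CBS.Ctx2.W2_card (X : CBS.Ctx2 κ μ θ) {a i : Ordinal.{0}} (ha : a < (Order.succ μ).ord)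
    (hi : i < μ.ord.cof.ord) : #(X.W2 a i) ≤ Cardinal.lift.{1} (θ i) := by
  have h0 : ∀ c : X.W2 a i, ∃ ν ∈ X.B, ν < κ.ord ∧ X.b ν < (θ i).ord ∧ X.F.e (X.p a) (X.p c) < ν ∧
    X.b (X.F.g (X.p c) ν) < (θ i).ord ∧
    ∀ c < a, ∀ c' < a, X.F.e (X.p a) (X.p c) < ν → X.F.e (X.p a) (X.p c') < ν →
      X.F.g (X.p c) ν = X.F.g (X.p c') ν → c = c' := fun c => c.2.2
  choose ν h1 h2 h3 h4 h5 h6 using h0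
  have h7 : #(X.W2 a i) ≤ #(Set.Iio (θ i).ord × Set.Iio (θ i).ord) := by
    refine Cardinal.mk_le_of_injective (f := fun c => (⟨_, h3 c⟩, ⟨_, h5 c⟩)) ?_
    intro x y h
    have h8 : X.b (ν x) = X.b (ν y) := congrArg (fun t => t.1.1) h
    have h9 : X.b (X.F.g (X.p x) (ν x)) = X.b (X.F.g (X.p y) (ν y)) := congrArg (fun t => t.2.1) h
    have h10 := X.b_inj _ (h1 x) (h2 x) _ (h1 y) (h2 y) h8
    have hpx := X.p_mem x.1 (x.2.1.trans ha)
    have hpy := X.p_mem y.1 (y.2.1.trans ha)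
    have h11 := X.b_inj _ (X.Bg _ hpx _ (h1 x) (h2 x)) (X.F.g_lt _ (X.hB _ hpx) _ (h2 x)) _
      (X.Bg _ hpy _ (h1 y) (h2 y)) (X.F.g_lt _ (X.hB _ hpy) _ (h2 y)) h9
    refine Subtype.ext (h6 x x.1 x.2.1 y.1 y.2.1 (h4 x) (h10 ▸ h4 y) ?_)
    rw [h11, h10]
  refine h7.trans ?_
  rw [Cardinal.mk_prod, CBS.mkIio, Cardinal.card_ord]
  simp only [Cardinal.lift_id]
  exact (Cardinal.mul_eq_self (Cardinal.aleph0_le_lift.2 (X.hθ i hi).1)).le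

theorem CBS.Ctx2.W0_card (X : CBS.Ctx2 κ μ θ) {a i : Ordinal.{0}} (ha : a < (Order.succ μ).ord)
    (hi : i < μ.ord.cof.ord) : #(X.W0 a i) ≤ Cardinal.lift.{1} (θ i) := by
  refine (Cardinal.mk_union_le _ _).trans ?_
  have h := Cardinal.add_eq_self (Cardinal.aleph0_le_lift.{0,1}.2 (X.hθ i hi).1)
  exact (add_le_add (X.W1_card ha) (X.W2_card ha hi)).trans h.le

theorem CBS.Ctx2.W0_lt (X : CBS.Ctx2 κ μ θ) {a i c : Ordinal.{0}} (h : c ∈ X.W0 a i) : c < a := by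
  rcases h with h | h <;> exact h.1

theorem CBS.Ctx2.W0_mono (X : CBS.Ctx2 κ μ θ) {a i j : Ordinal.{0}} (hij : i ≤ j)
    (hj : j < μ.ord.cof.ord) : X.W0 a i ⊆ X.W0 a j := by
  have h := Cardinal.ord_le_ord.2 (X.hθ2 i j hij hj)
  rintro c (⟨h1, h2⟩ | ⟨h1, ν, h2, h3, h4, h5, h6, h7⟩)
  · exact Or.inl ⟨h1, h2.trans_le h⟩
  · exact Or.inr ⟨h1, ν, h2, h3, h4.trans_le h, h5, h6.trans_le h, h7⟩

theorem CBS.Ctx2.W0_cov (X : CBS.Ctx2 κ μ θ) {a c : Ordinal.{0}} (ha : a < (Order.succ μ).ord)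
    (hc : c < a) : ∃ i < μ.ord.cof.ord, c ∈ X.W0 a i := by
  have hpa := X.p_mem a ha
  have hpc := X.p_mem c (hc.trans ha)
  obtain ⟨i, hi, h⟩ := X.idx (X.b_lt _ (X.Be _ hpa _ hpc (X.p_mono hc))
    (X.F.e_lt _ (X.hB _ hpa) _ (X.p_mono hc)))
  exact ⟨i, hi, Or.inl ⟨hc, h⟩⟩

theorem CBS.Ctx2.bddB (X : CBS.Ctx2 κ μ θ) {α : Ordinal.{0}}
    (hl : Order.IsSuccLimit α) {Q : Set Ordinal.{0}} (hQ : ∀ q ∈ Q, q ∈ X.B ∧ q < X.p α)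
    (hc : #Q < Cardinal.lift.{1} α.cof) : ∃ y < α, ∀ q ∈ Q, q < X.p y := by
  have h : ∀ q, ∃ x, q ∈ Q → x < α ∧ X.p x = q := by
    intro q
    by_cases hq : q ∈ Q
    · obtain ⟨x, hx, rfl⟩ := X.p_surj q (hQ q hq).1
      exact ⟨x, fun _ => ⟨X.p_mono.lt_iff_lt.1 (hQ _ hq).2, rfl⟩⟩
    · exact ⟨0, fun h => absurd h hq⟩
  choose r hr using h
  obtain ⟨y, hy, h⟩ := CBS.bdd (a := α) (S := r '' Q) (by rintro _ ⟨x, hx, rfl⟩; exact (hr x hx).1)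
    (Cardinal.mk_image_le.trans_lt hc)
  refine ⟨Order.succ y, hl.succ_lt hy, fun q hq => ?_⟩
  rw [← (hr q hq).2]
  exact X.p_mono (Order.lt_succ_of_le (h _ ⟨q, hq, rfl⟩))

theorem CBS.cof_le {κ : Cardinal.{0}} {a : Ordinal.{0}} (ha : a < (Order.succ κ).ord) : a.cof ≤ κ :=
  (Ordinal.cof_le_card a).trans (Order.lt_succ_iff.1 (Cardinal.lt_ord.1 ha))

theorem CBS.Ctx2.lims (X : CBS.Ctx2 κ μ θ) {α : Ordinal.{0}} (hα : α < (Order.succ μ).ord)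
    (hcof : μ.ord.cof < α.cof) (hl : Order.IsSuccLimit α) :
    Order.IsSuccLimit (X.p α) ∧ (X.p α).cof < κ := by
  have hpa := X.p_mem α hα
  constructor
  · rcases Ordinal.zero_or_succ_or_isSuccLimit (X.p α) with h | ⟨a, h⟩ | h
    · have := X.p_mono hl.bot_lt
      rw [h] at this
      exact absurd this (not_lt.2 zero_le)
    · replace h := h.symm
      have h1 := X.Bpred a (by rw [← h]; exact hpa)
      obtain ⟨x, hx, rfl⟩ := X.p_surj a h1
      have h2 : x < α := X.p_mono.lt_iff_lt.1 (by rw [h]; exact Order.lt_succ _)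
      have h3 := X.p_mono (hl.succ_lt h2)
      rw [h] at h3
      exact absurd (X.p_mono (Order.lt_succ x)) (not_lt.2 (Order.lt_succ_iff.1 h3))
    · exact h
  · refine lt_of_le_of_ne (CBS.cof_le (X.hB _ hpa)) ?_
    intro hk
    obtain ⟨E, hE, hE1, hE2⟩ := X.step3
    obtain ⟨y, hy, h⟩ := X.bddB hl (Q := X.F.D (X.p α) '' E) (by
      rintro _ ⟨ε, hε, rfl⟩
      have h1 : ε < (X.p α).cof.ord := by rw [hk]; exact (hE hε).2
      exact ⟨X.BD _ hpa _ (hE hε).1 h1, X.F.D_lt _ _ h1⟩)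
      ((Cardinal.mk_image_le.trans hE1).trans_lt (Cardinal.lift_lt.2 hcof))
    have hlt := X.p_mono hy
    have h2 := X.F.c_lt _ _ hlt
    obtain ⟨ε, hε, h3⟩ := hE2 _ (X.Bc _ hpa _ (X.p_mem y (hy.trans hα)) hlt) (by rw [hk] at h2; exact h2)
    have h4 : X.F.D (X.p α) (X.F.c (X.p α) (X.p y)) ≤ X.F.D (X.p α) ε := by
      rcases h3.lt_or_eq with h5 | h5
      · exact (X.F.D_mono _ _ _ h5 (by rw [hk]; exact (hE hε).2)).le
      · rw [h5]
    exact absurd ((X.F.c_le _ _ hlt).trans h4) (not_le.2 (h _ ⟨ε, hε, rfl⟩))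

theorem CBS.Ctx2.claim (X : CBS.Ctx2 κ μ θ) {α : Ordinal.{0}} (hα : α < (Order.succ μ).ord)
    (hcof : μ.ord.cof < α.cof) :
    ∃ Z ⊆ Set.Iio α, (∀ γ < α, ∃ z ∈ Z, γ ≤ z) ∧ ∀ β < α, β ≠ 0 →
      (∀ x < β, ∃ z ∈ Z, x < z ∧ z < β) → ∃ i < μ.ord.cof.ord, ∀ z ∈ Z, z < β → z ∈ X.W0 β i := by
  classical
  have hcl : ℵ₀ ≤ μ.ord.cof := Ordinal.aleph0_le_cof.2 (Cardinal.isSuccLimit_ord X.hμ)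
  have hl : Order.IsSuccLimit α := Ordinal.aleph0_le_cof.1 (hcl.trans hcof.le)
  obtain ⟨hlim, hck⟩ := X.lims hα hcof hl
  have hpa := X.p_mem α hα
  have hpK := X.hB _ hpa
  obtain ⟨ν0, hν0B, hν0⟩ : ∃ ν0 ∈ X.B, ν0 < κ.ord := by
    have h : #(X.B ∩ Set.Iio κ.ord : Set Ordinal.{0}) ≠ 0 := by
      rw [X.cardBK]
      exact (Cardinal.aleph0_pos.trans_le (Cardinal.aleph0_le_lift.2 X.hμ)).ne'
    obtain ⟨x⟩ := Cardinal.mk_ne_zero_iff.1 h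
    exact ⟨x.1, x.2.1, x.2.2⟩
  have hlB := X.Blam _ hpa
  have hlK : (X.p α).cof.ord < κ.ord := Cardinal.ord_lt_ord.2 hck
  set ν := X.F.N (X.p α) ν0 (X.p α).cof.ord with hν
  have hνB : ν ∈ X.B := X.BN _ hpa _ hν0B _ hlB hck hν0 hlK
  have hνK : ν < κ.ord := X.F.N_lt _ hpK hck _ hν0 _ hlK
  have N1 := X.F.N1 _ hpK hck hlim _ hν0
  have N2 := X.F.N2 _ hpK hck hlim _ hν0
  have N3 := X.F.N3 _ hpK hck hlim _ hν0
  have N3' := X.F.N3' _ hpK hck hlim _ hν0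
  have N4 := X.F.N4 _ hpK hck hlim _ hν0
  have hc' := X.F.c'_lt _ hpK hck hlim _ hν0
  rw [← hν] at N1 N2 N3 N3' N4 hc'
  let T : Set Ordinal.{0} := {z | z < α ∧ X.F.e (X.p α) (X.p z) < ν}
  have hT : ∀ γ < α, ∃ δ ∈ T, γ ≤ δ := by
    intro y hy
    have hlt := X.p_mono hy
    have h1 := X.F.c_lt _ _ hlt
    have h2 := X.BD _ hpa _ (X.Bc _ hpa _ (X.p_mem y (hy.trans hα)) hlt) h1
    obtain ⟨z, hz, h3⟩ := X.p_surj _ h2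
    refine ⟨z, ⟨X.p_mono.lt_iff_lt.1 ?_, ?_⟩, X.p_mono.le_iff_le.1 ?_⟩
    · rw [h3]; exact X.F.D_lt _ _ h1
    · rw [h3]; exact N3' _ h1
    · rw [h3]; exact X.F.c_le _ _ hlt
  have hidx : ∀ z, ∃ i, z ∈ T → i < μ.ord.cof.ord ∧ X.b (X.F.g (X.p z) ν) < (θ i).ord := by
    intro z
    by_cases hz : z ∈ T
    · have hpz := X.p_mem z (hz.1.trans hα)
      obtain ⟨i, hi⟩ := X.idx (X.b_lt _ (X.Bg _ hpz _ hνB hνK) (X.F.g_lt _ (X.hB _ hpz) _ hνK))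
      exact ⟨i, fun _ => hi⟩
    · exact ⟨0, fun h => absurd h hz⟩
  choose r hr using hidx
  obtain ⟨j, hj, hV⟩ := CBS.splitOrd hT r (fun t ht => (hr t ht).1) hcof
  let V : Set Ordinal.{0} := {z | z ∈ T ∧ r z = j}
  have hV' : ∀ γ < α, ∃ δ ∈ V, γ ≤ δ := by
    intro γ hγ
    obtain ⟨δ, h1, h2, h3⟩ := hV γ hγ
    exact ⟨δ, ⟨h1, h2⟩, h3⟩
  obtain ⟨D, hD1, hD2, hD3⟩ := CBS.fund α
  let Z : Set Ordinal.{0} := (fun x => CBS.pr V (D x)) '' Set.Iio α.cof.ord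
  have hZV : Z ⊆ V := by
    rintro _ ⟨x, hx, rfl⟩
    exact (CBS.pr_mem (hV' _ (hD1 x hx))).1
  have hZc : ∀ β < α, #(Z ∩ Set.Iio β : Set Ordinal.{0}) < Cardinal.lift.{1} α.cof := by
    intro β hβ
    obtain ⟨x0, hx0, h0⟩ := hD3 β hβ
    have : (Z ∩ Set.Iio β : Set Ordinal.{0}) ⊆ (fun x => CBS.pr V (D x)) '' Set.Iio x0 := by
      rintro _ ⟨⟨x, hx, rfl⟩, h1⟩
      refine ⟨x, ?_, rfl⟩
      by_contra h2
      have h3 : D x0 ≤ D x := by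
        rcases (not_lt.1 (fun h => h2 h) : x0 ≤ x).lt_or_eq with h | h
        · exact (hD2 _ _ h hx).le
        · exact le_of_eq (congrArg D h)
      exact absurd (h1 : CBS.pr V (D x) < β)
        (not_lt.2 (h0.trans (h3.trans (CBS.pr_mem (hV' _ (hD1 x hx))).2)))
    refine ((Cardinal.mk_le_mk_of_subset this).trans Cardinal.mk_image_le).trans_lt ?_
    rw [CBS.mkIio]
    exact Cardinal.lift_lt.2 (Cardinal.lt_ord.1 hx0)
  refine ⟨Z, fun z hz => (hZV hz).1.1, ?_, ?_⟩
  · intro γ hγ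
    obtain ⟨x, hx, h⟩ := hD3 γ hγ
    exact ⟨_, ⟨x, hx, rfl⟩, h.trans (CBS.pr_mem (hV' _ (hD1 x hx))).2⟩
  intro β hβ hβ0 hβl
  have hβM := hβ.trans hα
  have hpb := X.p_mem β hβM
  have hba := X.p_mono hβ
  have hin : X.F.e (X.p α) (X.p β) < ν := by
    by_contra hnot
    let S : Set Ordinal.{0} := {γ | γ < X.p α ∧ X.F.e (X.p α) γ < ν ∧ X.p β ≤ γ}
    have hSne : S.Nonempty := by
      obtain ⟨δ, h1, h2⟩ := hT β hβ
      exact ⟨X.p δ, X.p_mono h1.1, h1.2, X.p_mono.le_iff_le.2 h2⟩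
    obtain ⟨γ, hγ⟩ : ∃ γ, γ = sInf S := ⟨_, rfl⟩
    have hγS : γ ∈ S := hγ ▸ csInf_mem hSne
    have hγB : γ ∈ X.B := by
      rw [hγ]; exact X.Bm _ hpa _ hνB _ hpb (by have := hγS.1; rw [hγ] at this; exact this)
    have hγβ : X.p β < γ := lt_of_le_of_ne hγS.2.2 (fun h => hnot (by rw [h]; exact hγS.2.1))
    have hmin : ∀ a < γ, X.F.e (X.p α) a < ν → a < X.p β := by
      intro a ha h1
      by_contra h2
      exact absurd ha (not_lt.2 (hγ ▸ csInf_le' (show a ∈ S from ⟨ha.trans hγS.1, h1, not_lt.1 h2⟩)))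
    have hγK := X.hB _ hγB
    have hγc : γ.cof = κ := by
      by_contra hne
      have hlt := lt_of_le_of_ne (CBS.cof_le hγK) hne
      have h1 := X.F.c_lt _ _ hγβ
      have h2 := N3 γ hγS.1 hγS.2.1 _ h1 (h1.trans (N2 γ hγS.1 hγS.2.1 hlt))
      exact absurd (hmin _ (X.F.D_lt _ _ h1) h2) (not_lt.2 (X.F.c_le _ _ hγβ))
    have hz : ∀ z ∈ Z, z < β → X.p z ∈ X.B ∧ X.p z < γ ∧ X.F.c γ (X.p z) ∈ X.B ∧
        X.F.c γ (X.p z) < ν := by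
      intro z hz hzβ
      have h1 := (hZV hz).1
      have h2 := X.p_mem z (h1.1.trans hα)
      have h3 := (X.p_mono hzβ).trans hγβ
      exact ⟨h2, h3, X.Bc _ hγB _ h2 h3, N4 γ hγS.1 hγS.2.1 _ h3 h1.2⟩
    obtain ⟨y, hy, hQ⟩ := X.bddB hl
      (Q := (fun z => X.F.D (X.p α) (X.F.c' (X.p α) ν0 (X.F.c γ (X.p z)))) '' (Z ∩ Set.Iio β)) (by
        rintro _ ⟨z, ⟨h1, h2⟩, rfl⟩
        obtain ⟨h3, h4, h5, h6⟩ := hz z h1 h2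
        have h7 := (hc' _ h6).1
        exact ⟨X.BD _ hpa _ (X.Bc' _ hpa _ hν0B _ h5 h7) h7, X.F.D_lt _ _ h7⟩)
      (Cardinal.mk_image_le.trans_lt (hZc β hβ))
    have hlt := X.p_mono hy
    have hξ := X.F.c_lt _ _ hlt
    set ξ := X.F.c (X.p α) (X.p y) with hξd
    have hξB : ξ ∈ X.B := X.Bc _ hpa _ (X.p_mem y (hy.trans hα)) hlt
    have hx : X.F.N (X.p α) ν0 ξ < ν := X.F.N_mono _ hpK hck _ hν0 _ _ hξ
    have hxB : X.F.N (X.p α) ν0 ξ ∈ X.B := X.BN _ hpa _ hν0B _ hξB hck hν0 (hξ.trans hlK)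
    set x := X.F.N (X.p α) ν0 ξ with hxd
    have hxc : x < γ.cof.ord := by rw [hγc]; exact hx.trans hνK
    have h1 := hmin _ (X.F.D_lt γ x hxc) (N3 γ hγS.1 hγS.2.1 _ hxc hx)
    obtain ⟨w, hw, hw'⟩ := X.p_surj _ (X.BD _ hγB _ hxB hxc)
    have hwβ : w < β := X.p_mono.lt_iff_lt.1 (by rw [hw']; exact h1)
    obtain ⟨z, hzZ, hwz, hzβ⟩ := hβl w hwβ
    obtain ⟨h3, h4, h5, h6⟩ := hz z hzZ hzβ
    have h7 : X.F.D γ x < X.F.D γ (X.F.c γ (X.p z)) := by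
      rw [← hw']; exact (X.p_mono hwz).trans_le (X.F.c_le _ _ h4)
    have h8 : x < X.F.c γ (X.p z) := by
      by_contra h
      rcases (not_lt.1 h).lt_or_eq with h' | h'
      · exact absurd h7 (not_lt.2 (X.F.D_mono _ _ _ h' hxc).le)
      · rw [h'] at h7; exact lt_irrefl _ h7
    have h9 := hc' _ h6
    have h10 : ξ < X.F.c' (X.p α) ν0 (X.F.c γ (X.p z)) := by
      by_contra h
      have h11 := h8.trans h9.2
      rcases (not_lt.1 h).lt_or_eq with h' | h'
      · exact absurd h11 (not_lt.2 (X.F.N_mono _ hpK hck _ hν0 _ _ h').le)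
      · rw [h', ← hxd] at h11; exact lt_irrefl _ h11
    have h11 := X.F.D_mono _ _ _ h10 h9.1
    have h12 := hQ _ ⟨z, ⟨hzZ, hzβ⟩, rfl⟩
    exact absurd ((X.F.c_le _ _ hlt).trans_lt (h11.trans h12)) (lt_irrefl _)
  obtain ⟨i, hi, hi'⟩ := X.idx (X.b_lt _ hνB hνK)
  have hmx : max i j < μ.ord.cof.ord := max_lt hi hj
  refine ⟨max i j, hmx, fun z hz hzβ => Or.inr ⟨hzβ, ν, hνB, hνK, ?_, ?_, ?_, ?_⟩⟩
  · exact hi'.trans_le (Cardinal.ord_le_ord.2 (X.hθ2 _ _ (le_max_left _ _) hmx))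
  · exact (N1 _ hba hin _ (X.p_mono hzβ)).1 (hZV hz).1.2
  · have h1 := (hr z (hZV hz).1).2
    rw [(hZV hz).2] at h1
    exact h1.trans_le (Cardinal.ord_le_ord.2 (X.hθ2 _ _ (le_max_right _ _) hmx))
  · have key : ∀ c < β, ∀ c' < c, X.F.e (X.p β) (X.p c) < ν → X.F.e (X.p β) (X.p c') < ν →
        X.F.g (X.p c') ν < X.F.g (X.p c) ν := by
      intro c hc d hd h1 h2
      have h3 := (N1 _ hba hin _ (X.p_mono hc)).2 h1
      have h4 := (N1 _ hba hin _ (X.p_mono (hd.trans hc))).2 h2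
      have h5 := (N1 _ ((X.p_mono hc).trans hba) h3 _ (X.p_mono hd)).1 h4
      exact X.F.g_gt _ (X.hB _ (X.p_mem c (hc.trans hβM))) _ hνK _ (X.p_mono hd) h5
    intro c hc d hd h1 h2 h3
    rcases lt_trichotomy c d with h | h | h
    · exact absurd h3 (key d hd c h h2 h1).ne
    · exact h
    · exact absurd h3 (key c hc d h h1 h2).ne'

theorem CBS.Ctx2.exists_W (X : CBS.Ctx2 κ μ θ) : ∃ W, CBS.WSys μ θ W := by
  classical
  have hcl : ℵ₀ ≤ μ.ord.cof := Ordinal.aleph0_le_cof.2 (Cardinal.isSuccLimit_ord X.hμ)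
  let LL : Ordinal.{0} → Ordinal.{0} → Set Ordinal.{0} := fun a i =>
    {γ | γ < a ∧ (γ ≠ 0 ∧ ∀ x < γ, ∃ w ∈ X.W0 a i, x < w ∧ w < γ)}
  refine ⟨fun a i => X.W0 a i ∪ LL a i, ?_, ?_, ?_, ?_, ?_⟩
  · intro a ha i hi
    have hθ0 := Cardinal.aleph0_le_lift.{0,1}.2 (X.hθ i hi).1
    have h0 := X.W0_card ha hi
    have h1 : #(LL a i) ≤ Cardinal.lift.{1} (θ i) := by
      let S : Set Ordinal.{0} := X.W0 a i ∪ {a}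
      have hS : #S ≤ Cardinal.lift.{1} (θ i) := by
        refine (Cardinal.mk_union_le _ _).trans ?_
        rw [Cardinal.mk_singleton]
        exact (add_le_add h0 ((Cardinal.one_lt_aleph0.le).trans hθ0)).trans
          (Cardinal.add_eq_self hθ0).le
      have hm : ∀ γ : LL a i, CBS.pr S γ.1 ∈ S ∧ γ.1 ≤ CBS.pr S γ.1 := fun γ =>
        CBS.pr_mem ⟨a, Or.inr rfl, γ.2.1.le⟩
      have hlt : ∀ x y : LL a i, x.1 < y.1 → CBS.pr S x.1 ≠ CBS.pr S y.1 := by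
        intro x y hxy
        obtain ⟨w, hw, h2, h3⟩ := y.2.2.2 x.1 hxy
        exact ((CBS.pr_le (Or.inl hw) h2.le).trans_lt (h3.trans_le (hm y).2)).ne
      refine (Cardinal.mk_le_of_injective (f := fun γ : LL a i => (⟨_, (hm γ).1⟩ : S)) ?_).trans hS
      intro x y h
      have h := congrArg Subtype.val h
      rcases lt_trichotomy x.1 y.1 with h' | h' | h'
      · exact absurd h (hlt x y h')
      · exact Subtype.ext h'
      · exact absurd h.symm (hlt y x h')
    exact (Cardinal.mk_union_le _ _).trans ((add_le_add h0 h1).trans (Cardinal.add_eq_self hθ0).le)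
  · rintro a i c (h | h)
    · exact X.W0_lt h
    · exact h.1
  · rintro a ha i j hij hj c (h | ⟨h1, h2, h3⟩)
    · exact Or.inl (X.W0_mono hij hj h)
    · refine Or.inr ⟨h1, h2, fun x hx => ?_⟩
      obtain ⟨w, hw, h⟩ := h3 x hx
      exact ⟨w, X.W0_mono hij hj hw, h⟩
  · intro a ha γ hγ
    obtain ⟨i, hi, h⟩ := X.W0_cov ha hγ
    exact ⟨i, hi, Or.inl h⟩
  · intro α hα hcof
    have hl : Order.IsSuccLimit α := Ordinal.aleph0_le_cof.1 (hcl.trans hcof.le)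
    obtain ⟨Z, hZ, hZ1, hZ2⟩ := X.claim hα hcof
    refine ⟨{β | β < α ∧ (β ≠ 0 ∧ ∀ x < β, ∃ z ∈ Z, x < z ∧ z < β)}, ⟨fun β h => h.1, ?_, ?_⟩, ?_⟩
    · intro β hβ h0 hsup
      refine ⟨hβ, h0.ne', fun x hx => ?_⟩
      rw [← hsup] at hx
      obtain ⟨c, ⟨⟨h1, h2, h3⟩, h4⟩, hxc⟩ := exists_lt_of_lt_csSup' hx
      obtain ⟨z, hz, h5, h6⟩ := h3 x hxc
      exact ⟨z, hz, h5, h6.trans h4⟩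
    · intro γ hγ
      have hstep : ∀ y, ∃ z, y < α → z ∈ Z ∧ y < z := by
        intro y
        by_cases hy : y < α
        · obtain ⟨z, h1, h2⟩ := hZ1 _ (hl.succ_lt hy)
          exact ⟨z, fun _ => ⟨h1, Order.succ_le_iff.1 h2⟩⟩
        · exact ⟨0, fun h => absurd h hy⟩
      choose s hs using hstep
      let q : ℕ → Ordinal.{0} := fun n => Nat.rec (s γ) (fun _ y => s y) n
      have hq0 : ∀ n, q n ∈ Z := by
        intro n
        induction n with
        | zero => exact (hs γ hγ).1
        | succ n ih => exact (hs _ (hZ ih)).1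
      have hq1 : ∀ n, q n < q (n + 1) := fun n => (hs _ (hZ (hq0 n))).2
      have hbdd : BddAbove (Set.range q) := ⟨α, by rintro _ ⟨n, rfl⟩; exact (hZ (hq0 n)).le⟩
      have hle : ∀ n, q n < sSup (Set.range q) := fun n =>
        (hq1 n).trans_le (le_csSup hbdd ⟨n + 1, rfl⟩)
      have hγ' : γ < sSup (Set.range q) := (hs γ hγ).2.trans (hle 0)
      refine ⟨sSup (Set.range q), ⟨?_, ?_, ?_⟩, hγ'.le⟩
      · obtain ⟨b, hb, hb'⟩ := CBS.bdd (a := α) (S := Set.range q)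
          (by rintro _ ⟨n, rfl⟩; exact hZ (hq0 n)) (by
            have h1 : #(Set.range q) ≤ ℵ₀ := (Set.countable_range q).le_aleph0
            exact h1.trans_lt (Cardinal.aleph0_lt_lift.2 (hcl.trans_lt hcof)))
        exact (csSup_le' (fun x hx => hb' x hx)).trans_lt hb
      · exact (zero_le.trans_lt hγ').ne'
      · intro x hx
        obtain ⟨_, ⟨n, rfl⟩, h⟩ := exists_lt_of_lt_csSup' hx
        exact ⟨q n, hq0 n, h, hle n⟩
    · rintro β ⟨hβ, hβ0, hβl⟩
      obtain ⟨i, hi, h⟩ := hZ2 β hβ hβ0 hβl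
      refine ⟨i, hi, ?_⟩
      rintro γ ⟨h1, h2, h3⟩ hγβ
      refine Or.inr ⟨hγβ, h2, fun x hx => ?_⟩
      obtain ⟨z, hz, h4, h5⟩ := h3 x hx
      exact ⟨z, h z hz (h5.trans hγβ), h4, h5⟩
end

theorem cc_better_scale (κ μ : Cardinal.{0})
    (hκ : κ.IsRegular) (hμ : ℵ₀ ≤ μ) (hμsing : μ.ord.cof < μ) (hμκ : μ < κ)
    (hcc : ChangCC (Order.succ κ) κ (Order.succ μ) μ) :
    ∃ μs f, IsScale μ μs f ∧
      ∀ α < (Order.succ μ).ord, μ.ord.cof < α.cof → BetterAt μ f α := by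
  obtain ⟨θ, h1, h2, h3⟩ := CBS.theta hμ hμsing
  obtain ⟨X⟩ := CBS.ctx hκ hμ hμsing hμκ hcc
  obtain ⟨Y⟩ := X.ctx2 h1 h2 h3
  obtain ⟨W, hW⟩ := Y.exists_W
  exact CBS.final hμ hμsing h1 h3 hW
end
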